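/- arXiv:2002.12722 — 4 statements merged into one kernel-verified Lean document; each statement's English description precedes it below -/
import Mathlib

section
/- For every j ∈ L∖{1}: E_j[N_j] = (Σ_{g∈G(1,j)} π(g)) / (Σ_{g∈G(1)} π(g)), and also E_j[N_j] = λ_j · (E_j[T_1] + E_1[T_j]). -/
open MeasureTheory
open scoped ENNReal Classical

namespace FW

/-- `g` represents a `W`-graph on `Fin l`: the arrows are `i → g i` for `i ∉ W`
(we normalize `g i = i` on `W`). -/
def IsWGraph {l : ℕ} (W : Finset (Fin l)) (g : Fin l → Fin l) : Prop :=
  (∀ i ∈ W, g i = i) ∧ ∀ i ∉ W, g i ≠ i ∧ ∃ n : ℕ, g^[n] i ∈ W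

/-- `Σ_{g ∈ G(W)} π(g)` where `π(g) = ∏_{(i→j) ∈ g} p_{ij}`. -/
noncomputable def graphSum {l : ℕ} (p : Fin l → Fin l → ℝ≥0∞) (W : Finset (Fin l)) : ℝ≥0∞ :=
  ∑ g ∈ Finset.univ.filter (IsWGraph W), ∏ i ∈ Wᶜ, p i (g i)

/-- `n`-step transition probabilities. -/
noncomputable def matPow {l : ℕ} (p : Fin l → Fin l → ℝ≥0∞) : ℕ → Fin l → Fin l → ℝ≥0∞
  | 0 => fun i j => if i = j then 1 else 0
  | n + 1 => fun i j => ∑ k, matPow p n i k * p k j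

/-- Irreducibility of the transition matrix `p`. -/
def Irreducible {l : ℕ} (p : Fin l → Fin l → ℝ≥0∞) : Prop :=
  ∀ i j : Fin l, ∃ n : ℕ, 0 < matPow p n i j

/-- `P` is the family of path laws of the Markov chain with one-step transition
probabilities `p`: `P i` is a probability measure on paths, and the probability of every
cylinder set is `1_{s 0 = i} · ∏_k p_{s k, s (k+1)}`. -/
def IsMarkovChainLaw {l : ℕ} (p : Fin l → Fin l → ℝ≥0∞)
    (P : Fin l → Measure (ℕ → Fin l)) : Prop :=
  (∀ i, IsProbabilityMeasure (P i)) ∧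
    ∀ (i : Fin l) (n : ℕ) (s : ℕ → Fin l),
      P i {ω | ∀ k ≤ n, ω k = s k} =
        (if s 0 = i then 1 else 0) * ∏ k ∈ Finset.range n, p (s k) (s (k + 1))

/-- First hitting time `T_j = inf {n ≥ 0 : ω n = j}` (with value `∞` if the set is empty). -/
noncomputable def hitT {l : ℕ} (j : Fin l) (ω : ℕ → Fin l) : ℝ≥0∞ :=
  ⨅ n ∈ {n : ℕ | ω n = j}, (n : ℝ≥0∞)

/-- First return time `T_j⁺ = inf {n ≥ 1 : ω n = j}`. -/
noncomputable def hitTpos {l : ℕ} (j : Fin l) (ω : ℕ → Fin l) : ℝ≥0∞ :=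
  ⨅ n ∈ {n : ℕ | 1 ≤ n ∧ ω n = j}, (n : ℝ≥0∞)

/-- `N̂ = inf {n ≥ 0 : ω n ≠ o}`, the first visit to a state other than `o`. -/
noncomputable def exitT {l : ℕ} (o : Fin l) (ω : ℕ → Fin l) : ℝ≥0∞ :=
  ⨅ n ∈ {n : ℕ | ω n ≠ o}, (n : ℝ≥0∞)

/-- `N = inf {n ≥ N̂ : ω n = o}`, the first visit to `o` after `N̂`. -/
noncomputable def retT {l : ℕ} (o : Fin l) (ω : ℕ → Fin l) : ℝ≥0∞ :=
  ⨅ n ∈ {n : ℕ | exitT o ω ≤ (n : ℝ≥0∞) ∧ ω n = o}, (n : ℝ≥0∞)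

/-- `N_j = |{n ≥ 0 : n < N and ω n = j}|`, the number of visits (including time 0)
to `j` before `N`. -/
noncomputable def numVisits {l : ℕ} (o j : Fin l) (ω : ℕ → Fin l) : ℝ≥0∞ :=
  ∑' n : ℕ, if (n : ℝ≥0∞) < retT o ω ∧ ω n = j then 1 else 0

/-- `b` is reachable from `a` by following the arrows of `g`. -/
def Leads {l : ℕ} (g : Fin l → Fin l) (a b : Fin l) : Prop := ∃ n : ℕ, g^[n] a = b

theorem iterate_fix {l : ℕ} {g : Fin l → Fin l} {w : Fin l} (h : g w = w) (n : ℕ) :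
    g^[n] w = w := Function.iterate_fixed h n

theorem Leads.trans {l : ℕ} {g : Fin l → Fin l} {a b c : Fin l} (h1 : Leads g a b)
    (h2 : Leads g b c) : Leads g a c := by
  obtain ⟨n, rfl⟩ := h1
  obtain ⟨m, rfl⟩ := h2
  exact ⟨m + n, Function.iterate_add_apply _ _ _ _⟩

theorem Leads.step {l : ℕ} {g : Fin l → Fin l} {a b : Fin l} (h1 : Leads g (g a) b) :
    Leads g a b := by
  obtain ⟨n, rfl⟩ := h1
  exact ⟨n + 1, Function.iterate_succ_apply _ _ _⟩

theorem Leads.unstep {l : ℕ} {g : Fin l → Fin l} {a b : Fin l} (h1 : Leads g a b)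
    (hab : a ≠ b) : Leads g (g a) b := by
  obtain ⟨n, hn⟩ := h1
  cases n with
  | zero => exact absurd hn hab
  | succ n => exact ⟨n, by rwa [Function.iterate_succ_apply] at hn⟩

/-- If `k` leads to `i` and to the fixed point `w`, then `i` leads to `w`. -/
theorem Leads.confl {l : ℕ} {g : Fin l → Fin l} {k i w : Fin l} (hw : g w = w)
    (h1 : Leads g k i) (h2 : Leads g k w) : Leads g i w := by
  obtain ⟨a, rfl⟩ := h1
  obtain ⟨b, hb⟩ := h2
  refine ⟨b, ?_⟩
  rw [← Function.iterate_add_apply, add_comm, Function.iterate_add_apply, hb, iterate_fix hw]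

theorem Leads.of_fix {l : ℕ} {g : Fin l → Fin l} {w v : Fin l} (hw : g w = w)
    (h : Leads g w v) : w = v := by
  obtain ⟨a, rfl⟩ := h
  exact (iterate_fix hw a).symm

/-- A state leading to a fixed point other than itself is not on a cycle. -/
theorem not_leads_self {l : ℕ} {g : Fin l → Fin l} {i w : Fin l} (hw : g w = w)
    (h : Leads g i w) (hi : i ≠ w) : ¬ Leads g (g i) i := by
  rintro ⟨n, hn⟩
  obtain ⟨m, hm⟩ := h
  have hp : g^[n + 1] i = i := by rw [Function.iterate_succ_apply, hn]
  have h1 : g^[(n + 1) * m] i = i := by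
    rw [Function.iterate_mul]; exact iterate_fix (g := g^[n+1]) hp m |>.trans rfl
  apply hi
  rw [← h1]
  have : (n + 1) * m = n * m + m := by ring
  rw [this, Function.iterate_add_apply, hm, iterate_fix hw]

theorem iterate_update {l : ℕ} {g : Fin l → Fin l} {i k a : Fin l} (h : ¬ Leads g a i) (n : ℕ) :
    (Function.update g i k)^[n] a = g^[n] a := by
  induction n with
  | zero => rfl
  | succ n ih =>
    rw [Function.iterate_succ_apply', Function.iterate_succ_apply', ih,
      Function.update_of_ne]
    intro hh
    exact h ⟨n, hh⟩

theorem leads_update_iff {l : ℕ} {g : Fin l → Fin l} {i k a b : Fin l} (h : ¬ Leads g a i) :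
    Leads (Function.update g i k) a b ↔ Leads g a b := by
  unfold Leads
  simp only [iterate_update h]

theorem leads_update_self {l : ℕ} {g : Fin l → Fin l} {i k a : Fin l} (h : Leads g a i) :
    Leads (Function.update g i k) a i := by
  obtain ⟨n, hn⟩ := h
  induction n generalizing a with
  | zero => exact ⟨0, hn⟩
  | succ n ih =>
    by_cases hai : a = i
    · exact ⟨0, hai⟩
    · apply Leads.step
      rw [Function.update_of_ne hai]
      exact ih hn

theorem isWGraph_leads {l : ℕ} {W : Finset (Fin l)} {g : Fin l → Fin l} (hg : IsWGraph W g)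
    (i : Fin l) : ∃ w ∈ W, Leads g i w := by
  by_cases hi : i ∈ W
  · exact ⟨i, hi, 0, rfl⟩
  · obtain ⟨n, hn⟩ := (hg.2 i hi).2
    exact ⟨_, hn, n, rfl⟩

theorem isWGraph_not_cycle {l : ℕ} {W : Finset (Fin l)} {g : Fin l → Fin l} (hg : IsWGraph W g)
    {i : Fin l} (hi : i ∉ W) : ¬ Leads g (g i) i := by
  obtain ⟨w, hw, h⟩ := isWGraph_leads hg i
  exact not_leads_self (hg.1 w hw) h (fun e => hi (by rw [e]; exact hw))

theorem isWGraph_mk {l : ℕ} {W : Finset (Fin l)} {g : Fin l → Fin l}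
    (h1 : ∀ i ∈ W, g i = i) (h2 : ∀ i ∉ W, g i ≠ i ∧ ∃ w ∈ W, Leads g i w) : IsWGraph W g := by
  refine ⟨h1, fun i hi => ⟨(h2 i hi).1, ?_⟩⟩
  obtain ⟨w, hw, n, rfl⟩ := (h2 i hi).2
  exact ⟨n, hw⟩

theorem isWGraph_update {l : ℕ} {W : Finset (Fin l)} {g : Fin l → Fin l} (hg : IsWGraph W g)
    {i k : Fin l} (hi : i ∉ W) (hk : ¬ Leads g k i) : IsWGraph W (Function.update g i k) := by
  have hi' : ∃ w ∈ W, Leads (Function.update g i k) i w := by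
    obtain ⟨w, hw, h⟩ := isWGraph_leads hg k
    refine ⟨w, hw, Leads.step ?_⟩
    rw [Function.update_self, leads_update_iff hk]
    exact h
  apply isWGraph_mk
  · intro a ha
    have hai : a ≠ i := fun e => hi (e ▸ ha)
    rw [Function.update_of_ne hai, hg.1 a ha]
  · intro a ha
    refine ⟨?_, ?_⟩
    · by_cases hai : a = i
      · subst hai
        rw [Function.update_self]
        exact fun e => hk ⟨0, e⟩
      · rw [Function.update_of_ne hai]
        exact (hg.2 a ha).1
    · by_cases hai : Leads g a i
      · obtain ⟨w, hw, h⟩ := hi'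
        exact ⟨w, hw, (leads_update_self hai).trans h⟩
      · obtain ⟨w, hw, h⟩ := isWGraph_leads hg a
        exact ⟨w, hw, (leads_update_iff hai).2 h⟩

theorem prod_update {l : ℕ} (p : Fin l → Fin l → ℝ≥0∞) {W : Finset (Fin l)} {g : Fin l → Fin l}
    {i k : Fin l} (hi : i ∉ W) :
    (∏ a ∈ Wᶜ, p a (Function.update g i k a)) * p i (g i) = (∏ a ∈ Wᶜ, p a (g a)) * p i k := by
  have hi' : i ∈ Wᶜ := by simpa using hi
  rw [← Finset.mul_prod_erase _ _ hi', ← Finset.mul_prod_erase _ _ hi', Function.update_self]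
  have : ∏ x ∈ Wᶜ.erase i, p x (Function.update g i k x) = ∏ x ∈ Wᶜ.erase i, p x (g x) := by
    apply Finset.prod_congr rfl
    intro x hx
    rw [Function.update_of_ne (Finset.ne_of_mem_erase hx)]
  rw [this]
  ring

/-- The swapping involution on pairs (graph, extra arrow out of `i`). -/
noncomputable def swapArrow {l : ℕ} (i : Fin l) (x : (Fin l → Fin l) × Fin l) :
    (Fin l → Fin l) × Fin l :=
  if Leads x.1 x.2 i then x else (Function.update x.1 i x.2, x.1 i)

theorem swapArrow_swapArrow {l : ℕ} {W : Finset (Fin l)} {i : Fin l} (hi : i ∉ W)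
    {x : (Fin l → Fin l) × Fin l} (hx : IsWGraph W x.1) : swapArrow i (swapArrow i x) = x := by
  by_cases h : Leads x.1 x.2 i
  · simp [swapArrow, h]
  · have h1 : ¬ Leads x.1 (x.1 i) i := isWGraph_not_cycle hx hi
    have h2 : ¬ Leads (Function.update x.1 i x.2) (x.1 i) i := by rwa [leads_update_iff h1]
    have : swapArrow i x = (Function.update x.1 i x.2, x.1 i) := by simp [swapArrow, h]
    rw [this]
    simp [swapArrow, h2]

theorem swap_sum {l : ℕ} (p : Fin l → Fin l → ℝ≥0∞) {W : Finset (Fin l)} {i w : Fin l}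
    (hi : i ∉ W) (hw : w ∈ W) :
    ∑ x ∈ ((Finset.univ.filter (IsWGraph W)) ×ˢ Finset.univ).filter
        (fun x : (Fin l → Fin l) × Fin l => Leads x.1 x.2 w),
          (∏ a ∈ Wᶜ, p a (x.1 a)) * p i x.2 =
    ∑ x ∈ ((Finset.univ.filter (IsWGraph W)) ×ˢ Finset.univ).filter
        (fun x : (Fin l → Fin l) × Fin l => Leads x.1 i w),
          (∏ a ∈ Wᶜ, p a (x.1 a)) * p i x.2 := by
  have hiw : i ≠ w := fun e => hi (e ▸ hw)
  apply Finset.sum_nbij' (swapArrow i) (swapArrow i)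
  · rintro ⟨g, k⟩ hx
    simp only [Finset.mem_filter, Finset.mem_product, Finset.mem_univ, true_and, and_true] at hx ⊢
    obtain ⟨hg, hk⟩ := hx
    by_cases h : Leads g k i
    · simp only [swapArrow, h, if_true]
      exact ⟨hg, Leads.confl (hg.1 w hw) h hk⟩
    · simp only [swapArrow, h, if_false]
      refine ⟨isWGraph_update hg hi h, Leads.step ?_⟩
      rwa [Function.update_self, leads_update_iff h]
  · rintro ⟨g, k⟩ hx
    simp only [Finset.mem_filter, Finset.mem_product, Finset.mem_univ, true_and, and_true] at hx ⊢
    obtain ⟨hg, hk⟩ := hx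
    by_cases h : Leads g k i
    · simp only [swapArrow, h, if_true]
      exact ⟨hg, h.trans hk⟩
    · simp only [swapArrow, h, if_false]
      refine ⟨isWGraph_update hg hi h, ?_⟩
      rw [leads_update_iff (isWGraph_not_cycle hg hi)]
      exact hk.unstep hiw
  · rintro ⟨g, k⟩ hx
    simp only [Finset.mem_filter, Finset.mem_product, Finset.mem_univ, true_and, and_true] at hx
    exact swapArrow_swapArrow hi hx.1
  · rintro ⟨g, k⟩ hx
    simp only [Finset.mem_filter, Finset.mem_product, Finset.mem_univ, true_and, and_true] at hx
    exact swapArrow_swapArrow hi hx.1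
  · rintro ⟨g, k⟩ hx
    by_cases h : Leads g k i
    · simp only [swapArrow, h, if_true]
    · simp only [swapArrow, h, if_false]
      exact (prod_update p hi).symm

/-- Total weight of the `W`-graphs in which `i` leads to `w`. -/
noncomputable def leadSum {l : ℕ} (p : Fin l → Fin l → ℝ≥0∞) (W : Finset (Fin l))
    (w i : Fin l) : ℝ≥0∞ :=
  ∑ g ∈ Finset.univ.filter (IsWGraph W), if Leads g i w then ∏ a ∈ Wᶜ, p a (g a) else 0

theorem sum_p_leadSum {l : ℕ} (p : Fin l → Fin l → ℝ≥0∞) (W : Finset (Fin l))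
    (w i : Fin l) : ∑ k, p i k * leadSum p W w k =
    ∑ x ∈ ((Finset.univ.filter (IsWGraph W)) ×ˢ Finset.univ).filter
        (fun x : (Fin l → Fin l) × Fin l => Leads x.1 x.2 w),
          (∏ a ∈ Wᶜ, p a (x.1 a)) * p i x.2 := by
  rw [Finset.sum_filter, Finset.sum_product_right]
  apply Finset.sum_congr rfl
  intro k _
  unfold leadSum
  rw [Finset.mul_sum]
  apply Finset.sum_congr rfl
  intro g _
  split_ifs
  · rw [mul_comm]
  · simp

theorem leadSum_harmonic {l : ℕ} (p : Fin l → Fin l → ℝ≥0∞) (hrow : ∀ i, ∑ j, p i j = 1)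
    {W : Finset (Fin l)} {i w : Fin l} (hi : i ∉ W) (hw : w ∈ W) :
    leadSum p W w i = ∑ k, p i k * leadSum p W w k := by
  rw [sum_p_leadSum, swap_sum p hi hw, Finset.sum_filter, Finset.sum_product]
  unfold leadSum
  apply Finset.sum_congr rfl
  intro g _
  split_ifs
  · simp only
    rw [← Finset.mul_sum, hrow, mul_one]
  · simp

theorem leadSum_self {l : ℕ} (p : Fin l → Fin l → ℝ≥0∞) (W : Finset (Fin l)) (w : Fin l) :
    leadSum p W w w = graphSum p W := by
  unfold leadSum graphSum
  apply Finset.sum_congr rfl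
  intro g _
  rw [if_pos ⟨0, rfl⟩]

theorem leadSum_other {l : ℕ} (p : Fin l → Fin l → ℝ≥0∞) {W : Finset (Fin l)} {w v : Fin l}
    (hv : v ∈ W) (hvw : v ≠ w) : leadSum p W w v = 0 := by
  unfold leadSum
  apply Finset.sum_eq_zero
  intro g hg
  rw [if_neg]
  intro h
  exact hvw (h.of_fix ((Finset.mem_filter.1 hg).2.1 v hv))

theorem leadSum_add {l : ℕ} (p : Fin l → Fin l → ℝ≥0∞) {o j : Fin l} (hj : j ≠ o) (k : Fin l) :
    leadSum p {o, j} j k + leadSum p {o, j} o k = graphSum p {o, j} := by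
  unfold leadSum graphSum
  rw [← Finset.sum_add_distrib]
  apply Finset.sum_congr rfl
  intro g hg
  have hg := (Finset.mem_filter.1 hg).2
  have hfo : g o = o := hg.1 o (by simp)
  have hfj : g j = j := hg.1 j (by simp)
  by_cases h : Leads g k j
  · have : ¬ Leads g k o := fun h' => hj ((Leads.confl hfo h h').of_fix hfj)
    simp [h, this]
  · have : Leads g k o := by
      obtain ⟨w, hw, h'⟩ := isWGraph_leads hg k
      simp only [Finset.mem_insert, Finset.mem_singleton] at hw
      rcases hw with rfl | rfl
      · exact h'
      · exact absurd h' h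
    simp [h, this]

theorem graphSum_root {l : ℕ} (p : Fin l → Fin l → ℝ≥0∞) {o j : Fin l} (hj : j ≠ o) :
    ∑ k, p j k * leadSum p {o, j} o k = graphSum p {o} := by
  rw [sum_p_leadSum]
  unfold graphSum
  apply Finset.sum_nbij' (fun x => Function.update x.1 j x.2)
    (fun h => (Function.update h j j, h j))
  · rintro ⟨g, k⟩ hx
    simp only [Finset.mem_filter, Finset.mem_product, Finset.mem_univ, true_and, and_true] at hx ⊢
    obtain ⟨hg, hk⟩ := hx
    have hfo : g o = o := hg.1 o (by simp)
    have hfj : g j = j := hg.1 j (by simp)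
    have hkj : ¬ Leads g k j := fun h' => hj ((Leads.confl hfo h' hk).of_fix hfj)
    have hjo : Leads (Function.update g j k) j o := by
      apply Leads.step
      rwa [Function.update_self, leads_update_iff hkj]
    apply isWGraph_mk
    · intro a ha
      rw [Finset.mem_singleton] at ha
      subst ha
      rw [Function.update_of_ne hj.symm, hfo]
    · intro a ha
      rw [Finset.mem_singleton] at ha
      refine ⟨?_, o, by simp, ?_⟩
      · by_cases haj : a = j
        · subst haj
          rw [Function.update_self]
          exact fun e => hkj ⟨0, e⟩
        · rw [Function.update_of_ne haj]
          exact (hg.2 a (by simp [ha, haj])).1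
      · by_cases haj : Leads g a j
        · exact (leads_update_self haj).trans hjo
        · rw [leads_update_iff haj]
          obtain ⟨w, hw, h'⟩ := isWGraph_leads hg a
          simp only [Finset.mem_insert, Finset.mem_singleton] at hw
          rcases hw with rfl | rfl
          · exact h'
          · exact absurd h' haj
  · intro h hh
    simp only [Finset.mem_filter, Finset.mem_product, Finset.mem_univ, true_and, and_true] at hh ⊢
    have hfo : h o = o := hh.1 o (by simp)
    have hlo : ∀ a, Leads h a o := by
      intro a
      obtain ⟨w, hw, h'⟩ := isWGraph_leads hh a
      rw [Finset.mem_singleton] at hw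
      exact hw ▸ h'
    refine ⟨isWGraph_mk ?_ ?_, ?_⟩
    · intro a ha
      simp only [Finset.mem_insert, Finset.mem_singleton] at ha
      rcases ha with rfl | rfl
      · rw [Function.update_of_ne hj.symm, hfo]
      · rw [Function.update_self]
    · intro a ha
      simp only [Finset.mem_insert, Finset.mem_singleton, not_or] at ha
      refine ⟨?_, ?_⟩
      · rw [Function.update_of_ne ha.2]
        exact (hh.2 a (by simp [ha.1])).1
      · by_cases haj : Leads h a j
        · exact ⟨j, by simp, leads_update_self haj⟩
        · exact ⟨o, by simp, (leads_update_iff haj).2 (hlo a)⟩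
    · rw [leads_update_iff (isWGraph_not_cycle hh (by simp [hj]))]
      exact hlo _
  · rintro ⟨g, k⟩ hx
    simp only [Finset.mem_filter, Finset.mem_product, Finset.mem_univ, true_and, and_true] at hx
    have hfj : g j = j := hx.1.1 j (by simp)
    simp only [Function.update_idem, Function.update_self, Prod.mk.injEq, and_true]
    conv_lhs => rw [← hfj]
    rw [hfj]
    exact (Function.update_eq_self_iff).2 hfj.symm
  · intro h hh
    simp
  · rintro ⟨g, k⟩ hx
    have hjc : j ∈ ({o} : Finset (Fin l))ᶜ := by simp [hj]
    have he : ({o, j} : Finset (Fin l))ᶜ = ({o} : Finset (Fin l))ᶜ.erase j := by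
      ext a
      simp [and_comm]
    rw [← Finset.mul_prod_erase _ _ hjc, he, Function.update_self, mul_comm]
    congr 1
    apply Finset.prod_congr rfl
    intro x hx
    rw [Function.update_of_ne (Finset.ne_of_mem_erase hx)]

theorem leadSum_source {l : ℕ} (p : Fin l → Fin l → ℝ≥0∞) (hrow : ∀ i, ∑ j, p i j = 1)
    {o j : Fin l} (hj : j ≠ o) :
    leadSum p {o, j} j j = ∑ k, p j k * leadSum p {o, j} j k + graphSum p {o} := by
  rw [← graphSum_root p hj, ← Finset.sum_add_distrib, leadSum_self]
  simp only [← mul_add, leadSum_add p hj]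
  rw [← Finset.sum_mul, hrow, one_mul]

theorem p_le_one {l : ℕ} {p : Fin l → Fin l → ℝ≥0∞} (hrow : ∀ i, ∑ j, p i j = 1) (i k : Fin l) :
    p i k ≤ 1 := by
  rw [← hrow i]
  exact Finset.single_le_sum (f := fun k => p i k) (fun _ _ => zero_le) (Finset.mem_univ k)

theorem graphSum_ne_top {l : ℕ} {p : Fin l → Fin l → ℝ≥0∞} (hrow : ∀ i, ∑ j, p i j = 1)
    (W : Finset (Fin l)) : graphSum p W ≠ ⊤ := by
  unfold graphSum
  refine ENNReal.sum_ne_top.2 fun g _ => ENNReal.prod_ne_top fun a _ => ?_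
  exact ne_top_of_le_ne_top ENNReal.one_ne_top (p_le_one hrow _ _)

theorem leadSum_ne_top {l : ℕ} {p : Fin l → Fin l → ℝ≥0∞} (hrow : ∀ i, ∑ j, p i j = 1)
    (W : Finset (Fin l)) (w i : Fin l) : leadSum p W w i ≠ ⊤ := by
  unfold leadSum
  refine ENNReal.sum_ne_top.2 fun g _ => ?_
  split_ifs
  · refine ENNReal.prod_ne_top fun a _ => ?_
    exact ne_top_of_le_ne_top ENNReal.one_ne_top (p_le_one hrow _ _)
  · simp

theorem matPow_succ' {l : ℕ} (p : Fin l → Fin l → ℝ≥0∞) (n : ℕ) (i j : Fin l) :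
    matPow p (n + 1) i j = ∑ k, p i k * matPow p n k j := by
  induction n generalizing j with
  | zero => simp [matPow]
  | succ n ih =>
    rw [matPow]
    simp_rw [ih]
    simp_rw [matPow, Finset.sum_mul, Finset.mul_sum]
    rw [Finset.sum_comm]
    simp_rw [mul_assoc]

theorem graphSum_ne_zero {l : ℕ} {p : Fin l → Fin l → ℝ≥0∞} (hirr : Irreducible p) (o : Fin l) :
    graphSum p {o} ≠ 0 := by
  have hd := fun i => Nat.find_spec (hirr i o)
  set d : Fin l → ℕ := fun i => Nat.find (hirr i o) with hdd
  have key : ∀ i, ∃ k, (i = o → k = o) ∧ (i ≠ o → p i k ≠ 0 ∧ d k < d i) := by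
    intro i
    by_cases hi : i = o
    · exact ⟨o, fun _ => rfl, fun h => absurd hi h⟩
    · have h1 : 0 < matPow p (d i) i o := hd i
      cases hn : d i with
      | zero => rw [hn] at h1; simp [matPow, hi] at h1
      | succ n =>
        rw [hn, matPow_succ'] at h1
        obtain ⟨k, _, hk⟩ := Finset.exists_ne_zero_of_sum_ne_zero h1.ne'
        refine ⟨k, fun h => absurd h hi, fun _ => ⟨left_ne_zero_of_mul hk, ?_⟩⟩
        have : d k ≤ n := Nat.find_min' (hirr k o) (pos_iff_ne_zero.2 (right_ne_zero_of_mul hk))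
        omega
  choose g hg1 hg2 using key
  have hlead : ∀ n i, d i ≤ n → Leads g i o := by
    intro n
    induction n with
    | zero =>
      intro i hi
      by_cases h : i = o
      · exact ⟨0, h⟩
      · have := (hg2 i h).2
        omega
    | succ n ih =>
      intro i hi
      by_cases h : i = o
      · exact ⟨0, h⟩
      · have := (hg2 i h).2
        exact Leads.step (ih _ (by omega))
  have hG : IsWGraph {o} g := by
    apply isWGraph_mk
    · intro i hi
      rw [Finset.mem_singleton] at hi
      rw [hg1 i hi, hi]
    · intro i hi
      rw [Finset.mem_singleton] at hi
      refine ⟨fun e => ?_, o, by simp, hlead _ i le_rfl⟩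
      have := (hg2 i hi).2
      rw [e] at this
      exact lt_irrefl _ this
  intro h0
  unfold graphSum at h0
  rw [Finset.sum_eq_zero_iff] at h0
  have := h0 g (by simp [hG])
  rw [Finset.prod_eq_zero_iff] at this
  obtain ⟨a, ha, h⟩ := this
  exact (hg2 a (by simpa using ha)).1 h

/-- The transition matrix killed at `o`. -/
noncomputable def killed {l : ℕ} (p : Fin l → Fin l → ℝ≥0∞) (o : Fin l) :
    Matrix (Fin l) (Fin l) ℝ≥0∞ :=
  Matrix.of fun i k => if i = o ∨ k = o then 0 else p i k

/-- The Green matrix. -/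
noncomputable def green {l : ℕ} (Q : Matrix (Fin l) (Fin l) ℝ≥0∞) (i k : Fin l) : ℝ≥0∞ :=
  ∑' n : ℕ, (Q ^ n) i k

theorem iter_eq {l : ℕ} {Q : Matrix (Fin l) (Fin l) ℝ≥0∞} {v w : Fin l → ℝ≥0∞}
    (h : v = Q.mulVec v + w) (n : ℕ) :
    v = (Q ^ n).mulVec v + ∑ m ∈ Finset.range n, (Q ^ m).mulVec w := by
  induction n with
  | zero => simp
  | succ n ih =>
    rw [Finset.sum_range_succ, pow_succ, ← Matrix.mulVec_mulVec]
    conv_lhs => rw [ih]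
    conv_lhs => rw [h]
    rw [Matrix.mulVec_add]
    abel

theorem iter_le {l : ℕ} {Q : Matrix (Fin l) (Fin l) ℝ≥0∞} {v w : Fin l → ℝ≥0∞}
    (h : v = Q.mulVec v + w) (i : Fin l) : ∑' n, ((Q ^ n).mulVec w) i ≤ v i := by
  rw [ENNReal.tsum_eq_iSup_nat]
  apply iSup_le
  intro n
  conv_rhs => rw [iter_eq h n]
  rw [Pi.add_apply, Finset.sum_apply]
  exact le_add_self

theorem iter_tsum {l : ℕ} {Q : Matrix (Fin l) (Fin l) ℝ≥0∞} {v w : Fin l → ℝ≥0∞}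
    (h : v = Q.mulVec v + w) (hv : ∀ i, v i ≠ ⊤) (i : Fin l) (hQ : ∀ k, green Q i k ≠ ⊤) :
    ∑' n, ((Q ^ n).mulVec w) i = v i := by
  have h1 : Filter.Tendsto (fun n => ((Q ^ n).mulVec v) i) Filter.atTop (nhds 0) := by
    have : (0 : ℝ≥0∞) = ∑ k : Fin l, 0 * v k := by simp
    rw [this]
    simp only [Matrix.mulVec, dotProduct]
    apply tendsto_finsetSum
    intro k _
    exact ENNReal.Tendsto.mul_const
      (ENNReal.tendsto_atTop_zero_of_tsum_ne_top (hQ k)) (Or.inr (hv k))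
  have h2 := h1.add (ENNReal.tendsto_nat_tsum (fun n => ((Q ^ n).mulVec w) i))
  rw [zero_add] at h2
  refine tendsto_nhds_unique h2 ?_
  have : ∀ n, ((Q ^ n).mulVec v) i + ∑ m ∈ Finset.range n, ((Q ^ m).mulVec w) i = v i := by
    intro n
    conv_rhs => rw [iter_eq h n]
    rw [Pi.add_apply, Finset.sum_apply]
  simp only [this]
  exact tendsto_const_nhds

theorem leadSum_eqn {l : ℕ} {p : Fin l → Fin l → ℝ≥0∞} (hrow : ∀ i, ∑ j, p i j = 1)
    {o j : Fin l} (hj : j ≠ o) :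
    leadSum p {o, j} j = (killed p o).mulVec (leadSum p {o, j} j)
      + Pi.single j (graphSum p {o}) := by
  have h0 : leadSum p {o, j} j o = 0 := leadSum_other p (by simp) hj.symm
  ext i
  rw [Pi.add_apply]
  simp only [Matrix.mulVec, dotProduct, killed, Matrix.of_apply]
  by_cases hio : i = o
  · subst hio
    simp [h0, hj.symm]
  · have : ∀ k, (if i = o ∨ k = o then 0 else p i k) * leadSum p {o, j} j k
        = p i k * leadSum p {o, j} j k := by
      intro k
      by_cases hk : k = o
      · subst hk; simp [h0]
      · simp [hio, hk]
    simp only [this]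
    by_cases hij : i = j
    · subst hij
      rw [Pi.single_eq_same, leadSum_source p hrow hj]
    · rw [Pi.single_eq_of_ne hij, add_zero]
      exact leadSum_harmonic p hrow (by simp [hio, hij]) (by simp)

theorem mulVec_single_tsum {l : ℕ} (Q : Matrix (Fin l) (Fin l) ℝ≥0∞) (i j : Fin l) (c : ℝ≥0∞) :
    ∑' n, ((Q ^ n).mulVec (Pi.single j c)) i = green Q i j * c := by
  unfold green
  rw [← ENNReal.tsum_mul_right]
  congr 1
  ext n
  simp [Matrix.mulVec_single]

theorem pow_col_zero {l : ℕ} (p : Fin l → Fin l → ℝ≥0∞) {o i : Fin l} (hi : i ≠ o) (n : ℕ) :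
    (killed p o ^ n) i o = 0 := by
  cases n with
  | zero => simp [hi]
  | succ n => rw [pow_succ, Matrix.mul_apply]; simp [killed]

theorem green_col_zero {l : ℕ} (p : Fin l → Fin l → ℝ≥0∞) {o i : Fin l} (hi : i ≠ o) :
    green (killed p o) i o = 0 := by
  simp [green, pow_col_zero p hi]

theorem green_ne_top {l : ℕ} {p : Fin l → Fin l → ℝ≥0∞} (hrow : ∀ i, ∑ j, p i j = 1)
    (hirr : Irreducible p) {o i : Fin l} (hi : i ≠ o) (k : Fin l) :
    green (killed p o) i k ≠ ⊤ := by
  by_cases hk : k = o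
  · subst hk
    simp [green_col_zero p hi]
  · have := iter_le (leadSum_eqn hrow hk) i
    rw [mulVec_single_tsum] at this
    intro htop
    rw [htop, ENNReal.top_mul (graphSum_ne_zero hirr o), top_le_iff] at this
    exact leadSum_ne_top hrow _ _ _ this

theorem green_diag {l : ℕ} {p : Fin l → Fin l → ℝ≥0∞} (hrow : ∀ i, ∑ j, p i j = 1)
    (hirr : Irreducible p) {o j : Fin l} (hj : j ≠ o) :
    green (killed p o) j j = graphSum p {o, j} / graphSum p {o} := by
  have := iter_tsum (leadSum_eqn hrow hj) (leadSum_ne_top hrow _ _) j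
    (green_ne_top hrow hirr hj)
  rw [mulVec_single_tsum, leadSum_self] at this
  rw [ENNReal.eq_div_iff (graphSum_ne_zero hirr o) (graphSum_ne_top hrow _), ← this, mul_comm]

theorem green_step {l : ℕ} (Q : Matrix (Fin l) (Fin l) ℝ≥0∞) (i k : Fin l) :
    green Q i k = (if i = k then 1 else 0) + ∑ m, green Q i m * Q m k := by
  unfold green
  rw [tsum_eq_zero_add' (f := fun n => (Q ^ n) i k) ENNReal.summable, pow_zero, Matrix.one_apply]
  congr 1
  simp_rw [← ENNReal.tsum_mul_right]
  rw [← Summable.tsum_finsetSum (fun _ _ => ENNReal.summable)]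
  simp only [pow_succ, Matrix.mul_apply]

theorem green_flow {l : ℕ} {p : Fin l → Fin l → ℝ≥0∞} (hrow : ∀ i, ∑ j, p i j = 1)
    (hirr : Irreducible p) {o i : Fin l} (hi : i ≠ o) (k : Fin l) :
    ∑ m, green (killed p o) i m * p m k + (if i = k then 1 else 0)
      = green (killed p o) i k + (if o = k then 1 else 0) := by
  set S := green (killed p o) i with hS
  have hSo : S o = 0 := green_col_zero p hi
  have hSf : ∀ k, S k ≠ ⊤ := green_ne_top hrow hirr hi
  have h1 : ∀ k, k ≠ o → S k = (if i = k then 1 else 0) + ∑ m, S m * p m k := by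
    intro k hk
    rw [hS, green_step]
    congr 1
    apply Finset.sum_congr rfl
    intro m _
    by_cases hm : m = o
    · subst hm
      rw [← hS, hSo]; simp
    · simp [killed, hm, hk]
  by_cases hk : k = o
  · subst hk
    rw [if_neg hi, if_pos rfl, hSo, add_zero, zero_add]
    have hA : ∑ m, S m = ∑ m, S m * p m k + ∑ k' ∈ Finset.univ.erase k, ∑ m, S m * p m k' := by
      rw [Finset.add_sum_erase _ (fun k' => ∑ m, S m * p m k') (Finset.mem_univ k),
        Finset.sum_comm]
      simp [← Finset.mul_sum, hrow]
    have hB : ∑ m, S m = 1 + ∑ k' ∈ Finset.univ.erase k, ∑ m, S m * p m k' := by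
      rw [← Finset.add_sum_erase _ S (Finset.mem_univ k), hSo, zero_add]
      rw [Finset.sum_congr rfl (fun a ha => h1 a (Finset.ne_of_mem_erase ha)),
        Finset.sum_add_distrib]
      congr 1
      rw [Finset.sum_ite_eq, if_pos]
      simp [hi]
    have hf : ∑ k' ∈ Finset.univ.erase k, ∑ m, S m * p m k' ≠ ⊤ := by
      refine ENNReal.sum_ne_top.2 fun a _ => ENNReal.sum_ne_top.2 fun b _ => ?_
      exact ENNReal.mul_ne_top (hSf b) (ne_top_of_le_ne_top ENNReal.one_ne_top (p_le_one hrow _ _))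
    exact (ENNReal.add_left_inj hf).1 (hA.symm.trans hB)
  · rw [if_neg (Ne.symm hk), add_zero, h1 k hk, add_comm]

/-- Every finite invariant measure is determined by its mass at `r`. -/
theorem invariant_formula {l : ℕ} {p : Fin l → Fin l → ℝ≥0∞} (hrow : ∀ i, ∑ j, p i j = 1)
    (hirr : Irreducible p) (r : Fin l) : ∃ R : Fin l → ℝ≥0∞, ∀ ν : Fin l → ℝ≥0∞,
      (∀ k, ν k ≠ ⊤) → (∀ k, ∑ i, ν i * p i k = ν k) → ∀ k, ν k = R k * ν r := by
  set a : Fin l → ℝ≥0∞ := fun k => if k = r then 0 else p r k with ha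
  set Q := (killed p r).transpose with hQ
  have hg : ∀ k, k ≠ r → ∀ m, green Q k m ≠ ⊤ := by
    intro k hk m
    have h0 : green Q k m = green (killed p r) m k := by
      unfold green
      simp [hQ, ← Matrix.transpose_pow]
    rw [h0]
    by_cases hm : m = r
    · subst hm
      have : ∀ n, (killed p m ^ n) m k = 0 := by
        intro n
        cases n with
        | zero => simp [hk.symm]
        | succ n => rw [pow_succ', Matrix.mul_apply]; simp [killed]
      simp [green, this]
    · exact green_ne_top hrow hirr hm k
  refine ⟨fun k => if k = r then 1 else ∑' n, ((Q ^ n).mulVec a) k, ?_⟩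
  intro ν hν hinv k
  by_cases hk : k = r
  · simp [hk]
  simp only [hk, if_false]
  set v : Fin l → ℝ≥0∞ := fun k => if k = r then 0 else ν k with hv
  have heq : v = Q.mulVec v + ν r • a := by
    ext k
    by_cases hk : k = r
    · simp [hv, ha, hk, hQ, Matrix.mulVec, dotProduct, killed]
    · simp only [hv, ha, hk, hQ, Matrix.mulVec, dotProduct, killed, Pi.add_apply, Pi.smul_apply,
        smul_eq_mul, if_false, Matrix.transpose_apply, Matrix.of_apply, or_false]
      conv_lhs => rw [← hinv k, ← Finset.add_sum_erase _ _ (Finset.mem_univ r)]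
      rw [← Finset.add_sum_erase _ _ (Finset.mem_univ r), add_comm]
      congr 1
      simp only [if_true, mul_zero, zero_add]
      apply Finset.sum_congr rfl
      intro m hm
      simp [Finset.ne_of_mem_erase hm, mul_comm]
  have := iter_tsum heq (by intro i; simp only [hv]; split_ifs; simp; exact hν i) k (hg k hk)
  have h3 : v k = ν k := by simp [hv, hk]
  rw [← h3, ← this, ← ENNReal.tsum_mul_right]
  congr 1
  ext n
  rw [Matrix.mulVec_smul, Pi.smul_apply, smul_eq_mul, mul_comm]

theorem green_kac {l : ℕ} {p : Fin l → Fin l → ℝ≥0∞} (hrow : ∀ i, ∑ j, p i j = 1)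
    (hirr : Irreducible p) {lam : Fin l → ℝ≥0∞} (hlam : ∑ i, lam i = 1)
    (hinv : ∀ j, ∑ i, lam i * p i j = lam j) {o j : Fin l} (hj : j ≠ o) :
    green (killed p o) j j = lam j *
      (∑ k, green (killed p o) j k + ∑ k, green (killed p j) o k) := by
  obtain ⟨R, hR⟩ := invariant_formula hrow hirr j
  have h1 := hR lam (fun k => ne_top_of_le_ne_top ENNReal.one_ne_top (by
    rw [← hlam]
    exact Finset.single_le_sum (fun _ _ => zero_le) (Finset.mem_univ k))) hinv
  have h2 := hR (fun k => green (killed p o) j k + green (killed p j) o k)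
    (fun k => ENNReal.add_ne_top.2
      ⟨green_ne_top hrow hirr hj k, green_ne_top hrow hirr hj.symm k⟩) (by
    intro k
    have e1 := green_flow hrow hirr hj k
    have e2 := green_flow hrow hirr hj.symm k
    simp only [add_mul, Finset.sum_add_distrib]
    have hf : (if j = k then (1 : ℝ≥0∞) else 0) + (if o = k then 1 else 0) ≠ ⊤ := by
      split_ifs <;> simp
    rw [← ENNReal.add_left_inj hf]
    calc _ = (∑ m, green (killed p o) j m * p m k + (if j = k then 1 else 0)) +
          (∑ m, green (killed p j) o m * p m k + (if o = k then 1 else 0)) := by abel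
      _ = _ := by rw [e1, e2]; abel)
  rw [← Finset.sum_add_distrib]
  rw [Finset.sum_congr rfl (fun k _ => h2 k), ← Finset.sum_mul, green_col_zero p hj.symm,
    add_zero, ← mul_assoc, mul_comm (lam j), Finset.sum_mul]
  rw [← Finset.sum_congr rfl (fun k _ => h1 k), hlam, one_mul]

theorem measurable_at {l : ℕ} (i : Fin l) (n : ℕ) : MeasurableSet {ω : ℕ → Fin l | ω n = i} :=
  measurableSet_eq_fun (measurable_pi_apply n) measurable_const

theorem measure_sum_fibers {l : ℕ} (μ : Measure (ℕ → Fin l)) (A : Set (ℕ → Fin l)) (n : ℕ) :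
    μ A = ∑ s : Fin (n + 1) → Fin l,
      μ ({ω | ∀ k : Fin (n + 1), ω k = s k} ∩ A) := by
  have hr : Measurable (fun (ω : ℕ → Fin l) (k : Fin (n + 1)) => ω k) := by fun_prop
  have h := sum_measure_preimage_singleton (μ := μ.restrict A) (Finset.univ)
    (f := fun (ω : ℕ → Fin l) (k : Fin (n + 1)) => ω k)
    (fun y _ => hr (MeasurableSet.singleton y))
  simp only [Finset.coe_univ, Set.preimage_univ, Measure.restrict_apply_univ] at h
  rw [← h]
  apply Finset.sum_congr rfl
  intro s _
  rw [Measure.restrict_apply (hr (MeasurableSet.singleton s))]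
  congr 2
  ext ω
  simp [funext_iff]

theorem cyl_eq {l : ℕ} {p : Fin l → Fin l → ℝ≥0∞} {P : Fin l → Measure (ℕ → Fin l)}
    (hP : IsMarkovChainLaw p P) (i : Fin l) (n : ℕ) (s : ℕ → Fin l) (b : Fin l) :
    P i ({ω | ∀ k ≤ n, ω k = s k} ∩ {ω | ω (n + 1) = b}) =
      P i {ω | ∀ k ≤ n, ω k = s k} * p (s n) b := by
  have h1 := hP.2 i (n + 1) (Function.update s (n + 1) b)
  have h2 : {ω : ℕ → Fin l | ∀ k ≤ n + 1, ω k = Function.update s (n + 1) b k}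
      = {ω | ∀ k ≤ n, ω k = s k} ∩ {ω | ω (n + 1) = b} := by
    ext ω
    simp only [Set.mem_ofPred_eq, Set.mem_inter_iff]
    constructor
    · intro h
      refine ⟨fun k hk => ?_, ?_⟩
      · have := h k (by omega)
        rwa [Function.update_of_ne (by omega)] at this
      · have := h (n + 1) le_rfl
        rwa [Function.update_self] at this
    · rintro ⟨h, hb⟩ k hk
      by_cases hkn : k = n + 1
      · subst hkn; rw [Function.update_self, hb]
      · rw [Function.update_of_ne hkn]; exact h k (by omega)
  rw [← h2, h1, hP.2 i n s, Finset.prod_range_succ, ← mul_assoc, Function.update_self,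
    Function.update_of_ne (show n ≠ n + 1 by omega), Function.update_of_ne (show 0 ≠ n + 1 by omega)]
  congr 2
  apply Finset.prod_congr rfl
  intro k hk
  rw [Finset.mem_range] at hk
  rw [Function.update_of_ne (by omega), Function.update_of_ne (by omega)]

/-- One step of the Markov property. -/
theorem markov_step {l : ℕ} {p : Fin l → Fin l → ℝ≥0∞} {P : Fin l → Measure (ℕ → Fin l)}
    (hP : IsMarkovChainLaw p P) (i : Fin l) (n : ℕ) (E : Set (ℕ → Fin l)) (a b : Fin l)
    (hE : ∀ ω ω' : ℕ → Fin l, (∀ k ≤ n, ω k = ω' k) → ω ∈ E → ω' ∈ E)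
    (hEa : ∀ ω ∈ E, ω n = a) :
    P i (E ∩ {ω | ω (n + 1) = b}) = P i E * p a b := by
  rw [measure_sum_fibers (P i) (E ∩ _) n, measure_sum_fibers (P i) E n, Finset.sum_mul]
  apply Finset.sum_congr rfl
  intro s _
  set t : ℕ → Fin l := fun k => if h : k < n + 1 then s ⟨k, h⟩ else a with ht
  have hc : {ω : ℕ → Fin l | ∀ k : Fin (n + 1), ω k = s k} = {ω | ∀ k ≤ n, ω k = t k} := by
    ext ω
    simp only [Set.mem_ofPred_eq, ht]
    constructor
    · intro h k hk
      rw [dif_pos (by omega)]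
      exact h ⟨k, by omega⟩
    · intro h k
      have := h k (by omega)
      rwa [dif_pos k.2] at this
  rw [hc]
  by_cases htE : t ∈ E
  · have h1 : {ω | ∀ k ≤ n, ω k = t k} ∩ E = {ω | ∀ k ≤ n, ω k = t k} := by
      rw [Set.inter_eq_left]
      intro ω hω
      exact hE t ω (fun k hk => (hω k hk).symm) htE
    rw [← Set.inter_assoc, h1, cyl_eq hP, hEa t htE]
  · have h1 : {ω | ∀ k ≤ n, ω k = t k} ∩ E = ∅ := by
      rw [Set.eq_empty_iff_forall_notMem]
      rintro ω ⟨hω, hωE⟩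
      exact htE (hE ω t hω hωE)
    rw [← Set.inter_assoc, h1]
    simp

theorem start_ae {l : ℕ} {p : Fin l → Fin l → ℝ≥0∞} {P : Fin l → Measure (ℕ → Fin l)}
    (hP : IsMarkovChainLaw p P) (i : Fin l) : ∀ᵐ ω ∂ P i, ω 0 = i := by
  have h := hP.2 i 0 (fun _ => i)
  have := hP.1 i
  have h2 : {ω : ℕ → Fin l | ∀ k ≤ 0, ω k = i} = {ω | ω 0 = i} := by ext; simp
  rw [h2] at h
  have hm : MeasurableSet {ω : ℕ → Fin l | ω 0 = i} :=
    measurable_at i 0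
  rw [ae_iff]
  have := (prob_compl_eq_zero_iff hm (μ := P i)).2 (by simpa using h)
  exact this

theorem measurable_avoid {l : ℕ} (o : Fin l) (n : ℕ) :
    MeasurableSet {ω : ℕ → Fin l | ∀ m ≤ n, ω m ≠ o} := by
  have : {ω : ℕ → Fin l | ∀ m ≤ n, ω m ≠ o} = ⋂ m ≤ n, {ω : ℕ → Fin l | ω m = o}ᶜ := by
    ext; simp
  rw [this]
  refine MeasurableSet.iInter fun m => MeasurableSet.iInter fun _ => MeasurableSet.compl ?_
  exact measurable_at o m

theorem measurable_avoid_at {l : ℕ} (o k : Fin l) (n : ℕ) :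
    MeasurableSet {ω : ℕ → Fin l | (∀ m ≤ n, ω m ≠ o) ∧ ω n = k} :=
  (measurable_avoid o n).inter (measurable_at k n)

theorem sum_values {l : ℕ} (μ : Measure (ℕ → Fin l)) (A : Set (ℕ → Fin l)) (n : ℕ) :
    μ A = ∑ k, μ (A ∩ {ω | ω n = k}) := by
  have hr : Measurable (fun (ω : ℕ → Fin l) => ω n) := by fun_prop
  have h := sum_measure_preimage_singleton (μ := μ.restrict A) (Finset.univ)
    (f := fun (ω : ℕ → Fin l) => ω n) (fun y _ => hr (MeasurableSet.singleton y))
  simp only [Finset.coe_univ, Set.preimage_univ, Measure.restrict_apply_univ] at h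
  rw [← h]
  apply Finset.sum_congr rfl
  intro s _
  rw [Measure.restrict_apply (hr (MeasurableSet.singleton s)), Set.inter_comm]
  rfl

theorem avoid_prob {l : ℕ} {p : Fin l → Fin l → ℝ≥0∞} {P : Fin l → Measure (ℕ → Fin l)}
    (hP : IsMarkovChainLaw p P) {o i : Fin l} (hi : i ≠ o) (n : ℕ) (k : Fin l) :
    P i {ω | (∀ m ≤ n, ω m ≠ o) ∧ ω n = k} = (killed p o ^ n) i k := by
  induction n generalizing k with
  | zero =>
    have h0 := start_ae hP i
    have := hP.1 i
    by_cases hik : i = k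
    · subst hik
      rw [pow_zero, Matrix.one_apply_eq, ← measure_univ (μ := P i)]
      apply measure_congr
      filter_upwards [h0] with ω hω
      apply propext
      show ((∀ m ≤ 0, ω m ≠ o) ∧ ω 0 = i) ↔ True
      simp [hω, hi]
    · rw [pow_zero, Matrix.one_apply_ne hik, ← measure_empty (μ := P i)]
      apply measure_congr
      filter_upwards [h0] with ω hω
      apply propext
      show ((∀ m ≤ 0, ω m ≠ o) ∧ ω 0 = k) ↔ False
      simp [hω, hik]
  | succ n ih =>
    rw [pow_succ, Matrix.mul_apply]
    by_cases hk : k = o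
    · subst hk
      have : {ω : ℕ → Fin l | (∀ m ≤ n + 1, ω m ≠ k) ∧ ω (n + 1) = k} = ∅ := by
        rw [Set.eq_empty_iff_forall_notMem]
        rintro ω ⟨h1, h2⟩
        exact h1 _ le_rfl h2
      rw [this]
      simp [killed]
    · rw [sum_values _ _ n]
      apply Finset.sum_congr rfl
      intro a _
      have hset : {ω : ℕ → Fin l | (∀ m ≤ n + 1, ω m ≠ o) ∧ ω (n + 1) = k} ∩ {ω | ω n = a}
          = {ω | (∀ m ≤ n, ω m ≠ o) ∧ ω n = a} ∩ {ω | ω (n + 1) = k} := by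
        ext ω
        simp only [Set.mem_inter_iff, Set.mem_ofPred_eq]
        constructor
        · rintro ⟨⟨h1, h2⟩, h3⟩
          exact ⟨⟨fun m hm => h1 m (by omega), h3⟩, h2⟩
        · rintro ⟨⟨h1, h2⟩, h3⟩
          refine ⟨⟨fun m hm => ?_, h3⟩, h2⟩
          by_cases hmn : m = n + 1
          · subst hmn; rw [h3]; exact hk
          · exact h1 m (by omega)
      rw [hset, markov_step hP i n _ a k _ (fun ω hω => hω.2), ih a]
      · by_cases ha : a = o
        · subst ha
          rw [pow_col_zero p hi]; simp
        · simp [killed, ha, hk]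
      · rintro ω ω' h ⟨h1, h2⟩
        exact ⟨fun m hm => by rw [← h m hm]; exact h1 m hm, by rw [← h n le_rfl]; exact h2⟩

theorem lt_hitT_iff {l : ℕ} (o : Fin l) (ω : ℕ → Fin l) (n : ℕ) :
    (n : ℝ≥0∞) < hitT o ω ↔ ∀ m ≤ n, ω m ≠ o := by
  constructor
  · intro h m hm hmo
    have : hitT o ω ≤ (m : ℝ≥0∞) := iInf₂_le m hmo
    exact absurd (h.trans_le this) (by simpa using hm)
  · intro h
    have : ((n + 1 : ℕ) : ℝ≥0∞) ≤ hitT o ω := by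
      refine le_iInf₂ fun m hm => ?_
      have : n + 1 ≤ m := by
        by_contra hlt
        exact h m (by omega) hm
      exact_mod_cast this
    refine lt_of_lt_of_le ?_ this
    exact_mod_cast Nat.lt_succ_self n

theorem hitT_eq_tsum {l : ℕ} (o : Fin l) (ω : ℕ → Fin l) :
    hitT o ω = ∑' n : ℕ, {ω : ℕ → Fin l | ∀ m ≤ n, ω m ≠ o}.indicator (fun _ => (1 : ℝ≥0∞)) ω := by
  by_cases h : ∃ n, ω n = o
  · have hspec := Nat.find_spec h
    have hmin : ∀ m, m < Nat.find h → ω m ≠ o := fun m hm => Nat.find_min h hm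
    set N := Nat.find h
    have h1 : hitT o ω = N := by
      apply le_antisymm
      · exact iInf₂_le N hspec
      · refine le_iInf₂ fun m hm => ?_
        have : N ≤ m := Nat.find_min' h hm
        exact_mod_cast this
    rw [h1, tsum_eq_sum (s := Finset.range N)]
    · rw [Finset.sum_congr rfl (g := fun _ => (1 : ℝ≥0∞))]
      · simp
      · intro n hn
        rw [Finset.mem_range] at hn
        rw [Set.indicator_of_mem]
        intro m hm
        exact hmin m (by omega)
    · intro n hn
      rw [Finset.mem_range, not_lt] at hn
      rw [Set.indicator_of_notMem]
      intro hh
      exact hh N hn hspec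
  · push Not at h
    have h1 : hitT o ω = ⊤ := by
      refine top_le_iff.1 (le_iInf₂ fun m hm => absurd hm (h m))
    rw [h1]
    have : ∀ n : ℕ, {ω : ℕ → Fin l | ∀ m ≤ n, ω m ≠ o}.indicator (fun _ => (1 : ℝ≥0∞)) ω = 1 := by
      intro n
      rw [Set.indicator_of_mem]
      exact fun m _ => h m
    simp only [this]
    exact (ENNReal.tsum_const_eq_top_of_ne_zero one_ne_zero).symm

theorem lintegral_hitT {l : ℕ} {p : Fin l → Fin l → ℝ≥0∞} {P : Fin l → Measure (ℕ → Fin l)}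
    (hP : IsMarkovChainLaw p P) {o i : Fin l} (hi : i ≠ o) :
    ∫⁻ ω, hitT o ω ∂ P i = ∑ k, green (killed p o) i k := by
  simp only [hitT_eq_tsum]
  rw [lintegral_tsum (fun n => (measurable_const.indicator (measurable_avoid o n)).aemeasurable)]
  unfold green
  rw [← Summable.tsum_finsetSum (fun _ _ => ENNReal.summable)]
  congr 1
  ext n
  rw [lintegral_indicator (measurable_avoid o n), lintegral_one, Measure.restrict_apply_univ,
    sum_values _ _ n]
  apply Finset.sum_congr rfl
  intro k _
  exact avoid_prob hP hi n k

theorem lintegral_numVisits {l : ℕ} {p : Fin l → Fin l → ℝ≥0∞} {P : Fin l → Measure (ℕ → Fin l)}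
    (hP : IsMarkovChainLaw p P) {o j : Fin l} (hj : j ≠ o) :
    ∫⁻ ω, numVisits o j ω ∂ P j = green (killed p o) j j := by
  have h1 : ∫⁻ ω, numVisits o j ω ∂ P j = ∫⁻ ω, ∑' n : ℕ,
      {ω : ℕ → Fin l | (∀ m ≤ n, ω m ≠ o) ∧ ω n = j}.indicator (fun _ => (1 : ℝ≥0∞)) ω ∂ P j := by
    apply lintegral_congr_ae
    filter_upwards [start_ae hP j] with ω hω
    have he : exitT o ω = 0 := by
      refine le_antisymm ?_ zero_le
      have : exitT o ω ≤ ((0 : ℕ) : ℝ≥0∞) := iInf₂_le 0 (by simp [hω, hj])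
      simpa using this
    have hr : retT o ω = hitT o ω := by
      unfold retT hitT
      simp [he]
    unfold numVisits
    congr 1
    ext n
    simp only [hr, lt_hitT_iff, Set.indicator_apply, Set.mem_ofPred_eq]
  rw [h1, lintegral_tsum
    (fun n => (measurable_const.indicator (measurable_avoid_at o j n)).aemeasurable)]
  unfold green
  congr 1
  ext n
  rw [lintegral_indicator (measurable_avoid_at o j n), lintegral_one,
    Measure.restrict_apply_univ]
  exact avoid_prob hP hj n j

/-- For every `j ≠ 1` (the distinguished state `1` is denoted `o`):
`E_j[N_j] = (Σ_{g∈G(1,j)} π(g)) / (Σ_{g∈G(1)} π(g))` and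
`E_j[N_j] = λ_j (E_j[T_1] + E_1[T_j])`. -/
theorem expected_visits_eq {l : ℕ} (hl : 2 ≤ l)
    (p : Fin l → Fin l → ℝ≥0∞) (hrow : ∀ i, ∑ j, p i j = 1)
    (hirr : Irreducible p)
    (lam : Fin l → ℝ≥0∞) (hlam : ∑ i, lam i = 1)
    (hinv : ∀ j, ∑ i, lam i * p i j = lam j)
    (P : Fin l → Measure (ℕ → Fin l)) (hP : IsMarkovChainLaw p P)
    (o : Fin l) (j : Fin l) (hj : j ≠ o) :
    (∫⁻ ω, numVisits o j ω ∂ P j) = graphSum p {o, j} / graphSum p {o} ∧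
      (∫⁻ ω, numVisits o j ω ∂ P j)
        = lam j * ((∫⁻ ω, hitT o ω ∂ P j) + ∫⁻ ω, hitT j ω ∂ P o) := by
  rw [lintegral_numVisits hP hj, lintegral_hitT hP hj, lintegral_hitT hP hj.symm]
  exact ⟨green_diag hrow hirr hj, green_kac hrow hirr hlam hinv hj⟩

end FW
end

section
/- For all i, j ∈ L with j ≠ i: P_i(T_j < T_i^+) = 1 / ( λ_i · (E_j[T_i] + E_i[T_j]) ). -/
open MeasureTheory
open scoped ENNReal Classical

namespace FW

/-- The shift on path space. -/
def shf {l : ℕ} (ω : ℕ → Fin l) : ℕ → Fin l := fun n => ω (n + 1)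

theorem measurable_shf {l : ℕ} : Measurable (shf (l := l)) := by
  unfold shf
  fun_prop

theorem hitTpos_eq {l : ℕ} (j : Fin l) (ω : ℕ → Fin l) :
    hitTpos j ω = 1 + hitT j (shf ω) := by
  unfold hitTpos hitT shf
  apply le_antisymm
  · rw [ENNReal.add_iInf]
    refine le_iInf fun n => ?_
    by_cases h : ω (n + 1) = j
    · simp only [Set.mem_ofPred_eq, h, iInf_pos]
      refine (iInf₂_le (n + 1) ⟨by omega, h⟩).trans ?_
      push_cast
      rw [add_comm]
    · simp [h]
  · refine le_iInf₂ fun n hn => ?_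
    obtain ⟨h1, h2⟩ := hn
    obtain ⟨m, rfl⟩ : ∃ m, n = m + 1 := ⟨n - 1, by omega⟩
    have : (⨅ n ∈ {n : ℕ | ω (n + 1) = j}, (n : ℝ≥0∞)) ≤ m := iInf₂_le m h2
    push_cast
    rw [add_comm (m : ℝ≥0∞)]
    gcongr

theorem hitT_zero {l : ℕ} (j : Fin l) (ω : ℕ → Fin l) (h : ω 0 = j) : hitT j ω = 0 := by
  have : hitT j ω ≤ ((0 : ℕ) : ℝ≥0∞) := iInf₂_le 0 h
  simpa using this

theorem hitT_of_ne {l : ℕ} (j : Fin l) (ω : ℕ → Fin l) (h : ω 0 ≠ j) :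
    hitT j ω = 1 + hitT j (shf ω) := by
  rw [← hitTpos_eq]
  unfold hitT hitTpos
  refine iInf_congr fun n => iInf_congr_Prop ?_ fun _ => rfl
  simp only [Set.mem_ofPred_eq]
  constructor
  · intro hn
    refine ⟨?_, hn⟩
    rcases Nat.eq_zero_or_pos n with rfl | h'
    · exact absurd hn h
    · exact h'
  · exact fun h => h.2

theorem measurable_hitT {l : ℕ} (j : Fin l) : Measurable (hitT (l := l) j) := by
  unfold hitT
  refine Measurable.iInf fun n => ?_
  have hs : MeasurableSet {ω : ℕ → Fin l | ω n = j} :=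
    measurableSet_eq_fun (measurable_pi_apply n) measurable_const
  have : (fun ω : ℕ → Fin l => ⨅ (_ : n ∈ {n : ℕ | ω n = j}), (n : ℝ≥0∞))
      = fun ω => if ω n = j then (n : ℝ≥0∞) else ⊤ := by
    funext ω
    by_cases h : ω n = j <;> simp [h]
  rw [this]
  exact Measurable.ite hs measurable_const measurable_const

/-- Cylinder sets. -/
def cyl (l : ℕ) : Set (Set (ℕ → Fin l)) :=
  {A | A = ∅ ∨ ∃ (n : ℕ) (s : ℕ → Fin l), A = {ω | ∀ k ≤ n, ω k = s k}}

theorem cyl_pi (l : ℕ) : IsPiSystem (cyl l) := by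
  have key : ∀ (n m : ℕ) (s t : ℕ → Fin l), n ≤ m →
      ({ω : ℕ → Fin l | ∀ k ≤ n, ω k = s k} ∩ {ω | ∀ k ≤ m, ω k = t k}).Nonempty →
      ({ω : ℕ → Fin l | ∀ k ≤ n, ω k = s k} ∩ {ω | ∀ k ≤ m, ω k = t k})
        = {ω | ∀ k ≤ m, ω k = t k} := by
    rintro n m s t hnm ⟨ω, h1, h2⟩
    refine Set.inter_eq_right.2 fun ω' h' k hk => ?_
    rw [h' k (hk.trans hnm), ← h2 k (hk.trans hnm), h1 k hk]
  rintro A hA B hB hne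
  rcases hA with rfl | ⟨n, s, rfl⟩
  · simp at hne
  rcases hB with rfl | ⟨m, t, rfl⟩
  · simp at hne
  rcases le_total n m with h | h
  · exact Or.inr ⟨m, t, key n m s t h hne⟩
  · rw [Set.inter_comm] at hne ⊢
    exact Or.inr ⟨n, s, key m n t s h hne⟩

theorem cyl_gen (l : ℕ) :
    (MeasurableSpace.pi : MeasurableSpace (ℕ → Fin l)) = MeasurableSpace.generateFrom (cyl l) := by
  apply le_antisymm
  · refine iSup_le fun n => ?_
    rw [← measurable_iff_comap_le]
    refine @measurable_to_countable' (Fin l) (ℕ → Fin l) _ _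
      (MeasurableSpace.generateFrom (cyl l)) (fun ω => ω n) fun x => ?_
    have : (fun ω : ℕ → Fin l => ω n) ⁻¹' {x} =
        ⋃ s : Fin (n + 1) → Fin l, if s (Fin.last n) = x then
          {ω : ℕ → Fin l | ∀ k ≤ n, ω k = s (Fin.ofNat (n + 1) k)} else ∅ := by
      ext ω
      simp only [Set.mem_preimage, Set.mem_singleton_iff, Set.mem_iUnion]
      constructor
      · intro h
        refine ⟨fun k => ω k, ?_⟩
        simp only [Fin.val_last, h, if_true, Set.mem_ofPred_eq]
        intro k hk
        simp [Fin.ofNat, Nat.mod_eq_of_lt (Nat.lt_succ_of_le hk)]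
      · rintro ⟨s, hs⟩
        split_ifs at hs with h
        · rw [hs n le_rfl, ← h]
          congr 1
          ext
          simp [Fin.ofNat]
        · exact absurd hs (Set.notMem_empty _)
    rw [this]
    refine MeasurableSet.iUnion fun s => ?_
    split_ifs
    · exact MeasurableSpace.measurableSet_generateFrom (Or.inr ⟨n, fun k => s (Fin.ofNat (n + 1) k), rfl⟩)
    · exact @MeasurableSet.empty _ (_)
  · refine MeasurableSpace.generateFrom_le ?_
    rintro A (rfl | ⟨n, s, rfl⟩)
    · exact MeasurableSet.empty
    · simp only [Set.ofPred_forall]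
      exact MeasurableSet.iInter fun k => MeasurableSet.iInter fun _ =>
        measurableSet_eq_fun (measurable_pi_apply k) measurable_const

theorem start {l : ℕ} {p : Fin l → Fin l → ℝ≥0∞} {P : Fin l → Measure (ℕ → Fin l)}
    (hP : IsMarkovChainLaw p P) (x : Fin l) : ∀ᵐ ω ∂ P x, ω 0 = x := by
  have := hP.1 x
  have h := hP.2 x 0 (fun _ => x)
  have hs : MeasurableSet {ω : ℕ → Fin l | ω 0 = x} :=
    measurableSet_eq_fun (measurable_pi_apply 0) measurable_const
  simp at h
  rw [ae_iff]
  have := (prob_compl_eq_zero_iff hs (μ := P x)).2 h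
  exact this

theorem markov {l : ℕ} {p : Fin l → Fin l → ℝ≥0∞} {P : Fin l → Measure (ℕ → Fin l)}
    (hrow : ∀ i, ∑ j, p i j = 1)
    (hP : IsMarkovChainLaw p P) (x : Fin l) :
    (P x).map shf = ∑ y, p x y • P y := by
  have := hP.1
  have hpm : IsProbabilityMeasure ((P x).map shf) :=
    Measure.isProbabilityMeasure_map measurable_shf.aemeasurable
  refine ext_of_generate_finite (cyl l) (cyl_gen l) (cyl_pi l) ?_ ?_
  · rintro A (rfl | ⟨n, s, rfl⟩)
    · simp
    · have hA : MeasurableSet {ω : ℕ → Fin l | ∀ k ≤ n, ω k = s k} := by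
        rw [cyl_gen]
        exact MeasurableSpace.measurableSet_generateFrom (Or.inr ⟨n, s, rfl⟩)
      rw [Measure.map_apply measurable_shf hA]
      have h1 : P x (shf ⁻¹' {ω : ℕ → Fin l | ∀ k ≤ n, ω k = s k}) =
          P x {ω | ∀ k ≤ n + 1, ω k = (fun k => Nat.casesOn k x s : ℕ → Fin l) k} := by
        refine measure_congr ?_
        filter_upwards [start hP x] with ω hω
        simp only [eq_iff_iff]
        constructor
        · intro h k hk
          cases k with
          | zero => exact hω
          | succ k => exact h k (by omega)
        · intro h k hk
          exact h (k + 1) (by omega)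
      rw [h1, hP.2 x (n + 1), Finset.prod_range_succ']
      simp only [Measure.coe_finsetSum, Finset.sum_apply, Measure.smul_apply, smul_eq_mul, hP.2]
      rw [Finset.sum_eq_single (s 0)]
      · simp [mul_comm]
      · intro b _ hb
        simp [hb.symm]
      · simp
  · simp [hrow]

theorem lint_shf {l : ℕ} {p : Fin l → Fin l → ℝ≥0∞} {P : Fin l → Measure (ℕ → Fin l)}
    (hrow : ∀ i, ∑ j, p i j = 1)
    (hP : IsMarkovChainLaw p P) (x : Fin l) (F : (ℕ → Fin l) → ℝ≥0∞) (hF : Measurable F) :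
    ∫⁻ ω, F (shf ω) ∂ P x = ∑ y, p x y * ∫⁻ ω, F ω ∂ P y := by
  rw [← lintegral_map hF measurable_shf, markov hrow hP, lintegral_finsetSum_measure]
  simp

theorem pow_inv {l : ℕ} {p : Fin l → Fin l → ℝ≥0∞} {lam : Fin l → ℝ≥0∞}
    (hinv : ∀ j, ∑ i, lam i * p i j = lam j) (n : ℕ) (j : Fin l) :
    ∑ i, lam i * matPow p n i j = lam j := by
  induction n generalizing j with
  | zero => simp [matPow]
  | succ n ih =>
    simp only [matPow, Finset.mul_sum]
    rw [Finset.sum_comm]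
    simp only [← mul_assoc, ← Finset.sum_mul, ih, hinv]

theorem lam_pos {l : ℕ} {p : Fin l → Fin l → ℝ≥0∞} {lam : Fin l → ℝ≥0∞}
    (hirr : Irreducible p) (hlam : ∑ i, lam i = 1)
    (hinv : ∀ j, ∑ i, lam i * p i j = lam j) (j : Fin l) : lam j ≠ 0 := by
  intro h
  have : ∀ i, lam i = 0 := by
    intro i
    obtain ⟨n, hn⟩ := hirr i j
    have := pow_inv hinv n j
    rw [h, Finset.sum_eq_zero_iff] at this
    exact (mul_eq_zero.1 (this i (Finset.mem_univ _))).resolve_right hn.ne'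
  simp [this] at hlam

theorem sum_inv {l : ℕ} {p : Fin l → Fin l → ℝ≥0∞} {lam : Fin l → ℝ≥0∞}
    (hinv : ∀ j, ∑ i, lam i * p i j = lam j) (v : Fin l → ℝ≥0∞) :
    ∑ x, lam x * ∑ y, p x y * v y = ∑ y, lam y * v y := by
  simp only [Finset.mul_sum]
  rw [Finset.sum_comm]
  simp only [← mul_assoc, ← Finset.sum_mul, hinv]

theorem kac_alg {l : ℕ} {p : Fin l → Fin l → ℝ≥0∞} {lam : Fin l → ℝ≥0∞}
    (hlam : ∑ i, lam i = 1) (hinv : ∀ j, ∑ i, lam i * p i j = lam j) (j : Fin l)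
    (v w : Fin l → ℝ≥0∞) (hj : w j = 0) (hw : ∀ x, x ≠ j → w x = 1 + ∑ y, p x y * v y) :
    ∑ x, lam x * w x + lam j * (1 + ∑ y, p j y * v y) = 1 + ∑ x, lam x * v x := by
  have h : 1 + ∑ x, lam x * v x = ∑ x, lam x * (1 + ∑ y, p x y * v y) := by
    simp only [mul_add, Finset.sum_add_distrib, sum_inv hinv, mul_one, hlam]
  rw [h, ← Finset.sum_erase_add _ _ (Finset.mem_univ j),
    ← Finset.sum_erase_add Finset.univ (fun x => lam x * (1 + ∑ y, p x y * v y))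
      (Finset.mem_univ j), hj, mul_zero, add_zero]
  congr 1
  refine Finset.sum_congr rfl fun x hx => ?_
  rw [hw x (Finset.ne_of_mem_erase hx)]

theorem prop_along {l : ℕ} {p : Fin l → Fin l → ℝ≥0∞} (hirr : Irreducible p)
    (Q : Fin l → Prop) (i : Fin l) (hi : Q i)
    (hstep : ∀ x y, Q x → p x y ≠ 0 → Q y) (y : Fin l) : Q y := by
  obtain ⟨n, hn⟩ := hirr i y
  induction n generalizing y with
  | zero =>
    by_cases h : i = y
    · exact h ▸ hi
    · simp [matPow, h] at hn
  | succ n ih =>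
    simp only [matPow] at hn
    obtain ⟨k, -, hk⟩ := Finset.exists_ne_zero_of_sum_ne_zero hn.ne'
    exact hstep k y (ih k (pos_iff_ne_zero.2 (left_ne_zero_of_mul hk))) (right_ne_zero_of_mul hk)

theorem h_self {l : ℕ} {p : Fin l → Fin l → ℝ≥0∞} {P : Fin l → Measure (ℕ → Fin l)}
    (hP : IsMarkovChainLaw p P) (j : Fin l) : ∫⁻ ω, hitT j ω ∂ P j = 0 := by
  rw [lintegral_eq_zero_iff (measurable_hitT j)]
  filter_upwards [start hP j] with ω hω using hitT_zero j ω hω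

theorem h_step {l : ℕ} {p : Fin l → Fin l → ℝ≥0∞} {P : Fin l → Measure (ℕ → Fin l)}
    (hrow : ∀ i, ∑ j, p i j = 1)
    (hP : IsMarkovChainLaw p P) (j x : Fin l) (hx : x ≠ j) :
    ∫⁻ ω, hitT j ω ∂ P x = 1 + ∑ y, p x y * ∫⁻ ω, hitT j ω ∂ P y := by
  have := hP.1 x
  rw [← lint_shf hrow hP x _ (measurable_hitT j)]
  have : ∫⁻ ω, hitT j ω ∂ P x = ∫⁻ ω, 1 + hitT j (shf ω) ∂ P x := by
    refine lintegral_congr_ae ?_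
    filter_upwards [start hP x] with ω hω using hitT_of_ne j ω (hω ▸ hx)
  rw [this, lintegral_add_left measurable_const]
  simp

theorem hn_step {l : ℕ} {p : Fin l → Fin l → ℝ≥0∞} {P : Fin l → Measure (ℕ → Fin l)}
    (hrow : ∀ i, ∑ j, p i j = 1)
    (hP : IsMarkovChainLaw p P) (j x : Fin l) (hx : x ≠ j) (n : ℕ) :
    ∫⁻ ω, min (hitT j ω) ((n + 1 : ℕ) : ℝ≥0∞) ∂ P x
      = 1 + ∑ y, p x y * ∫⁻ ω, min (hitT j ω) (n : ℝ≥0∞) ∂ P y := by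
  have := hP.1 x
  rw [← lint_shf hrow hP x _ ((measurable_hitT j).min measurable_const)]
  have : ∫⁻ ω, min (hitT j ω) ((n + 1 : ℕ) : ℝ≥0∞) ∂ P x
      = ∫⁻ ω, 1 + min (hitT j (shf ω)) (n : ℝ≥0∞) ∂ P x := by
    refine lintegral_congr_ae ?_
    filter_upwards [start hP x] with ω hω
    rw [hitT_of_ne j ω (hω ▸ hx), Nat.cast_succ, add_comm (n : ℝ≥0∞), min_add_add_left]
  rw [this, lintegral_add_left measurable_const]
  simp

theorem h_sup {l : ℕ} (P : Fin l → Measure (ℕ → Fin l)) (j x : Fin l) :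
    ∫⁻ ω, hitT j ω ∂ P x = ⨆ n : ℕ, ∫⁻ ω, min (hitT j ω) (n : ℝ≥0∞) ∂ P x := by
  rw [← lintegral_iSup]
  · refine lintegral_congr fun ω => ?_
    rw [← inf_iSup_eq (α := ℝ≥0∞), ENNReal.iSup_natCast]
    simp
  · exact fun n => (measurable_hitT j).min measurable_const
  · intro n m hnm ω
    exact min_le_min le_rfl (by exact_mod_cast hnm)

theorem h_fin {l : ℕ} {p : Fin l → Fin l → ℝ≥0∞} {P : Fin l → Measure (ℕ → Fin l)}
    {lam : Fin l → ℝ≥0∞}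
    (hrow : ∀ i, ∑ j, p i j = 1) (hirr : Irreducible p) (hlam : ∑ i, lam i = 1)
    (hinv : ∀ j, ∑ i, lam i * p i j = lam j)
    (hP : IsMarkovChainLaw p P) (j x : Fin l) : ∫⁻ ω, hitT j ω ∂ P x ≠ ⊤ := by
  have hlt : ∀ x, lam x ≠ ⊤ := fun x hx => by
    have := (Finset.single_le_sum (f := lam) (fun _ _ => zero_le) (Finset.mem_univ x))
    rw [hlam, hx] at this
    simp at this
  have hb : ∀ n : ℕ, lam j * (1 + ∑ y, p j y * ∫⁻ ω, min (hitT j ω) (n : ℝ≥0∞) ∂ P y) ≤ 1 := by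
    intro n
    have hk := kac_alg hlam hinv j (fun y => ∫⁻ ω, min (hitT j ω) (n : ℝ≥0∞) ∂ P y)
      (fun y => ∫⁻ ω, min (hitT j ω) ((n + 1 : ℕ) : ℝ≥0∞) ∂ P y)
      (le_antisymm ((lintegral_mono fun ω => min_le_left _ _).trans (h_self hP j).le) zero_le)
      (fun x hx => hn_step hrow hP j x hx n)
    have hfin : ∑ x, lam x * ∫⁻ ω, min (hitT j ω) ((n + 1 : ℕ) : ℝ≥0∞) ∂ P x ≠ ⊤ := by
      refine ENNReal.sum_ne_top.2 fun x _ => ENNReal.mul_ne_top (hlt x) ?_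
      have := hP.1 x
      refine ((lintegral_mono (g := fun _ => ((n + 1 : ℕ) : ℝ≥0∞))
        fun ω => min_le_right _ _).trans_lt ?_).ne
      simp
    have hle : ∑ x, lam x * ∫⁻ ω, min (hitT j ω) (n : ℝ≥0∞) ∂ P x ≤
        ∑ x, lam x * ∫⁻ ω, min (hitT j ω) ((n + 1 : ℕ) : ℝ≥0∞) ∂ P x := by
      gcongr
      simp
    refine (ENNReal.add_le_add_iff_left hfin).1 ?_
    rw [hk, add_comm]
    gcongr
  have hj : ∀ y, p j y ≠ 0 → ∫⁻ ω, hitT j ω ∂ P y ≠ ⊤ := by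
    intro y hy htop
    have h1 : lam j * (p j y * ∫⁻ ω, hitT j ω ∂ P y) ≤ 1 := by
      rw [h_sup, ENNReal.mul_iSup, ENNReal.mul_iSup]
      refine iSup_le fun n => le_trans ?_ (hb n)
      gcongr
      refine le_trans ?_ le_add_self
      exact Finset.single_le_sum
        (f := fun y => p j y * ∫⁻ ω, min (hitT j ω) (n : ℝ≥0∞) ∂ P y)
        (fun _ _ => zero_le) (Finset.mem_univ y)
    rw [htop, ENNReal.mul_top hy, ENNReal.mul_top (lam_pos hirr hlam hinv j)] at h1
    simp at h1
  refine prop_along hirr (fun x => ∫⁻ ω, hitT j ω ∂ P x ≠ ⊤) j ?_ ?_ x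
  · simp [h_self hP j]
  · intro x y hx hxy
    by_cases hxj : x = j
    · exact hj y (hxj ▸ hxy)
    · intro hy
      apply hx
      rw [h_step hrow hP j x hxj, ENNReal.add_eq_top]
      right
      rw [ENNReal.sum_eq_top]
      exact ⟨y, Finset.mem_univ _, by rw [hy, ENNReal.mul_top hxy]⟩

/-- Uniqueness of functions harmonic off `{i, j}`. -/
theorem harm_uniq {l : ℕ} {p : Fin l → Fin l → ℝ≥0∞}
    {lam : Fin l → ℝ≥0∞}
    (hrow : ∀ i, ∑ j, p i j = 1) (hirr : Irreducible p) (hlam : ∑ i, lam i = 1)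
    (hinv : ∀ j, ∑ i, lam i * p i j = lam j) (i j : Fin l) (D : Fin l → ℝ)
    (hi : D i = 0) (hj : D j = 0)
    (hD : ∀ x, x ≠ i → x ≠ j → D x = ∑ y, (p x y).toReal * D y) : ∀ x, D x = 0 := by
  have hlt : ∀ x, lam x ≠ ⊤ := fun x hx => by
    have := (Finset.single_le_sum (f := lam) (fun _ _ => zero_le) (Finset.mem_univ x))
    rw [hlam, hx] at this
    simp at this
  have hpt : ∀ x y, p x y ≠ ⊤ := fun x y hx => by
    have := (Finset.single_le_sum (f := p x) (fun _ _ => zero_le) (Finset.mem_univ y))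
    rw [hrow, hx] at this
    simp at this
  have hinv' : ∀ y, ∑ x, (lam x).toReal * (p x y).toReal = (lam y).toReal := by
    intro y
    rw [← hinv y, ENNReal.toReal_sum fun x _ => ENNReal.mul_ne_top (hlt x) (hpt x y)]
    simp
  have hsub : ∀ x, |D x| ≤ ∑ y, (p x y).toReal * |D y| := by
    intro x
    have h0 : 0 ≤ ∑ y, (p x y).toReal * |D y| := by positivity
    by_cases h1 : x = i
    · rw [h1] at h0 ⊢; simpa [hi] using h0
    by_cases h2 : x = j
    · rw [h2] at h0 ⊢; simpa [hj] using h0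
    rw [hD x h1 h2]
    refine (Finset.abs_sum_le_sum_abs _ _).trans (le_of_eq ?_)
    refine Finset.sum_congr rfl fun y _ => ?_
    rw [abs_mul, abs_of_nonneg ENNReal.toReal_nonneg]
  have hsum : ∑ x, (lam x).toReal * |D x| =
      ∑ x, (lam x).toReal * ∑ y, (p x y).toReal * |D y| := by
    simp only [Finset.mul_sum]
    rw [Finset.sum_comm]
    simp only [← mul_assoc, ← Finset.sum_mul, hinv']
  have heq := (Finset.sum_eq_sum_iff_of_le (s := Finset.univ) fun x _ =>
    mul_le_mul_of_nonneg_left (hsub x) (ENNReal.toReal_nonneg (a := lam x))).1 hsum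
  refine prop_along hirr (fun x => D x = 0) i hi ?_
  intro x y hx hxy
  have h1 := heq x (Finset.mem_univ x)
  have hlx : (lam x).toReal ≠ 0 := ENNReal.toReal_ne_zero.2 ⟨lam_pos hirr hlam hinv x, hlt x⟩
  have h2 := mul_left_cancel₀ hlx h1
  rw [hx, abs_zero, eq_comm, Finset.sum_eq_zero_iff_of_nonneg (fun _ _ => by positivity)] at h2
  have h3 := h2 y (Finset.mem_univ y)
  rcases mul_eq_zero.1 h3 with h | h
  · exact absurd h (ENNReal.toReal_ne_zero.2 ⟨hxy, hpt x y⟩)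
  · exact abs_eq_zero.1 h

theorem u_step {l : ℕ} {p : Fin l → Fin l → ℝ≥0∞} {P : Fin l → Measure (ℕ → Fin l)}
    (hrow : ∀ i, ∑ j, p i j = 1)
    (hP : IsMarkovChainLaw p P) (i j x : Fin l) (hxj : x ≠ j) :
    P x {ω | hitT j ω < hitTpos i ω} = ∑ y, p x y * P y {ω | hitT j ω < hitT i ω} := by
  have hm : MeasurableSet {ω : ℕ → Fin l | hitT j ω < hitT i ω} :=
    measurableSet_lt (measurable_hitT j) (measurable_hitT i)
  have h1 : P x {ω | hitT j ω < hitTpos i ω} =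
      P x (shf ⁻¹' {ω | hitT j ω < hitT i ω}) := by
    refine measure_congr ?_
    filter_upwards [start hP x] with ω hω
    have : hitT j ω < hitTpos i ω ↔ hitT j (shf ω) < hitT i (shf ω) := by
      rw [hitT_of_ne j ω (hω ▸ hxj), hitTpos_eq, ENNReal.add_lt_add_iff_left ENNReal.one_ne_top]
    exact propext this
  rw [h1, ← Measure.map_apply measurable_shf hm, markov hrow hP]
  simp

theorem u_step2 {l : ℕ} {p : Fin l → Fin l → ℝ≥0∞} {P : Fin l → Measure (ℕ → Fin l)}
    (hrow : ∀ i, ∑ j, p i j = 1)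
    (hP : IsMarkovChainLaw p P) (i j x : Fin l) (hxi : x ≠ i) (hxj : x ≠ j) :
    P x {ω | hitT j ω < hitT i ω} = ∑ y, p x y * P y {ω | hitT j ω < hitT i ω} := by
  rw [← u_step hrow hP i j x hxj]
  refine measure_congr ?_
  filter_upwards [start hP x] with ω hω
  have : hitT j ω < hitT i ω ↔ hitT j ω < hitTpos i ω := by
    rw [hitT_of_ne i ω (hω ▸ hxi), hitTpos_eq]
  exact propext this

theorem u_zero {l : ℕ} {p : Fin l → Fin l → ℝ≥0∞} {P : Fin l → Measure (ℕ → Fin l)}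
    (hP : IsMarkovChainLaw p P) (i j : Fin l) :
    P i {ω | hitT j ω < hitT i ω} = 0 := by
  have : ∀ᵐ ω ∂ P i, ¬ (hitT j ω < hitT i ω) := by
    filter_upwards [start hP i] with ω hω
    simp [hitT_zero i ω hω]
  simpa [ae_iff] using this

theorem u_one {l : ℕ} {p : Fin l → Fin l → ℝ≥0∞} {P : Fin l → Measure (ℕ → Fin l)}
    (hP : IsMarkovChainLaw p P) (i j : Fin l) (hij : j ≠ i) :
    P j {ω | hitT j ω < hitT i ω} = 1 := by
  have := hP.1 j
  have h : {ω : ℕ → Fin l | hitT j ω < hitT i ω} =ᵐ[P j] Set.univ := by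
    filter_upwards [start hP j] with ω hω
    have : hitT j ω < hitT i ω := by
      rw [hitT_zero j ω hω, hitT_of_ne i ω (hω ▸ hij)]
      exact lt_of_lt_of_le one_pos le_self_add
    exact propext ⟨fun _ => trivial, fun _ => this⟩
  rw [measure_congr h]
  simp

/-- For all states `i ≠ j` of an irreducible finite-state Markov chain with
invariant distribution `λ`: `P_i(T_j < T_i⁺) = 1 / (λ_i (E_j[T_i] + E_i[T_j]))`. -/
theorem prob_hit_before_return {l : ℕ} (hl : 2 ≤ l)
    (p : Fin l → Fin l → ℝ≥0∞) (hrow : ∀ i, ∑ j, p i j = 1)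
    (hirr : Irreducible p)
    (lam : Fin l → ℝ≥0∞) (hlam : ∑ i, lam i = 1)
    (hinv : ∀ j, ∑ i, lam i * p i j = lam j)
    (P : Fin l → Measure (ℕ → Fin l)) (hP : IsMarkovChainLaw p P)
    (i j : Fin l) (hij : j ≠ i) :
    P i {ω | hitT j ω < hitTpos i ω}
      = 1 / (lam i * ((∫⁻ ω, hitT i ω ∂ P j) + ∫⁻ ω, hitT j ω ∂ P i)) := by
  have hpr := hP.1
  have hpt : ∀ x y, p x y ≠ ⊤ := fun x y hx => by
    have := (Finset.single_le_sum (f := p x) (fun _ _ => zero_le) (Finset.mem_univ y))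
    rw [hrow, hx] at this
    simp at this
  have hrow' : ∀ x, ∑ y, (p x y).toReal = 1 := by
    intro x
    rw [← ENNReal.toReal_sum fun y _ => hpt x y, hrow]
    simp
  have hsumR : ∀ (v : Fin l → ℝ≥0∞), (∀ y, v y ≠ ⊤) → ∀ x,
      (∑ y, p x y * v y).toReal = ∑ y, (p x y).toReal * (v y).toReal := by
    intro v hv x
    rw [ENNReal.toReal_sum fun y _ => ENNReal.mul_ne_top (hpt x y) (hv y)]
    simp
  have hsumF : ∀ (v : Fin l → ℝ≥0∞), (∀ y, v y ≠ ⊤) → ∀ x, ∑ y, p x y * v y ≠ ⊤ := fun v hv x =>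
    ENNReal.sum_ne_top.2 fun y _ => ENNReal.mul_ne_top (hpt x y) (hv y)
  have hF := fun j x => h_fin hrow hirr hlam hinv hP j x
  have hstep := fun j x hx => h_step hrow hP j x hx
  have hself := fun j => h_self hP j
  -- Kac
  have hkac : lam i * (1 + ∑ y, p i y * ∫⁻ ω, hitT i ω ∂ P y) = 1 := by
    have hk := kac_alg hlam hinv i (fun y => ∫⁻ ω, hitT i ω ∂ P y)
      (fun y => ∫⁻ ω, hitT i ω ∂ P y) (hself i) (hstep i)
    have hlt : ∀ x, lam x ≠ ⊤ := fun x hx => by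
      have := (Finset.single_le_sum (f := lam) (fun _ _ => zero_le) (Finset.mem_univ x))
      rw [hlam, hx] at this
      simp at this
    have hfin : ∑ x, lam x * ∫⁻ ω, hitT i ω ∂ P x ≠ ⊤ :=
      ENNReal.sum_ne_top.2 fun x _ => ENNReal.mul_ne_top (hlt x) (hF i x)
    exact (ENNReal.add_right_inj hfin).1 (hk.trans (add_comm _ _))
  have hustep := u_step hrow hP i j i hij.symm
  have hu2 := fun x h1 h2 => u_step2 hrow hP i j x h1 h2
  have hu0 := u_zero hP i j
  have hu1 := u_one hP i j hij
  set q := P i {ω | hitT j ω < hitTpos i ω} with hq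
  have hqF : q ≠ ⊤ := measure_ne_top _ _
  have hUF : ∀ x, P x {ω | hitT j ω < hitT i ω} ≠ ⊤ := fun x => measure_ne_top _ _
  clear_value q
  generalize hU : (fun x => P x {ω | hitT j ω < hitT i ω}) = U at *
  have hU' : ∀ x, P x {ω | hitT j ω < hitT i ω} = U x := fun x => congrFun hU x
  generalize hH : (fun j x => ∫⁻ ω, hitT j ω ∂ P x) = H at *
  have hH' : ∀ j x, ∫⁻ ω, hitT j ω ∂ P x = H j x := fun j x => congrFun (congrFun hH j) x
  simp only [hU', hH'] at *
  clear hU hU' hH hH'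
  set c : ℝ := (H j i).toReal + (H i j).toReal with hc
  have hstepR : ∀ j x, x ≠ j →
      (H j x).toReal = 1 + ∑ y, (p x y).toReal * (H j y).toReal := by
    intro j x hx
    rw [hstep j x hx, ENNReal.toReal_add ENNReal.one_ne_top (hsumF _ (hF j) x),
      hsumR _ (hF j) x]
    simp
  have hD := harm_uniq hrow hirr hlam hinv i j
    (fun x => (H j x).toReal - (H i x).toReal - (H j i).toReal + c * (U x).toReal)
    (by simp [hself, hu0]) (by simp [hself, hu1, hc]; ring) (by
      intro x hxi hxj
      simp only [mul_add, mul_sub, Finset.sum_add_distrib, Finset.sum_sub_distrib,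
        ← Finset.sum_mul, hrow']
      have h3 : (U x).toReal = ∑ y, (p x y).toReal * (U y).toReal := by
        rw [hu2 x hxi hxj, hsumR _ hUF x]
      have h4 : ∑ y, (p x y).toReal * (c * (U y).toReal) = c * (U x).toReal := by
        rw [h3, Finset.mul_sum]
        exact Finset.sum_congr rfl fun y _ => by ring
      rw [h4, hstepR j x hxj, hstepR i x hxi]
      ring)
  have hqR : q.toReal = ∑ y, (p i y).toReal * (U y).toReal := by
    rw [hustep, hsumR _ hUF i]
  have hmain : c * q.toReal = 1 + ∑ y, (p i y).toReal * (H i y).toReal := by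
    have h5 : ∑ y, (p i y).toReal *
        ((H j y).toReal - (H i y).toReal - (H j i).toReal + c * (U y).toReal) = 0 :=
      Finset.sum_eq_zero fun y _ => by rw [hD y, mul_zero]
    simp only [mul_add, mul_sub, Finset.sum_add_distrib, Finset.sum_sub_distrib,
        ← Finset.sum_mul, hrow'] at h5
    have h4 : ∑ y, (p i y).toReal * (c * (U y).toReal) = c * q.toReal := by
      rw [hqR, Finset.mul_sum]
      exact Finset.sum_congr rfl fun y _ => by ring
    rw [h4] at h5
    have := hstepR j i hij.symm
    linarith
  have hE : (H i j + H j i) * q = 1 + ∑ y, p i y * H i y := by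
    rw [← ENNReal.toReal_eq_toReal_iff'
      (ENNReal.mul_ne_top (ENNReal.add_ne_top.2 ⟨hF i j, hF j i⟩) hqF)
      (ENNReal.add_ne_top.2 ⟨ENNReal.one_ne_top, hsumF _ (hF i) i⟩),
      ENNReal.toReal_mul, ENNReal.toReal_add (hF i j) (hF j i),
      ENNReal.toReal_add ENNReal.one_ne_top (hsumF _ (hF i) i), hsumR _ (hF i) i,
      add_comm (H i j).toReal]
    simpa using hmain
  rw [← hE, ← mul_assoc, mul_comm] at hkac
  rw [one_div]
  exact ENNReal.eq_inv_of_mul_eq_one_left hkac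

end FW
end

section
/- For all pairwise distinct i, j, k ∈ L and every x ∈ 𝒳_k: a^{−4^{l−2}} · P_k(T_j < T_i) ≤ P_x(T̃_j < T̃_i) ≤ a^{4^{l−2}} · P_k(T_j < T_i). -/
open MeasureTheory ProbabilityTheory
open scoped ENNReal Classical

namespace FW

variable {X : Type} [MeasurableSpace X]

/-- The probability, for the chain with transition kernel `κ` currently at `x`, that the next
`k` steps successively lie in the sets of the list `As`. -/
noncomputable def cylProb (κ : Kernel X X) : X → List (Set X) → ℝ≥0∞
  | _, [] => 1
  | x, A :: As => ∫⁻ y in A, cylProb κ y As ∂ κ x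

/-- `Q` is the family of path laws of the Markov chain on `X` with transition kernel `κ`:
`Q x` is a probability measure on paths, and the probability of every cylinder set is the
corresponding iterated integral of `κ` started at `x`. -/
def IsMarkovChainLawKernel (κ : Kernel X X) (Q : X → Measure (ℕ → X)) : Prop :=
  (∀ x, IsProbabilityMeasure (Q x)) ∧
    ∀ (x : X) (n : ℕ) (A : ℕ → Set X), (∀ k, MeasurableSet (A k)) →
      Q x {ω | ∀ k ≤ n, ω k ∈ A k} =
        Set.indicator (A 0) (fun _ => 1) x *
          cylProb κ x ((List.range n).map fun k => A (k + 1))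

/-- First hitting time `T̃_B = inf {n ≥ 0 : ω n ∈ B}` for the chain on `X`. -/
noncomputable def hitS (B : Set X) (ω : ℕ → X) : ℝ≥0∞ :=
  ⨅ n ∈ {n : ℕ | ω n ∈ B}, (n : ℝ≥0∞)

/-- Rates after elimination of the state `w`. -/
noncomputable def elimR {l : ℕ} (c : Fin l → Fin l → ℝ) (w : Fin l) : Fin l → Fin l → ℝ :=
  fun u v => if v = w ∨ v = u then 0 else c u v + c u w * c w v / ∑ x, c w x

lemma elimR_sum {l : ℕ} (c : Fin l → Fin l → ℝ) (w u : Fin l)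
    (hw : c w w = 0) (hC : 0 < ∑ x, c w x) (M : Fin l → ℝ) :
    ∑ v, elimR c w u v * (M v - M u) =
      ∑ v, c u v * (M v - M u) + c u w / (∑ x, c w x) * ∑ v, c w v * (M v - M w) := by
  set C := ∑ x, c w x with hCdef
  have h1 : ∀ v, elimR c w u v * (M v - M u) =
      c u v * (M v - M u) + c u w / C * (c w v * (M v - M w)) + c u w / C * (c w v * (M w - M u))
        - (if v = w then c u w * (M w - M u) else 0) := by
    intro v
    unfold elimR
    rw [← hCdef]
    by_cases h : v = w
    · subst h; simp [hw]
    · by_cases h' : v = u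
      · subst h'; simp [h]; ring
      · simp [h, h']; ring
  rw [Finset.sum_congr rfl (fun v _ => h1 v), Finset.sum_sub_distrib, Finset.sum_add_distrib,
    Finset.sum_add_distrib, Finset.sum_ite_eq' Finset.univ w]
  simp only [Finset.mem_univ, if_true]
  rw [← Finset.mul_sum, ← Finset.mul_sum, ← Finset.sum_mul, ← hCdef]
  field_simp
  ring

lemma elimR_le {l : ℕ} (c q : Fin l → Fin l → ℝ) (a : ℝ) (ha : 1 ≤ a) (w u : Fin l)
    (hc0 : ∀ v, 0 ≤ c u v) (hc0' : ∀ v, 0 ≤ c w v)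
    (hq0 : ∀ v, 0 ≤ q u v) (hq0' : ∀ v, 0 ≤ q w v)
    (hC : 0 < ∑ x, c w x) (hQ : 0 < ∑ x, q w x)
    (h1 : ∀ v, c u v ≤ a * q u v) (h2 : ∀ v, c w v ≤ a * q w v)
    (h3 : ∀ v, q w v ≤ a * c w v) (v : Fin l) :
    elimR c w u v ≤ a ^ 3 * elimR q w u v := by
  unfold elimR
  split_ifs with h
  · simp
  · have ha0 : 0 < a := by linarith
    have hQC : ∑ x, q w x ≤ a * ∑ x, c w x := by
      rw [Finset.mul_sum]; exact Finset.sum_le_sum fun x _ => h3 x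
    rw [mul_add]
    have e1 : c u v ≤ a ^ 3 * q u v := by
      refine (h1 v).trans ?_
      refine mul_le_mul_of_nonneg_right ?_ (hq0 v)
      exact le_self_pow₀ ha (by norm_num)
    have e2 : c u w * c w v / ∑ x, c w x ≤ a ^ 3 * (q u w * q w v / ∑ x, q w x) := by
      rw [← mul_div_assoc, div_le_div_iff₀ hC hQ]
      calc c u w * c w v * ∑ x, q w x ≤ (a * q u w) * (a * q w v) * (a * ∑ x, c w x) := by
            have := h1 w
            have := h2 v
            have := hc0 w
            have := hc0' v
            have := hq0 w
            have := hq0' v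
            gcongr
        _ = _ := by ring
    linarith

lemma elimR_nonneg {l : ℕ} (c : Fin l → Fin l → ℝ) (w u : Fin l)
    (hc0 : ∀ v, 0 ≤ c u v) (hc0' : ∀ v, 0 ≤ c w v) (v : Fin l) : 0 ≤ elimR c w u v := by
  unfold elimR
  split_ifs with h
  · rfl
  · have := Finset.sum_nonneg (s := Finset.univ) (fun x _ => hc0' x)
    have := hc0 v
    have := hc0 w
    have := hc0' v
    positivity

/-- Comparison of a subharmonic and a superharmonic function for comparable rates. -/
lemma finite_comparison {l : ℕ} (j k : Fin l) (M H : Fin l → ℝ)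
    (hMj : M j = 1) (hHj : H j = 1) (hH0 : ∀ v, 0 ≤ H v) (n : ℕ) :
    ∀ (S : Finset (Fin l)) (c q : Fin l → Fin l → ℝ) (a : ℝ), S.card = n + 1 → k ∈ S → j ∉ S →
      1 ≤ a →
      (∀ u ∈ S, ∀ v, 0 ≤ c u v) → (∀ u ∈ S, ∀ v, 0 ≤ q u v) →
      (∀ u ∈ S, c u u = 0) → (∀ u ∈ S, q u u = 0) →
      (∀ u ∈ S, ∀ v, c u v ≤ a * q u v) → (∀ u ∈ S, ∀ v, q u v ≤ a * c u v) →
      (∀ u ∈ S, ∀ v, v ∉ S → v ≠ j → c u v * M v = 0) →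
      (∀ T ⊆ S, T.Nonempty → ∃ u ∈ T, ∃ v, v ∉ T ∧ 0 < q u v) →
      (∀ u ∈ S, 0 ≤ ∑ v, c u v * (M v - M u)) →
      (∀ u ∈ S, ∑ v, q u v * (H v - H u) ≤ 0) →
      M k ≤ a ^ (4 ^ (n + 1)) * H k := by
  have pos : ∀ (S : Finset (Fin l)) (c q : Fin l → Fin l → ℝ) (a : ℝ), 1 ≤ a →
      (∀ u ∈ S, ∀ v, 0 ≤ q u v) → (∀ u ∈ S, ∀ v, q u v ≤ a * c u v) →
      (∀ T ⊆ S, T.Nonempty → ∃ u ∈ T, ∃ v, v ∉ T ∧ 0 < q u v) → ∀ w ∈ S,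
      0 < ∑ v, q w v ∧ 0 < ∑ v, c w v := by
    intro S c q a ha hq0 hqc hcut w hw
    obtain ⟨u, hu, v, -, hv⟩ := hcut {w} (by simpa using hw) (by simp)
    obtain rfl : u = w := by simpa using hu
    have hQ : 0 < ∑ v, q u v :=
      Finset.sum_pos' (fun v _ => hq0 u hw v) ⟨v, Finset.mem_univ _, hv⟩
    refine ⟨hQ, ?_⟩
    have hQC : ∑ x, q u x ≤ a * ∑ x, c u x := by
      rw [Finset.mul_sum]; exact Finset.sum_le_sum fun x _ => hqc u hw x
    by_contra hneg
    push Not at hneg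
    nlinarith
  induction n with
  | zero =>
    intro S c q a hcard hk hj ha hc0 hq0 hcd hqd hcq hqc hbd hcut hsub hsup
    obtain ⟨k', rfl⟩ := Finset.card_eq_one.mp hcard
    obtain rfl : k = k' := by simpa using hk
    have hkS := Finset.mem_singleton_self k
    obtain ⟨hQ, hC⟩ := pos {k} c q a ha hq0 hqc hcut k hkS
    have hs1 := hsub k hkS
    have hs2 := hsup k hkS
    simp only [mul_sub, Finset.sum_sub_distrib, ← Finset.sum_mul] at hs1 hs2
    have e1 : ∑ v, c k v * M v = c k j := by
      rw [Finset.sum_eq_single j]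
      · simp [hMj]
      · intro v _ hv
        by_cases h : v = k
        · subst h; simp [hcd v hkS]
        · exact hbd k hkS v (by simpa using h) hv
      · simp
    have e2 : q k j ≤ ∑ v, q k v * H v := by
      have := Finset.single_le_sum (f := fun v => q k v * H v)
        (fun v _ => mul_nonneg (hq0 k hkS v) (hH0 v)) (Finset.mem_univ j)
      simpa [hHj] using this
    rw [e1] at hs1
    have hQC : ∑ x, q k x ≤ a * ∑ x, c k x := by
      rw [Finset.mul_sum]; exact Finset.sum_le_sum fun x _ => hqc k hkS x
    have h3 := hcq k hkS j
    have hHk := hH0 k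
    have ha0 : 0 < a := by linarith
    have h4 : M k * ∑ v, c k v ≤ (a ^ 2 * H k) * ∑ v, c k v := by
      calc M k * ∑ v, c k v ≤ c k j := by linarith
        _ ≤ a * q k j := h3
        _ ≤ a * ((∑ v, q k v) * H k) := by
            gcongr; linarith
        _ ≤ a * ((a * ∑ v, c k v) * H k) := by gcongr
        _ = _ := by ring
    have h5 := le_of_mul_le_mul_right h4 hC
    refine h5.trans ?_
    refine mul_le_mul_of_nonneg_right ?_ hHk
    exact pow_le_pow_right₀ ha (by norm_num)
  | succ n ih =>
    intro S c q a hcard hk hj ha hc0 hq0 hcd hqd hcq hqc hbd hcut hsub hsup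
    obtain ⟨w, hwS, hwk⟩ : ∃ w ∈ S, w ≠ k := Finset.exists_mem_ne (by omega) k
    obtain ⟨hQ, hC⟩ := pos S c q a ha hq0 hqc hcut w hwS
    have hmem : ∀ u ∈ S.erase w, u ∈ S := fun u hu => Finset.mem_of_mem_erase hu
    have key := ih (S.erase w) (elimR c w) (elimR q w) (a ^ 3)
      (by rw [Finset.card_erase_of_mem hwS]; omega) (Finset.mem_erase.2 ⟨hwk.symm, hk⟩)
      (fun h => hj (hmem _ h)) (one_le_pow₀ ha)
      (fun u hu v => elimR_nonneg c w u (hc0 u (hmem u hu)) (hc0 w hwS) v)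
      (fun u hu v => elimR_nonneg q w u (hq0 u (hmem u hu)) (hq0 w hwS) v)
      (fun u hu => by simp [elimR]) (fun u hu => by simp [elimR])
      (fun u hu v => elimR_le c q a ha w u (hc0 u (hmem u hu)) (hc0 w hwS) (hq0 u (hmem u hu))
        (hq0 w hwS) hC hQ (hcq u (hmem u hu)) (hcq w hwS) (hqc w hwS) v)
      (fun u hu v => elimR_le q c a ha w u (hq0 u (hmem u hu)) (hq0 w hwS) (hc0 u (hmem u hu))
        (hc0 w hwS) hQ hC (hqc u (hmem u hu)) (hqc w hwS) (hcq w hwS) v)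
      ?_ ?_ ?_ ?_
    · refine key.trans ?_
      refine mul_le_mul_of_nonneg_right ?_ (hH0 k)
      rw [← pow_mul]
      refine pow_le_pow_right₀ ha ?_
      rw [pow_succ 4 (n + 1)]; omega
    · intro u hu v hv hvj
      by_cases hvw : v = w
      · simp [elimR, hvw]
      · have hvS : v ∉ S := fun h => hv (Finset.mem_erase.2 ⟨hvw, h⟩)
        have b1 := hbd u (hmem u hu) v hvS hvj
        have b2 := hbd w hwS v hvS hvj
        unfold elimR
        split_ifs
        · simp
        · rw [add_mul, b1, div_mul_eq_mul_div, mul_assoc, b2]; simp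
    · intro T hT hTne
      have hTS : T ⊆ S := fun u hu => hmem u (hT hu)
      have hwT : w ∉ T := fun h => by simpa using hT h
      have hge : ∀ u ∈ S, ∀ v, v ≠ w → v ≠ u → q u v ≤ elimR q w u v ∧
          q u w * q w v / ∑ x, q w x ≤ elimR q w u v := by
        intro u hu v h1 h2
        have x1 : 0 ≤ q u w * q w v / ∑ x, q w x :=
          div_nonneg (mul_nonneg (hq0 u hu w) (hq0 w hwS v)) hQ.le
        have x2 := hq0 u hu v
        simp only [elimR, h1, h2, or_self, if_false]
        constructor <;> linarith
      obtain ⟨u, hu, v, hv, huv⟩ := hcut (insert w T)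
        (Finset.insert_subset hwS hTS) (by simp)
      have hvw : v ≠ w := fun h => hv (by simp [h])
      have hvT : v ∉ T := fun h => hv (by simp [h])
      rcases Finset.mem_insert.1 hu with rfl | huT
      · obtain ⟨u', hu', v', hv', huv'⟩ := hcut T hTS hTne
        by_cases hv'w : v' = u
        · subst hv'w
          refine ⟨u', hu', v, hvT, lt_of_lt_of_le ?_
            (hge u' (hTS hu') v hvw (fun h => hvT (h ▸ hu'))).2⟩
          positivity
        · exact ⟨u', hu', v', hv', lt_of_lt_of_le huv'
            (hge u' (hTS hu') v' hv'w (fun h => hv' (h ▸ hu'))).1⟩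
      · exact ⟨u, huT, v, hvT, lt_of_lt_of_le huv
            (hge u (hTS huT) v hvw (fun h => hvT (h ▸ huT))).1⟩
    · intro u hu
      rw [elimR_sum c w u (hcd w hwS) hC]
      have := hsub u (hmem u hu)
      have := hsub w hwS
      have := hc0 u (hmem u hu) w
      positivity
    · intro u hu
      rw [elimR_sum q w u (hqd w hwS) hQ]
      have h1 := hsup u (hmem u hu)
      have h2 := hsup w hwS
      have h3 : 0 ≤ q u w / ∑ x, q w x := div_nonneg (hq0 u (hmem u hu) w) hQ.le
      have := mul_nonpos_of_nonneg_of_nonpos h3 h2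
      linarith

lemma irr_closed {l : ℕ} {p : Fin l → Fin l → ℝ≥0∞} (hirr : Irreducible p)
    (T : Set (Fin l)) (k : Fin l) (hk : k ∈ T)
    (hT : ∀ u ∈ T, ∀ v, v ≠ u → p u v ≠ 0 → v ∈ T) (v : Fin l) : v ∈ T := by
  have h : ∀ n v, 0 < matPow p n k v → v ∈ T := by
    intro n
    induction n with
    | zero =>
      intro v hv
      by_cases h : k = v
      · exact h ▸ hk
      · simp [matPow, h] at hv
    | succ n ih =>
      intro v hv
      simp only [matPow] at hv
      obtain ⟨u, -, hu⟩ := Finset.exists_ne_zero_of_sum_ne_zero hv.ne'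
      have h1 : u ∈ T := ih u (pos_iff_ne_zero.2 (left_ne_zero_of_mul hu))
      by_cases h : v = u
      · exact h ▸ h1
      · exact hT u h1 v h (right_ne_zero_of_mul hu)
  obtain ⟨n, hn⟩ := hirr k v
  exact h n v hn

lemma hit_lt_iff (A B : ℕ → Prop) (hAB : ∀ n, A n → ¬ B n) :
    (⨅ n ∈ {n : ℕ | A n}, (n : ℝ≥0∞)) < (⨅ n ∈ {n : ℕ | B n}, (n : ℝ≥0∞)) ↔
      ∃ n, A n ∧ ∀ m < n, ¬ A m ∧ ¬ B m := by
  constructor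
  · intro h
    simp only [iInf_lt_iff] at h
    obtain ⟨n, hn, hlt⟩ := h
    have hex : ∃ n, A n := ⟨n, hn⟩
    refine ⟨Nat.find hex, Nat.find_spec hex, fun m hm => ⟨Nat.find_min hex hm, fun hB => ?_⟩⟩
    have h1 : Nat.find hex ≤ n := Nat.find_min' hex hn
    have h2 : (⨅ n ∈ {n : ℕ | B n}, (n : ℝ≥0∞)) ≤ m := iInf₂_le m hB
    have h3 : (m : ℝ≥0∞) ≤ n := by exact_mod_cast (hm.le.trans h1)
    exact absurd (hlt.trans_le (h2.trans h3)) (lt_irrefl _)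
  · rintro ⟨n, hn, h⟩
    have h1 : (⨅ n ∈ {n : ℕ | A n}, (n : ℝ≥0∞)) ≤ n := iInf₂_le n hn
    have h2 : ((n + 1 : ℕ) : ℝ≥0∞) ≤ ⨅ n ∈ {n : ℕ | B n}, (n : ℝ≥0∞) := by
      refine le_iInf₂ fun m hm => ?_
      have : n + 1 ≤ m := by
        by_contra hlt
        rcases Nat.lt_or_ge m n with h' | h'
        · exact (h m h').2 hm
        · obtain rfl : m = n := by omega
          exact hAB m hn hm
      exact_mod_cast this
    refine h1.trans_lt (lt_of_lt_of_le ?_ h2)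
    exact_mod_cast Nat.lt_succ_self n

/-- Decomposition of a hitting event. -/
lemma measure_hit {Y : Type} [MeasurableSpace Y] (μ : Measure (ℕ → Y)) (A B : Set Y)
    (hA : MeasurableSet A) (hB : MeasurableSet B) (hAB : Disjoint A B)
    (h0 : μ {ω | ω 0 ∈ A} = 0) :
    μ {ω | (⨅ n ∈ {n : ℕ | ω n ∈ A}, (n : ℝ≥0∞)) < (⨅ n ∈ {n : ℕ | ω n ∈ B}, (n : ℝ≥0∞))} =
      ∑' n, μ {ω | ∀ m ≤ n + 1, ω m ∈ if m < n + 1 then (A ∪ B)ᶜ else A} := by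
  set D : ℕ → Set (ℕ → Y) := fun n => {ω | ∀ m ≤ n, ω m ∈ if m < n then (A ∪ B)ᶜ else A} with hD
  have hDA : ∀ n ω, ω ∈ D n → ω n ∈ A := fun n ω h => by simpa using h n le_rfl
  have hDW : ∀ n ω, ω ∈ D n → ∀ m < n, ω m ∈ (A ∪ B)ᶜ := fun n ω h m hm => by
    have := h m hm.le
    rwa [if_pos hm] at this
  have e : {ω : ℕ → Y | (⨅ n ∈ {n : ℕ | ω n ∈ A}, (n : ℝ≥0∞)) <
      (⨅ n ∈ {n : ℕ | ω n ∈ B}, (n : ℝ≥0∞))} = ⋃ n, D n := by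
    ext ω
    rw [Set.mem_ofPred_eq, hit_lt_iff (fun n => ω n ∈ A) (fun n => ω n ∈ B)
      (fun n h1 h2 => Set.disjoint_left.1 hAB h1 h2), Set.mem_iUnion]
    refine exists_congr fun n => ⟨?_, ?_⟩
    · rintro ⟨h1, h2⟩ m hm
      split_ifs with h
      · have := h2 m h
        simpa [not_or] using this
      · obtain rfl : m = n := by omega
        exact h1
    · intro h
      refine ⟨hDA n ω h, fun m hm => ?_⟩
      have := hDW n ω h m hm
      simpa [not_or] using this
  have hmeas : ∀ n, MeasurableSet (D n) := by
    intro n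
    have : D n = ⋂ m, ⋂ (_ : m ≤ n), (fun ω : ℕ → Y => ω m) ⁻¹'
        (if m < n then (A ∪ B)ᶜ else A) := by
      ext ω; simp [hD]
    rw [this]
    refine MeasurableSet.iInter fun m => MeasurableSet.iInter fun _ => ?_
    refine measurable_pi_apply m ?_
    split_ifs
    · exact (hA.union hB).compl
    · exact hA
  have hdisj : Pairwise (Function.onFun Disjoint D) := by
    have aux : ∀ n m, n < m → Disjoint (D n) (D m) := by
      intro n m hnm
      refine Set.disjoint_left.2 fun ω h1 h2 => ?_
      exact hDW m ω h2 n hnm (Or.inl (hDA n ω h1))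
    intro n m hnm
    rcases lt_or_gt_of_ne hnm with h | h
    · exact aux n m h
    · exact (aux m n h).symm
  rw [e, measure_iUnion hdisj hmeas, tsum_eq_zero_add' ENNReal.summable]
  have hz : μ (D 0) = 0 := by
    rw [← h0]; congr 1; ext ω; simp [hD]
  rw [hz, zero_add]

/-- First passage probabilities of the kernel chain. -/
noncomputable def gK {X : Type} [MeasurableSpace X] (κ : Kernel X X) (W A : Set X) :
    ℕ → X → ℝ≥0∞
  | 0 => fun x => κ x A
  | n + 1 => fun x => ∫⁻ y in W, gK κ W A n y ∂ κ x

lemma cylProb_eq_gK {X : Type} [MeasurableSpace X] (κ : Kernel X X) (W A : Set X) (n : ℕ) :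
    ∀ x, cylProb κ x ((List.range (n + 1)).map fun k => if k + 1 < n + 1 then W else A) =
      gK κ W A n x := by
  induction n with
  | zero => intro x; simp [cylProb, gK]
  | succ n ih =>
    intro x
    rw [List.range_succ_eq_map, List.map_cons, List.map_map]
    simp only [cylProb, gK]
    rw [if_pos (by omega)]
    congr 1
    funext y
    rw [← ih y]
    congr 1
    refine List.map_congr_left fun k _ => ?_
    simp only [Function.comp, Nat.succ_eq_add_one]
    congr 1
    simp

lemma measurable_gK {X : Type} [MeasurableSpace X] (κ : Kernel X X) [IsMarkovKernel κ]
    {W A : Set X} (hW : MeasurableSet W) (hA : MeasurableSet A) (n : ℕ) :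
    Measurable (gK κ W A n) := by
  induction n with
  | zero => exact κ.measurable_coe hA
  | succ n ih => exact ih.setLIntegral_kernel hW

lemma tsum_gK {X : Type} [MeasurableSpace X] (κ : Kernel X X) [IsMarkovKernel κ]
    {W A : Set X} (hW : MeasurableSet W) (hA : MeasurableSet A) (x : X) :
    ∑' n, gK κ W A n x = κ x A + ∫⁻ y in W, ∑' n, gK κ W A n y ∂ κ x := by
  rw [tsum_eq_zero_add' ENNReal.summable,
    lintegral_tsum (fun n => (measurable_gK κ hW hA n).aemeasurable)]
  rfl

/-- First passage probabilities of the finite chain. -/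
noncomputable def gF {l : ℕ} (p : Fin l → Fin l → ℝ≥0∞) (i j : Fin l) : ℕ → Fin l → ℝ≥0∞
  | 0 => fun u => p u j
  | n + 1 => fun u => ∑ v, if v = i ∨ v = j then 0 else p u v * gF p i j n v

lemma tsum_gF {l : ℕ} (p : Fin l → Fin l → ℝ≥0∞) (i j u : Fin l) (hij : i ≠ j) :
    ∑' n, gF p i j n u =
      ∑ v, p u v * (if v = j then 1 else if v = i then 0 else ∑' n, gF p i j n v) := by
  rw [tsum_eq_zero_add' ENNReal.summable]
  simp only [gF]
  rw [Summable.tsum_finsetSum (fun _ _ => ENNReal.summable)]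
  have h : p u j = ∑ v, if v = j then p u v else 0 := by simp
  rw [h, ← Finset.sum_add_distrib]
  refine Finset.sum_congr rfl fun v _ => ?_
  by_cases h1 : v = j
  · simp [h1]
  · by_cases h2 : v = i
    · simp [h2, hij]
    · simp [h1, h2, ENNReal.tsum_mul_left]

lemma finite_markov {l : ℕ} (p : Fin l → Fin l → ℝ≥0∞) (P : Fin l → Measure (ℕ → Fin l))
    (hP : IsMarkovChainLaw p P) (i j u : Fin l) (r : ℕ) :
    ∀ (n : ℕ) (s : ℕ → Fin l),
      P u {ω | (∀ m ≤ n, ω m = s m) ∧ (∀ m < r, ω (n + 1 + m) ≠ i ∧ ω (n + 1 + m) ≠ j) ∧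
        ω (n + 1 + r) = j} = P u {ω | ∀ m ≤ n, ω m = s m} * gF p i j r (s n) := by
  have step : ∀ (n : ℕ) (s : ℕ → Fin l) (v : Fin l),
      {ω : ℕ → Fin l | ∀ m ≤ n + 1, ω m = Function.update s (n + 1) v m} =
        {ω | (∀ m ≤ n, ω m = s m) ∧ ω (n + 1) = v} := by
    intro n s v
    ext ω
    constructor
    · intro h
      refine ⟨fun m hm => ?_, by simpa using h (n + 1) le_rfl⟩
      have := h m (by omega)
      rwa [Function.update_of_ne (by omega)] at this
    · rintro ⟨h1, h2⟩ m hm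
      by_cases h : m = n + 1
      · subst h; simpa using h2
      · rw [Function.update_of_ne h]; exact h1 m (by omega)
  have stepP : ∀ (n : ℕ) (s : ℕ → Fin l) (v : Fin l),
      P u {ω : ℕ → Fin l | (∀ m ≤ n, ω m = s m) ∧ ω (n + 1) = v} =
        P u {ω | ∀ m ≤ n, ω m = s m} * p (s n) v := by
    intro n s v
    rw [← step, hP.2, hP.2, Finset.prod_range_succ]
    rw [Function.update_of_ne (by omega), Function.update_of_ne (by omega), Function.update_self,
      ← mul_assoc]
    congr 2
    refine Finset.prod_congr rfl fun m hm => ?_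
    have := Finset.mem_range.1 hm
    rw [Function.update_of_ne (by omega), Function.update_of_ne (by omega)]
  induction r with
  | zero =>
    intro n s
    simpa [gF] using stepP n s j
  | succ r ih =>
    intro n s
    have e : {ω : ℕ → Fin l | (∀ m ≤ n, ω m = s m) ∧
        (∀ m < r + 1, ω (n + 1 + m) ≠ i ∧ ω (n + 1 + m) ≠ j) ∧ ω (n + 1 + (r + 1)) = j} =
        ⋃ v ∈ Finset.univ.filter (fun v => ¬ (v = i ∨ v = j)),
          {ω | (∀ m ≤ n + 1, ω m = Function.update s (n + 1) v m) ∧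
            (∀ m < r, ω (n + 1 + 1 + m) ≠ i ∧ ω (n + 1 + 1 + m) ≠ j) ∧
              ω (n + 1 + 1 + r) = j} := by
      ext ω
      have hs := fun v => Set.ext_iff.1 (step n s v) ω
      simp only [Set.mem_ofPred_eq] at hs
      simp only [Set.mem_iUnion, Set.mem_ofPred_eq, Finset.mem_filter, Finset.mem_univ, true_and,
        hs, exists_prop, not_or]
      constructor
      · rintro ⟨h1, h2, h3⟩
        refine ⟨ω (n + 1), by simpa using h2 0 (by omega), ⟨h1, rfl⟩, fun m hm => ?_, ?_⟩
        · have := h2 (m + 1) (by omega)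
          rwa [show n + 1 + (m + 1) = n + 1 + 1 + m by omega] at this
        · rwa [show n + 1 + (r + 1) = n + 1 + 1 + r by omega] at h3
      · rintro ⟨v, hv, ⟨h1, h2⟩, h3, h4⟩
        refine ⟨h1, fun m hm => ?_, ?_⟩
        · rcases m with _ | m
          · simpa [h2] using hv
          · have := h3 m (by omega)
            rwa [show n + 1 + 1 + m = n + 1 + (m + 1) by omega] at this
        · rwa [show n + 1 + (r + 1) = n + 1 + 1 + r by omega]
    have cyl : ∀ (m : ℕ) (v : Fin l), MeasurableSet {ω : ℕ → Fin l | ω m = v} := fun m v =>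
      (measurable_pi_apply (X := fun _ : ℕ => Fin l) m) (measurableSet_singleton v)
    rw [e, measure_biUnion_finset]
    · simp only [ih]
      rw [Finset.sum_filter]
      simp only [gF]
      rw [Finset.mul_sum]
      refine Finset.sum_congr rfl fun v _ => ?_
      by_cases hv : v = i ∨ v = j
      · simp [hv]
      · simp only [hv, not_false_eq_true, if_true, if_false]
        rw [step, stepP, Function.update_self, mul_assoc]
    · intro v _ v' _ hvv'
      refine Set.disjoint_left.2 fun ω h1 h2 => hvv' ?_
      have a1 := h1.1 (n + 1) le_rfl
      have a2 := h2.1 (n + 1) le_rfl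
      rw [Function.update_self] at a1 a2
      exact a1.symm.trans a2
    · intro v _
      have : Countable ℕ := inferInstance
      refine MeasurableSet.inter ?_ (MeasurableSet.inter ?_ (cyl _ _))
      · have : {ω : ℕ → Fin l | ∀ m ≤ n + 1, ω m = Function.update s (n + 1) v m} =
            ⋂ m, ⋂ (_ : m ≤ n + 1), {ω | ω m = Function.update s (n + 1) v m} := by
          ext ω; simp
        change MeasurableSet {ω : ℕ → Fin l | ∀ m ≤ n + 1, ω m = Function.update s (n + 1) v m}
        rw [this]
        exact MeasurableSet.iInter fun m => MeasurableSet.iInter fun _ => cyl _ _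
      · have : {ω : ℕ → Fin l | ∀ m < r, ω (n + 1 + 1 + m) ≠ i ∧ ω (n + 1 + 1 + m) ≠ j} =
            ⋂ m, ⋂ (_ : m < r), ({ω | ω (n + 1 + 1 + m) = i}ᶜ ∩ {ω | ω (n + 1 + 1 + m) = j}ᶜ) := by
          ext ω; simp
        change MeasurableSet
          {ω : ℕ → Fin l | ∀ m < r, ω (n + 1 + 1 + m) ≠ i ∧ ω (n + 1 + 1 + m) ≠ j}
        rw [this]
        exact MeasurableSet.iInter fun m => MeasurableSet.iInter fun _ =>
          (cyl _ _).compl.inter (cyl _ _).compl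

lemma finite_hit {l : ℕ} (p : Fin l → Fin l → ℝ≥0∞) (P : Fin l → Measure (ℕ → Fin l))
    (hP : IsMarkovChainLaw p P) (i j u : Fin l) (hij : i ≠ j) (hui : u ≠ i) (huj : u ≠ j) :
    P u {ω | hitT j ω < hitT i ω} = ∑' n, gF p i j n u := by
  have hp1 := hP.1 u
  have h00 := hP.2 u 0 (fun _ => u)
  simp only [nonpos_iff_eq_zero, forall_eq, if_true, Finset.range_zero, Finset.prod_empty,
    mul_one] at h00
  have h0 : P u {ω | ω 0 ∈ ({j} : Set (Fin l))} = 0 := by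
    have := hP.2 u 0 (fun _ => j)
    simpa [huj.symm] using this
  have := measure_hit (P u) {j} {i} (measurableSet_singleton j) (measurableSet_singleton i)
    (by simpa using hij.symm) h0
  have e : {ω : ℕ → Fin l | hitT j ω < hitT i ω} = {ω : ℕ → Fin l |
      (⨅ n ∈ {n : ℕ | ω n ∈ ({j} : Set (Fin l))}, (n : ℝ≥0∞)) <
        (⨅ n ∈ {n : ℕ | ω n ∈ ({i} : Set (Fin l))}, (n : ℝ≥0∞))} := rfl
  rw [e, this]
  refine tsum_congr fun n => ?_
  have h1 := finite_markov p P hP i j u n 0 (fun _ => u)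
  simp only [nonpos_iff_eq_zero, forall_eq, h00, one_mul] at h1
  rw [← h1]
  have hae : ∀ᵐ ω ∂(P u), ω 0 = u := by
    rw [ae_iff]
    have hm : MeasurableSet {ω : ℕ → Fin l | ω 0 = u} :=
      (measurable_pi_apply (X := fun _ : ℕ => Fin l) 0) (measurableSet_singleton u)
    exact (prob_compl_eq_zero_iff hm).2 h00
  refine measure_congr ?_
  filter_upwards [hae] with ω hω
  refine propext ?_
  change (∀ m ≤ n + 1, ω m ∈ if m < n + 1 then ({j} ∪ {i} : Set (Fin l))ᶜ else {j}) ↔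
    (ω 0 = u ∧ (∀ m < n, ω (0 + 1 + m) ≠ i ∧ ω (0 + 1 + m) ≠ j) ∧ ω (0 + 1 + n) = j)
  constructor
  · intro h
    refine ⟨hω, fun m hm => ?_, ?_⟩
    · have := h (0 + 1 + m) (by omega)
      rw [if_pos (by omega)] at this
      simp only [Set.mem_compl_iff, Set.mem_union, Set.mem_singleton_iff, not_or] at this
      exact this.symm
    · have := h (0 + 1 + n) (by omega)
      rw [if_neg (by omega)] at this
      exact this
  · rintro ⟨-, h2, h3⟩ m hm
    split_ifs with h
    · simp only [Set.mem_compl_iff, Set.mem_union, Set.mem_singleton_iff, not_or]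
      rcases m with _ | m
      · rw [hω]; exact ⟨huj, hui⟩
      · have := h2 m (by omega)
        rw [show 0 + 1 + m = m + 1 by omega] at this
        exact this.symm
    · obtain rfl : m = 0 + 1 + n := by omega
      exact h3

lemma kernel_hit {X : Type} [MeasurableSpace X] (κ : Kernel X X)
    (Q : X → Measure (ℕ → X)) (hQ : IsMarkovChainLawKernel κ Q) (A B : Set X)
    (hA : MeasurableSet A) (hB : MeasurableSet B) (hAB : Disjoint A B) (x : X)
    (hx : x ∈ (A ∪ B)ᶜ) :
    Q x {ω | hitS A ω < hitS B ω} = ∑' n, gK κ (A ∪ B)ᶜ A n x := by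
  have hxA : x ∉ A := fun h => hx (Or.inl h)
  have h0 : Q x {ω | ω 0 ∈ A} = 0 := by
    have := hQ.2 x 0 (fun _ => A) (fun _ => hA)
    simpa [hxA] using this
  have := measure_hit (Q x) A B hA hB hAB h0
  unfold hitS
  rw [this]
  refine tsum_congr fun n => ?_
  have h1 := hQ.2 x (n + 1) (fun m => if m < n + 1 then (A ∪ B)ᶜ else A)
    (fun m => by
      split_ifs
      · exact (hA.union hB).compl
      · exact hA)
  rw [h1, cylProb_eq_gK]
  simp only [Nat.zero_lt_succ, if_true]
  rw [Set.indicator_of_mem hx, one_mul]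

lemma kernel_step {X : Type} [MeasurableSpace X] {l : ℕ}
    (Xs : Fin l → Set X) (hXmeas : ∀ i, MeasurableSet (Xs i))
    (hXdisj : Pairwise fun i j => Disjoint (Xs i) (Xs j))
    (hXcover : (⋃ i, Xs i) = Set.univ)
    (κ : Kernel X X) [IsMarkovKernel κ] (i j : Fin l) (hij : i ≠ j) (x : X) :
    ∑' n, gK κ (Xs j ∪ Xs i)ᶜ (Xs j) n x = ∑ v, (if v = j then κ x (Xs v) else if v = i then 0
      else ∫⁻ y in Xs v, ∑' n, gK κ (Xs j ∪ Xs i)ᶜ (Xs j) n y ∂ κ x) := by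
  rw [tsum_gK κ ((hXmeas j).union (hXmeas i)).compl (hXmeas j)]
  have hW : (Xs j ∪ Xs i)ᶜ = ⋃ v ∈ Finset.univ.filter (fun v => ¬ (v = j ∨ v = i)), Xs v := by
    ext y
    obtain ⟨w, hw⟩ := Set.mem_iUnion.1 (hXcover ▸ Set.mem_univ y : y ∈ ⋃ i, Xs i)
    have huniq : ∀ v, y ∈ Xs v → v = w := fun v hv => by
      by_contra hne
      exact Set.disjoint_left.1 (hXdisj hne) hv hw
    simp only [Set.mem_compl_iff, Set.mem_union, Set.mem_iUnion, Finset.mem_filter,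
      Finset.mem_univ, true_and, exists_prop]
    constructor
    · intro h
      refine ⟨w, ?_, hw⟩
      rintro (rfl | rfl)
      · exact h (Or.inl hw)
      · exact h (Or.inr hw)
    · rintro ⟨v, hv, hyv⟩ h
      rcases h with h | h
      · exact hv (Or.inl ((huniq v hyv).trans (huniq j h).symm))
      · exact hv (Or.inr ((huniq v hyv).trans (huniq i h).symm))
  set f : X → ℝ≥0∞ := fun y => ∑' n, gK κ (Xs j ∪ Xs i)ᶜ (Xs j) n y with hf
  have h1 : ∫⁻ y in (Xs j ∪ Xs i)ᶜ, f y ∂ κ x =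
      ∑ v, if ¬ (v = j ∨ v = i) then ∫⁻ y in Xs v, f y ∂ κ x else 0 := by
    rw [hW, lintegral_biUnion_finset, Finset.sum_filter]
    · intro v _ w _ hvw
      exact hXdisj hvw
    · intro v _
      exact hXmeas v
  have h2 : κ x (Xs j) = ∑ v, if v = j then κ x (Xs v) else 0 := by simp
  rw [h1, h2, ← Finset.sum_add_distrib]
  refine Finset.sum_congr rfl fun v _ => ?_
  by_cases hv : v = j
  · simp [hv]
  · by_cases hv' : v = i <;> simp [hv, hv']

/-- For pairwise distinct `i, j, k` and any `x ∈ 𝒳_k`: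
`a^{−4^{l−2}} · P_k(T_j < T_i) ≤ P_x(T̃_j < T̃_i) ≤ a^{4^{l−2}} · P_k(T_j < T_i)`. -/
theorem hit_prob_comparison {l : ℕ} (hl : 2 ≤ l)
    (p : Fin l → Fin l → ℝ≥0∞) (hrow : ∀ i, ∑ j, p i j = 1)
    (hirr : Irreducible p)
    (P : Fin l → Measure (ℕ → Fin l)) (hP : IsMarkovChainLaw p P)
    (Xs : Fin l → Set X) (hXmeas : ∀ i, MeasurableSet (Xs i))
    (hXdisj : Pairwise fun i j => Disjoint (Xs i) (Xs j))
    (hXcover : (⋃ i, Xs i) = Set.univ)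
    (κ : Kernel X X) (hκ : IsMarkovKernel κ)
    (Q : X → Measure (ℕ → X)) (hQ : IsMarkovChainLawKernel κ Q)
    (a : ℝ≥0∞) (ha1 : 1 ≤ a) (haT : a ≠ ⊤)
    (hcomp : ∀ (i j : Fin l), j ≠ i → ∀ x ∈ Xs i,
      a⁻¹ * p i j ≤ κ x (Xs j) ∧ κ x (Xs j) ≤ a * p i j)
    (i j k : Fin l) (hij : i ≠ j) (hik : i ≠ k) (hjk : j ≠ k)
    (x : X) (hx : x ∈ Xs k) :
    (a ^ (4 ^ (l - 2)))⁻¹ * P k {ω | hitT j ω < hitT i ω}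
        ≤ Q x {ω | hitS (Xs j) ω < hitS (Xs i) ω} ∧
      Q x {ω | hitS (Xs j) ω < hitS (Xs i) ω}
        ≤ a ^ (4 ^ (l - 2)) * P k {ω | hitT j ω < hitT i ω} := by
  set N := 4 ^ (l - 2) with hN
  have hPp := hP.1
  have hQp := hQ.1
  set h : X → ℝ≥0∞ := fun y => ∑' n, gK κ (Xs j ∪ Xs i)ᶜ (Xs j) n y with hh
  have hpfin : ∀ u v, p u v ≠ ⊤ := by
    intro u v
    have h1 : p u v ≤ ∑ w, p u w := Finset.single_le_sum (fun w _ => zero_le) (Finset.mem_univ v)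
    rw [hrow u] at h1
    exact ne_top_of_le_ne_top ENNReal.one_ne_top h1
  have hhit : ∀ u, u ≠ i → u ≠ j → ∀ y ∈ Xs u,
      Q y {ω | hitS (Xs j) ω < hitS (Xs i) ω} = h y := by
    intro u hui huj y hy
    refine kernel_hit κ Q hQ (Xs j) (Xs i) (hXmeas j) (hXmeas i) (hXdisj hij.symm) y ?_
    rintro (h' | h')
    · exact Set.disjoint_left.1 (hXdisj huj) hy h'
    · exact Set.disjoint_left.1 (hXdisj hui) hy h'
  have hle1 : ∀ u, u ≠ i → u ≠ j → ∀ y ∈ Xs u, h y ≤ 1 := by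
    intro u hui huj y hy
    rw [← hhit u hui huj y hy]
    exact prob_le_one
  have hfit : ∀ u, u ≠ i → u ≠ j →
      P u {ω | hitT j ω < hitT i ω} = ∑' n, gF p i j n u :=
    fun u hui huj => finite_hit p P hP i j u hij hui huj
  have hFle1 : ∀ u, u ≠ i → u ≠ j → ∑' n, gF p i j n u ≤ 1 := by
    intro u hui huj
    rw [← hfit u hui huj]
    exact prob_le_one
  have hstep := kernel_step Xs hXmeas hXdisj hXcover κ i j hij
  have hne : ∀ v, (Xs v).Nonempty := by
    intro v
    refine irr_closed hirr {v | (Xs v).Nonempty} k ⟨x, hx⟩ ?_ v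
    rintro u ⟨y, hy⟩ v hvu hpv
    by_contra hemp
    rw [Set.mem_ofPred_eq, Set.not_nonempty_iff_eq_empty] at hemp
    have h1 := (hcomp u v hvu y hy).1
    rw [hemp, measure_empty, nonpos_iff_eq_zero, mul_eq_zero] at h1
    rcases h1 with h1 | h1
    · exact haT (ENNReal.inv_eq_zero.1 h1)
    · exact hpv h1
  -- real quantities
  set r : ℝ := a.toReal with hr
  have hr1 : 1 ≤ r := by
    have := ENNReal.toReal_mono haT ha1
    simpa using this
  have hr0 : 0 < r := by linarith
  set pr : Fin l → Fin l → ℝ := fun u v => if v = u then 0 else (p u v).toReal with hpr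
  set K : X → Fin l → ℝ := fun y v => (κ y (Xs v)).toReal with hK
  have hK0 : ∀ y v, 0 ≤ K y v := fun y v => ENNReal.toReal_nonneg
  have hpr0 : ∀ u v, 0 ≤ pr u v := by
    intro u v
    simp only [hpr]
    split_ifs
    · rfl
    · exact ENNReal.toReal_nonneg
  have hKsum : ∀ y, ∑ v, K y v = 1 := by
    intro y
    rw [hK, ← ENNReal.toReal_sum (fun v _ => measure_ne_top _ _)]
    have : κ y (⋃ v, Xs v) = ∑ v, κ y (Xs v) := by
      rw [measure_iUnion hXdisj hXmeas, tsum_fintype]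
    rw [← this, hXcover, measure_univ, ENNReal.toReal_one]
  have hKc : ∀ u v, v ≠ u → ∀ y ∈ Xs u, r⁻¹ * pr u v ≤ K y v ∧ K y v ≤ r * pr u v := by
    intro u v hvu y hy
    obtain ⟨h1, h2⟩ := hcomp u v hvu y hy
    have e1 := ENNReal.toReal_mono (measure_ne_top _ _) h1
    have e2 := ENNReal.toReal_mono (ENNReal.mul_ne_top haT (hpfin u v)) h2
    rw [ENNReal.toReal_mul] at e1 e2
    rw [ENNReal.toReal_inv] at e1
    simp only [hpr, hvu, if_false]
    exact ⟨e1, e2⟩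
  set S : Finset (Fin l) := (Finset.univ.erase i).erase j with hS
  have hmemS : ∀ u, u ∈ S ↔ u ≠ j ∧ u ≠ i := by
    intro u
    simp [hS]
  have hcard : S.card = l - 2 := by
    rw [hS, Finset.card_erase_of_mem (by simp [hij.symm]), Finset.card_erase_of_mem (by simp)]
    simp
    omega
  have hkS : k ∈ S := (hmemS k).2 ⟨hjk.symm, hik.symm⟩
  obtain ⟨n, hn⟩ : ∃ n, S.card = n + 1 :=
    ⟨S.card - 1, by have := Finset.card_pos.2 ⟨k, hkS⟩; omega⟩
  have hnl : 4 ^ (n + 1) = N := by rw [hN, ← hcard, hn]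
  have hcut : ∀ q : Fin l → Fin l → ℝ, (∀ u v, 0 < pr u v → 0 < q u v) →
      ∀ T ⊆ S, T.Nonempty → ∃ u ∈ T, ∃ v, v ∉ T ∧ 0 < q u v := by
    intro q hq T hT ⟨t, ht⟩
    by_contra hcon
    push Not at hcon
    have hi : i ∈ (T : Set (Fin l)) := by
      refine irr_closed hirr (T : Set (Fin l)) t ht ?_ i
      intro u hu v hvu hpv
      by_contra hvT
      have h1 := hcon u hu v hvT
      have h2 : 0 < pr u v := by
        simp only [hpr, hvu, if_false]
        exact ENNReal.toReal_pos hpv (hpfin u v)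
      exact absurd (hq u v h2) (not_lt.2 h1)
    exact ((hmemS i).1 (hT hi)).2 rfl
  -- the finite chain
  set F : Fin l → ℝ := fun v => if v = j then 1 else if v = i then 0 else
    (∑' n, gF p i j n v).toReal with hF
  have hFj : F j = 1 := by simp [hF]
  have hFi : F i = 0 := by simp [hF, hij]
  have hF0 : ∀ v, 0 ≤ F v := by
    intro v
    simp only [hF]
    split_ifs
    · exact zero_le_one
    · rfl
    · exact ENNReal.toReal_nonneg
  have hFharm : ∀ u ∈ S, ∑ v, pr u v * (F v - F u) = 0 := by
    intro u hu
    obtain ⟨huj, hui⟩ := (hmemS u).1 hu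
    have e1 : F u = ∑ v, (p u v).toReal * F v := by
      have e := congrArg ENNReal.toReal (tsum_gF p i j u hij)
      rw [ENNReal.toReal_sum] at e
      · have e' : F u = (∑' n, gF p i j n u).toReal := by simp [hF, huj, hui]
        rw [e', e]
        refine Finset.sum_congr rfl fun v _ => ?_
        rw [ENNReal.toReal_mul]
        simp only [hF]
        split_ifs <;> simp
      · intro v _
        refine ENNReal.mul_ne_top (hpfin u v) ?_
        split_ifs with h1 h2
        · simp
        · simp
        · exact ne_top_of_le_ne_top ENNReal.one_ne_top (hFle1 v h2 h1)
    have e2 : ∑ v, (p u v).toReal = 1 := by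
      rw [← ENNReal.toReal_sum (fun v _ => hpfin u v), hrow u, ENNReal.toReal_one]
    have e3 : ∑ v, pr u v * (F v - F u) = ∑ v, (p u v).toReal * (F v - F u) := by
      refine Finset.sum_congr rfl fun v _ => ?_
      simp only [hpr]
      split_ifs with h1
      · subst h1; simp
      · rfl
    rw [e3]
    simp only [mul_sub, Finset.sum_sub_distrib, ← Finset.sum_mul]
    rw [← e1, e2]; ring
  have hfin : ∀ u, u ≠ i → u ≠ j → ∀ y ∈ Xs u, h y ≠ ⊤ := fun u h1 h2 y hy =>
    ne_top_of_le_ne_top ENNReal.one_ne_top (hle1 u h1 h2 y hy)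
  have hreal1 : ∀ u, u ≠ i → u ≠ j → ∀ y ∈ Xs u, (h y).toReal ≤ 1 := fun u h1 h2 y hy => by
    have := ENNReal.toReal_mono ENNReal.one_ne_top (hle1 u h1 h2 y hy)
    simpa using this
  -- upper function
  set M : Fin l → ℝ := fun v => if v = j then 1 else if v = i then 0 else
    sSup ((fun y => (h y).toReal) '' Xs v) with hM
  have hMle : ∀ v, v ≠ i → v ≠ j → ∀ y ∈ Xs v, (h y).toReal ≤ M v := by
    intro v hvi hvj y hy
    simp only [hM, hvi, hvj, if_false]
    refine le_csSup ⟨1, ?_⟩ ⟨y, hy, rfl⟩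
    rintro _ ⟨z, hz, rfl⟩
    exact hreal1 v hvi hvj z hz
  have hM0 : ∀ v, 0 ≤ M v := by
    intro v
    by_cases hvj : v = j
    · simp [hM, hvj]
    · by_cases hvi : v = i
      · simp [hM, hvi, hij]
      · obtain ⟨y, hy⟩ := hne v
        exact ENNReal.toReal_nonneg.trans (hMle v hvi hvj y hy)
  have hMstep : ∀ u, u ≠ i → u ≠ j → ∀ y ∈ Xs u, (h y).toReal ≤ ∑ v, K y v * M v := by
    intro u hui huj y hy
    have e : h y ≤ ∑ v, κ y (Xs v) * ENNReal.ofReal (M v) := by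
      simp only [hh]
      rw [hstep y]
      refine Finset.sum_le_sum fun v _ => ?_
      by_cases hvj : v = j
      · simp [hvj, hM]
      · by_cases hvi : v = i
        · simp [hvi, hij]
        · simp only [hvj, hvi, if_false]
          rw [mul_comm, ← setLIntegral_const]
          refine setLIntegral_mono' (hXmeas v) fun z hz => ?_
          exact (ENNReal.le_ofReal_iff_toReal_le (hfin v hvi hvj z hz) (hM0 v)).2
            (hMle v hvi hvj z hz)
    have hft : ∀ v ∈ Finset.univ, κ y (Xs v) * ENNReal.ofReal (M v) ≠ ⊤ := fun v _ =>
      ENNReal.mul_ne_top (measure_ne_top _ _) ENNReal.ofReal_ne_top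
    have e2 := ENNReal.toReal_mono (ENNReal.sum_ne_top.2 hft) e
    rw [ENNReal.toReal_sum hft] at e2
    simpa only [ENNReal.toReal_mul, ENNReal.toReal_ofReal (hM0 _)] using e2
  -- lower function
  set H : Fin l → ℝ := fun v => if v = j then 1 else if v = i then 0 else
    sInf ((fun y => (h y).toReal) '' Xs v) with hH
  have hHle : ∀ v, v ≠ i → v ≠ j → ∀ y ∈ Xs v, H v ≤ (h y).toReal := by
    intro v hvi hvj y hy
    simp only [hH, hvi, hvj, if_false]
    refine csInf_le ⟨0, ?_⟩ ⟨y, hy, rfl⟩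
    rintro _ ⟨z, hz, rfl⟩
    exact ENNReal.toReal_nonneg
  have hH0 : ∀ v, 0 ≤ H v := by
    intro v
    simp only [hH]
    split_ifs
    · exact zero_le_one
    · rfl
    · refine Real.sInf_nonneg ?_
      rintro _ ⟨z, hz, rfl⟩
      exact ENNReal.toReal_nonneg
  have hHstep : ∀ u, u ≠ i → u ≠ j → ∀ y ∈ Xs u, ∑ v, K y v * H v ≤ (h y).toReal := by
    intro u hui huj y hy
    have e : ∑ v, κ y (Xs v) * ENNReal.ofReal (H v) ≤ h y := by
      simp only [hh]
      rw [hstep y]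
      refine Finset.sum_le_sum fun v _ => ?_
      by_cases hvj : v = j
      · simp [hvj, hH]
      · by_cases hvi : v = i
        · simp [hvi, hij, hH]
        · simp only [hvj, hvi, if_false]
          rw [mul_comm, ← setLIntegral_const]
          refine setLIntegral_mono' (hXmeas v) fun z hz => ?_
          exact ENNReal.ofReal_le_of_le_toReal (hHle v hvi hvj z hz)
    have hft : ∀ v ∈ Finset.univ, κ y (Xs v) * ENNReal.ofReal (H v) ≠ ⊤ := fun v _ =>
      ENNReal.mul_ne_top (measure_ne_top _ _) ENNReal.ofReal_ne_top
    have e2 := ENNReal.toReal_mono (hfin u hui huj y hy) e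
    rw [ENNReal.toReal_sum hft] at e2
    simpa only [ENNReal.toReal_mul, ENNReal.toReal_ofReal (hH0 _)] using e2
  -- rates
  have hrinv : r⁻¹ ≤ 1 := inv_le_one_of_one_le₀ hr1
  have hrinv0 : 0 < r⁻¹ := inv_pos.2 hr0
  have hrate : ∀ b : Fin l → Fin l → Prop, ∀ c : Fin l → Fin l → ℝ,
      (∀ u v, c u v = if b u v then r * pr u v else r⁻¹ * pr u v) →
      (∀ u v, 0 ≤ c u v) ∧ (∀ u, c u u = 0) ∧ (∀ u v, c u v ≤ r * pr u v) ∧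
      (∀ u v, pr u v ≤ r * c u v) ∧ (∀ u v, 0 < pr u v → 0 < c u v) := by
    intro b c hc
    refine ⟨fun u v => ?_, fun u => ?_, fun u v => ?_, fun u v => ?_, fun u v hp => ?_⟩
    · rw [hc]; have := hpr0 u v; split_ifs <;> positivity
    · rw [hc]; simp [hpr]
    · rw [hc]
      split_ifs
      · rfl
      · exact mul_le_mul_of_nonneg_right (hrinv.trans hr1) (hpr0 u v)
    · rw [hc]
      have h0 := hpr0 u v
      split_ifs
      · nlinarith [mul_nonneg h0 hr0.le, mul_nonneg (mul_nonneg h0 hr0.le) (sub_nonneg.2 hr1),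
          mul_nonneg h0 (sub_nonneg.2 hr1)]
      · rw [← mul_assoc, mul_inv_cancel₀ hr0.ne', one_mul]
    · rw [hc]; split_ifs <;> positivity
  have hprd : ∀ u, pr u u = 0 := fun u => by simp [hpr]
  have hbdS : ∀ v, v ∉ S → v ≠ j → v = i := by
    intro v hv hvj
    by_contra hvi
    exact hv ((hmemS v).2 ⟨hvj, hvi⟩)
  have hjS : j ∉ S := fun hj => ((hmemS j).1 hj).1 rfl
  have upper : M k ≤ r ^ N * F k := by
    rw [← hnl]
    obtain ⟨c1, c2, c3, c4, c5⟩ := hrate (fun u v => M u ≤ M v)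
      (fun u v => if M u ≤ M v then r * pr u v else r⁻¹ * pr u v) (fun u v => rfl)
    refine finite_comparison j k M F (by simp [hM]) hFj hF0 n S _ pr r hn hkS hjS hr1
      (fun u _ v => c1 u v) (fun u _ v => hpr0 u v) (fun u _ => c2 u) (fun u _ => hprd u)
      (fun u _ v => c3 u v) (fun u _ v => c4 u v) ?_ (hcut pr fun u v h => h) ?_
      (fun u hu => (hFharm u hu).le)
    · intro u _ v hv hvj
      have : M v = 0 := by rw [hbdS v hv hvj]; simp [hM, hij]
      rw [this, mul_zero]
    · intro u hu
      obtain ⟨huj, hui⟩ := (hmemS u).1 hu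
      have key : ∀ y ∈ Xs u, (h y).toReal ≤ M u +
          ∑ v, (if M u ≤ M v then r * pr u v else r⁻¹ * pr u v) * (M v - M u) := by
        intro y hy
        have e1 := hMstep u hui huj y hy
        have e2 : ∑ v, K y v * M v = M u + ∑ v, K y v * (M v - M u) := by
          simp only [mul_sub, Finset.sum_sub_distrib, ← Finset.sum_mul, hKsum]; ring
        rw [e2] at e1
        refine e1.trans (add_le_add_right (Finset.sum_le_sum fun v _ => ?_) _)
        by_cases hvu : v = u
        · subst hvu; simp
        · obtain ⟨k1, k2⟩ := hKc u v hvu y hy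
          split_ifs with hc
          · exact mul_le_mul_of_nonneg_right k2 (sub_nonneg.2 hc)
          · exact mul_le_mul_of_nonpos_right k1 (by linarith [not_le.1 hc])
      have hsup : M u ≤ M u +
          ∑ v, (if M u ≤ M v then r * pr u v else r⁻¹ * pr u v) * (M v - M u) := by
        have e : M u = sSup ((fun y => (h y).toReal) '' Xs u) := by simp [hM, hui, huj]
        conv_lhs => rw [e]
        refine csSup_le ((hne u).image _) ?_
        rintro _ ⟨y, hy, rfl⟩
        exact key y hy
      linarith
  have lower : F k ≤ r ^ N * H k := by
    rw [← hnl]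
    obtain ⟨c1, c2, c3, c4, c5⟩ := hrate (fun u v => H v ≤ H u)
      (fun u v => if H v ≤ H u then r * pr u v else r⁻¹ * pr u v) (fun u v => rfl)
    refine finite_comparison j k F H hFj (by simp [hH]) hH0 n S pr _ r hn hkS hjS hr1
      (fun u _ v => hpr0 u v) (fun u _ v => c1 u v) (fun u _ => hprd u) (fun u _ => c2 u)
      (fun u _ v => c4 u v) (fun u _ v => c3 u v) ?_ (hcut _ c5)
      (fun u hu => (hFharm u hu).ge) ?_
    · intro u _ v hv hvj
      rw [hbdS v hv hvj, hFi, mul_zero]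
    · intro u hu
      obtain ⟨huj, hui⟩ := (hmemS u).1 hu
      have key : ∀ y ∈ Xs u, H u +
          ∑ v, (if H v ≤ H u then r * pr u v else r⁻¹ * pr u v) * (H v - H u) ≤
            (h y).toReal := by
        intro y hy
        have e1 := hHstep u hui huj y hy
        have e2 : ∑ v, K y v * H v = H u + ∑ v, K y v * (H v - H u) := by
          simp only [mul_sub, Finset.sum_sub_distrib, ← Finset.sum_mul, hKsum]; ring
        rw [e2] at e1
        refine le_trans (add_le_add_right (Finset.sum_le_sum fun v _ => ?_) _) e1
        by_cases hvu : v = u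
        · subst hvu; simp
        · obtain ⟨k1, k2⟩ := hKc u v hvu y hy
          split_ifs with hc
          · exact mul_le_mul_of_nonpos_right k2 (sub_nonpos.2 hc)
          · exact mul_le_mul_of_nonneg_right k1 (by linarith [not_le.1 hc])
      have hinf : H u +
          ∑ v, (if H v ≤ H u then r * pr u v else r⁻¹ * pr u v) * (H v - H u) ≤ H u := by
        have e : H u = sInf ((fun y => (h y).toReal) '' Xs u) := by simp [hH, hui, huj]
        conv_rhs => rw [e]
        refine le_csInf ((hne u).image _) ?_
        rintro _ ⟨y, hy, rfl⟩
        exact key y hy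
      linarith
  have hxM := hMle k hik.symm hjk.symm x hx
  have hxH := hHle k hik.symm hjk.symm x hx
  have hFk : F k = (∑' n, gF p i j n k).toReal := by simp [hF, hik.symm, hjk.symm]
  have haN : a ^ N ≠ ⊤ := ENNReal.pow_ne_top haT
  have haN0 : a ^ N ≠ 0 := pow_ne_zero _ (zero_lt_one.trans_le ha1).ne'
  have hFkfin : ∑' n, gF p i j n k ≠ ⊤ :=
    ne_top_of_le_ne_top ENNReal.one_ne_top (hFle1 k hik.symm hjk.symm)
  have hhx := hfin k hik.symm hjk.symm x hx
  rw [hhit k hik.symm hjk.symm x hx, hfit k hik.symm hjk.symm]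
  constructor
  · rw [ENNReal.inv_mul_le_iff haN0 haN,
      ← ENNReal.toReal_le_toReal hFkfin (ENNReal.mul_ne_top haN hhx), ENNReal.toReal_mul,
      ENNReal.toReal_pow, ← hFk]
    exact lower.trans (mul_le_mul_of_nonneg_left hxH (by positivity))
  · rw [← ENNReal.toReal_le_toReal hhx (ENNReal.mul_ne_top haN hFkfin), ENNReal.toReal_mul,
      ENNReal.toReal_pow, ← hFk]
    exact hxM.trans upper

end FW
end

section
/- For every i ∈ L, every j ∈ L∖{i}, and every x ∈ 𝒳_i: a^{−4^{l−2}−1} · P_i(T_j < T_i^+) ≤ P_x(T̃_j < T̃_i^+) ≤ a^{4^{l−2}+1} · P_i(T_j < T_i^+). -/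
open MeasureTheory ProbabilityTheory
open scoped ENNReal Classical

namespace FW

variable {X : Type} [MeasurableSpace X]

/-- First return time `T̃_B⁺ = inf {n ≥ 1 : ω n ∈ B}` for the chain on `X`. -/
noncomputable def hitSpos (B : Set X) (ω : ℕ → X) : ℝ≥0∞ :=
  ⨅ n ∈ {n : ℕ | 1 ≤ n ∧ ω n ∈ B}, (n : ℝ≥0∞)

theorem elim {ι : Type*} [DecidableEq ι] (B : Finset ι) (n : ℕ) : ∀ (S : Finset ι), S.card = n →
    Disjoint S B → ∀ (A : ℝ), 1 ≤ A → ∀ (w v : ι → ι → ℝ), (∀ x m, 0 ≤ w x m) →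
    (∀ x m, 0 ≤ v x m) → (∀ x m, w x m ≤ A * v x m) → (∀ x m, v x m ≤ A * w x m) →
    (∀ D ⊆ S, D.Nonempty → ∃ x ∈ D, ∃ m ∈ S ∪ B, m ∉ D ∧ 0 < w x m) →
    ∀ (U V : ι → ℝ), (∀ x, 0 ≤ V x) → (∀ b ∈ B, U b ≤ V b) →
    (∀ x ∈ S, 0 ≤ ∑ m ∈ S ∪ B, w x m * (U m - U x)) →
    (∀ x ∈ S, ∑ m ∈ S ∪ B, v x m * (V m - V x) ≤ 0) →
    ∀ x ∈ S, U x ≤ A ^ (3 ^ n - 1) * V x := by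
  induction n with
  | zero =>
    intro S hS _ A _ w v _ _ _ _ _ U V _ _ _ _ x hx
    rw [Finset.card_eq_zero] at hS
    simp [hS] at hx
  | succ n ih =>
    intro S hS hSB A hA w v hw hv hwv hvw hnd U V hV hB hU hVs
    obtain ⟨k, S', hk, rfl, hc⟩ := Finset.card_eq_succ.mp hS
    have hkB : k ∉ B := fun h => Finset.disjoint_left.mp hSB (Finset.mem_insert_self _ _) h
    have hSB' : Disjoint S' B := Finset.disjoint_of_subset_left (Finset.subset_insert _ _) hSB
    have hkR : k ∉ S' ∪ B := by simp [hk, hkB]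
    set R := S' ∪ B with hR
    have hins : insert k S' ∪ B = insert k R := by rw [hR, Finset.insert_union]
    rw [hins] at hnd hU hVs
    have A0 : 0 < A := by linarith
    -- total rates
    set W := ∑ m ∈ R, w k m with hWdef
    set W' := ∑ m ∈ R, v k m with hW'def
    have hWpos : 0 < W := by
      obtain ⟨x, hx, m, hm, hmD, hp⟩ := hnd {k} (by simp) (by simp)
      simp only [Finset.mem_singleton] at hx hmD
      subst hx
      rw [Finset.mem_insert] at hm
      exact Finset.sum_pos' (fun m _ => hw _ _) ⟨m, hm.resolve_left hmD, hp⟩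
    have hWW' : W ≤ A * W' := by
      rw [hWdef, hW'def, Finset.mul_sum]; exact Finset.sum_le_sum fun m _ => hwv k m
    have hW'W : W' ≤ A * W := by
      rw [hWdef, hW'def, Finset.mul_sum]; exact Finset.sum_le_sum fun m _ => hvw k m
    have hW'pos : 0 < W' := by
      by_contra h
      push Not at h
      nlinarith
    have hUk : W * U k ≤ ∑ m ∈ R, w k m * U m := by
      have := hU k (Finset.mem_insert_self _ _)
      rw [Finset.sum_insert hkR] at this
      simp only [sub_self, mul_zero, zero_add, mul_sub, Finset.sum_sub_distrib,
        ← Finset.sum_mul] at this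
      linarith
    have hVk : ∑ m ∈ R, v k m * V m ≤ W' * V k := by
      have := hVs k (Finset.mem_insert_self _ _)
      rw [Finset.sum_insert hkR] at this
      simp only [sub_self, mul_zero, zero_add, mul_sub, Finset.sum_sub_distrib,
        ← Finset.sum_mul] at this
      linarith
    have key : ∀ x ∈ S', U x ≤ (A ^ 3) ^ (3 ^ n - 1) * V x := by
      have comp : ∀ (w v : ι → ι → ℝ) (W W' : ℝ), 0 < W → 0 < W' → W' ≤ A * W →
          (∀ x m, 0 ≤ w x m) → (∀ x m, 0 ≤ v x m) → (∀ x m, w x m ≤ A * v x m) → ∀ x m,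
          w x m + w x k * w k m / W ≤ A ^ 3 * (v x m + v x k * v k m / W') := by
        intro w v W W' h1 h2 h3 hw hv hwv x m
        have e1 : w x m ≤ A ^ 3 * v x m := by
          refine (hwv x m).trans (mul_le_mul_of_nonneg_right ?_ (hv _ _))
          nlinarith [mul_self_nonneg (A-1), mul_pos A0 A0]
        have e2 : w x k * w k m / W ≤ A ^ 3 * (v x k * v k m / W') := by
          rw [← mul_div_assoc, div_le_div_iff₀ h1 h2]
          calc w x k * w k m * W' ≤ (A * v x k) * (A * v k m) * (A * W) := by
                gcongr
                · exact mul_nonneg (mul_nonneg A0.le (hv _ _)) (mul_nonneg A0.le (hv _ _))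
                · exact hw _ _
                · exact mul_nonneg A0.le (hv _ _)
                · exact hwv _ _
                · exact hwv _ _
            _ = _ := by ring
        linarith
      refine ih S' hc hSB' (A ^ 3) (one_le_pow₀ hA)
        (fun x m => w x m + w x k * w k m / W) (fun x m => v x m + v x k * v k m / W')
        ?_ ?_ ?_ ?_ ?_ U V hV hB ?_ ?_
      · intro x m
        have := hw x m; have := hw x k; have := hw k m
        positivity
      · intro x m
        have := hv x m; have := hv x k; have := hv k m
        positivity
      · exact comp w v W W' hWpos hW'pos hW'W hw hv hwv
      · exact comp v w W' W hW'pos hWpos hWW' hv hw hvw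
      · intro D hD hDn
        have hkD : k ∉ D := fun h => hk (hD h)
        have pos1 : ∀ x m, 0 < w x m → 0 < w x m + w x k * w k m / W := by
          intro x m h
          have := hw x k; have := hw k m
          positivity
        obtain ⟨x, hx, m, hm, hmD, hp⟩ := hnd D (hD.trans (Finset.subset_insert _ _)) hDn
        rw [Finset.mem_insert] at hm
        rcases hm with rfl | hm
        · obtain ⟨y, hy, z, hz, hzD, hq⟩ := hnd (insert m D) (Finset.insert_subset_insert _ hD)
            (Finset.insert_nonempty _ _)
          rw [Finset.mem_insert, not_or] at hzD
          have hzR := (Finset.mem_insert.mp hz).resolve_left hzD.1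
          rcases Finset.mem_insert.mp hy with rfl | hy
          · refine ⟨x, hx, z, hzR, hzD.2, ?_⟩
            have := hw x z
            positivity
          · exact ⟨y, hy, z, hzR, hzD.2, pos1 _ _ hq⟩
        · exact ⟨x, hx, m, hm, hmD, pos1 _ _ hp⟩
      · intro x hx
        have h := hU x (Finset.mem_insert_of_mem hx)
        rw [Finset.sum_insert hkR] at h
        have e : ∑ m ∈ R, (w x m + w x k * w k m / W) * (U m - U x)
            = ∑ m ∈ R, w x m * (U m - U x)
              + w x k / W * (∑ m ∈ R, w k m * U m - W * U x) := by
          rw [hWdef, Finset.sum_mul, ← Finset.sum_sub_distrib, Finset.mul_sum,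
            ← Finset.sum_add_distrib]
          exact Finset.sum_congr rfl fun m _ => by ring
        rw [e]
        have h2 : w x k / W * (W * U k - W * U x)
            ≤ w x k / W * (∑ m ∈ R, w k m * U m - W * U x) :=
          mul_le_mul_of_nonneg_left (by linarith) (div_nonneg (hw _ _) hWpos.le)
        have h3 : w x k / W * (W * U k - W * U x) = w x k * (U k - U x) := by
          field_simp
        linarith
      · intro x hx
        have h := hVs x (Finset.mem_insert_of_mem hx)
        rw [Finset.sum_insert hkR] at h
        have e : ∑ m ∈ R, (v x m + v x k * v k m / W') * (V m - V x)
            = ∑ m ∈ R, v x m * (V m - V x)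
              + v x k / W' * (∑ m ∈ R, v k m * V m - W' * V x) := by
          rw [hW'def, Finset.sum_mul, ← Finset.sum_sub_distrib, Finset.mul_sum,
            ← Finset.sum_add_distrib]
          exact Finset.sum_congr rfl fun m _ => by ring
        rw [e]
        have h2 : v x k / W' * (∑ m ∈ R, v k m * V m - W' * V x)
            ≤ v x k / W' * (W' * V k - W' * V x) :=
          mul_le_mul_of_nonneg_left (by linarith) (div_nonneg (hv _ _) hW'pos.le)
        have h3 : v x k / W' * (W' * V k - W' * V x) = v x k * (V k - V x) := by
          field_simp
        linarith
    set F := (A ^ 3) ^ (3 ^ n - 1) with hF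
    have hF1 : 1 ≤ F := one_le_pow₀ (one_le_pow₀ hA)
    have hFA : A ^ 2 * F = A ^ (3 ^ (n + 1) - 1) := by
      rw [hF, ← pow_mul, ← pow_add]
      congr 1
      have : 1 ≤ 3 ^ n := Nat.one_le_pow _ _ (by norm_num)
      rw [pow_succ]; omega
    have keyR : ∀ m ∈ R, U m ≤ F * V m := by
      intro m hm
      rcases Finset.mem_union.mp hm with h | h
      · exact key m h
      · nlinarith [hB m h, hV m]
    rw [← hFA]
    intro x hx
    rcases Finset.mem_insert.mp hx with rfl | hx
    · have h1 : ∑ m ∈ R, w x m * U m ≤ A * F * ∑ m ∈ R, v x m * V m := by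
        rw [Finset.mul_sum]
        refine Finset.sum_le_sum fun m hm => ?_
        calc w x m * U m ≤ w x m * (F * V m) := mul_le_mul_of_nonneg_left (keyR m hm) (hw _ _)
          _ ≤ (A * v x m) * (F * V m) :=
            mul_le_mul_of_nonneg_right (hwv _ _) (mul_nonneg (by linarith) (hV _))
          _ = _ := by ring
      have h2 : W * U x ≤ W * (A ^ 2 * F * V x) := by
        calc W * U x ≤ A * F * ∑ m ∈ R, v x m * V m := hUk.trans h1
          _ ≤ A * F * (W' * V x) := mul_le_mul_of_nonneg_left hVk (by positivity)
          _ ≤ A * F * (A * W * V x) := mul_le_mul_of_nonneg_left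
              (mul_le_mul_of_nonneg_right hW'W (hV _)) (by positivity)
          _ = _ := by ring
      exact le_of_mul_le_mul_left h2 hWpos
    · refine (key x hx).trans (mul_le_mul_of_nonneg_right ?_ (hV x))
      nlinarith [one_le_pow₀ hA (n := 2)]

theorem measurable_cylProb (κ : Kernel X X) [IsMarkovKernel κ] (As : List (Set X))
    (h : ∀ A ∈ As, MeasurableSet A) : Measurable fun y => cylProb κ y As := by
  induction As with
  | nil => simp only [cylProb]; exact measurable_const
  | cons A As ih =>
    simp only [cylProb]
    exact (ih fun B hB => h B (List.mem_cons_of_mem _ hB)).setLIntegral_kernel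
      (h A List.mem_cons_self)

/-- probability of hitting `J` at time `n+1`, staying in `C` before. -/
noncomputable def vv (κ : Kernel X X) (C J : Set X) (n : ℕ) (y : X) : ℝ≥0∞ :=
  cylProb κ y (List.replicate n C ++ [J])

/-- probability of eventually hitting `J` at a positive time, staying in `C` before. -/
noncomputable def GG (κ : Kernel X X) (C J : Set X) (y : X) : ℝ≥0∞ := ∑' n, vv κ C J n y

theorem vv_zero (κ : Kernel X X) (C J : Set X) (y : X) : vv κ C J 0 y = κ y J := by
  simp [vv, cylProb]

theorem vv_succ (κ : Kernel X X) (C J : Set X) (n : ℕ) (y : X) :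
    vv κ C J (n + 1) y = ∫⁻ z in C, vv κ C J n z ∂κ y := by
  simp [vv, cylProb, List.replicate_succ]

theorem measurable_vv (κ : Kernel X X) [IsMarkovKernel κ] {C J : Set X} (hC : MeasurableSet C)
    (hJ : MeasurableSet J) (n : ℕ) : Measurable (vv κ C J n) := by
  refine measurable_cylProb κ _ fun A hA => ?_
  rcases List.mem_append.mp hA with h | h
  · rw [List.eq_of_mem_replicate h]; exact hC
  · rw [List.mem_singleton.mp h]; exact hJ

theorem GG_eq (κ : Kernel X X) [IsMarkovKernel κ] {C J : Set X} (hC : MeasurableSet C)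
    (hJ : MeasurableSet J) (y : X) :
    GG κ C J y = κ y J + ∫⁻ z in C, GG κ C J z ∂κ y := by
  unfold GG
  rw [lintegral_tsum fun n => (measurable_vv κ hC hJ n).aemeasurable,
    tsum_eq_zero_add' ENNReal.summable, vv_zero]
  simp only [vv_succ]

theorem GG_le_one (κ : Kernel X X) [IsMarkovKernel κ] {C J : Set X} (hC : MeasurableSet C)
    (hJ : MeasurableSet J) (hd : Disjoint J C) (y : X) : GG κ C J y ≤ 1 := by
  unfold GG
  rw [ENNReal.tsum_eq_iSup_nat]
  refine iSup_le fun n => ?_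
  induction n generalizing y with
  | zero => simp
  | succ n ih =>
    rw [Finset.sum_range_succ', vv_zero]
    simp only [vv_succ]
    rw [← lintegral_finsetSum _ fun n _ => measurable_vv κ hC hJ n]
    calc (∫⁻ z in C, ∑ k ∈ Finset.range n, vv κ C J k z ∂κ y) + κ y J
        ≤ (∫⁻ z in C, 1 ∂κ y) + κ y J := by gcongr with z; exact ih z
      _ = κ y (J ∪ C) := by rw [setLIntegral_one, measure_union hd hC, add_comm]
      _ ≤ 1 := prob_le_one

theorem GG_sum {l : ℕ} (κ : Kernel X X) [IsMarkovKernel κ] (Xs : Fin l → Set X)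
    (hXmeas : ∀ i, MeasurableSet (Xs i))
    (hXdisj : Pairwise fun i j => Disjoint (Xs i) (Xs j))
    (hXcover : (⋃ i, Xs i) = Set.univ) (i j : Fin l) (y : X) :
    GG κ (Xs i ∪ Xs j)ᶜ (Xs j) y = κ y (Xs j) +
      ∑ m ∈ Finset.univ \ {i, j}, ∫⁻ z in Xs m, GG κ (Xs i ∪ Xs j)ᶜ (Xs j) z ∂κ y := by
  rw [GG_eq κ ((hXmeas i).union (hXmeas j)).compl (hXmeas j)]
  congr 1
  rw [← lintegral_biUnion_finset (fun a _ b _ hab => hXdisj hab) (fun b _ => hXmeas b)]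
  congr 2
  ext z
  simp only [Set.mem_compl_iff, Set.mem_union, Finset.mem_sdiff, Finset.mem_univ, true_and,
    Finset.mem_insert, Finset.mem_singleton, Set.mem_iUnion, exists_prop]
  constructor
  · intro h
    have hz : z ∈ ⋃ i, Xs i := hXcover ▸ Set.mem_univ z
    obtain ⟨m, hm⟩ := Set.mem_iUnion.mp hz
    refine ⟨m, ?_, hm⟩
    rintro (rfl | rfl)
    · exact h (Or.inl hm)
    · exact h (Or.inr hm)
  · rintro ⟨m, hm, hzm⟩ (h | h)
    · exact Set.disjoint_left.mp (hXdisj (fun e => hm (Or.inl e))) hzm h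
    · exact Set.disjoint_left.mp (hXdisj (fun e => hm (Or.inr e))) hzm h

theorem sum_split {l : ℕ} (i j : Fin l) (hij : j ≠ i) (f : Fin l → ℝ≥0∞) (hi : f i = 0) :
    ∑ m, f m = f j + ∑ m ∈ Finset.univ \ {i, j}, f m := by
  rw [← Finset.sum_sdiff (Finset.subset_univ ({i, j} : Finset (Fin l))), add_comm,
    Finset.sum_pair hij.symm, hi, zero_add]

theorem GG_le {l : ℕ} (κ : Kernel X X) [IsMarkovKernel κ] (Xs : Fin l → Set X)
    (hXmeas : ∀ i, MeasurableSet (Xs i))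
    (hXdisj : Pairwise fun i j => Disjoint (Xs i) (Xs j))
    (hXcover : (⋃ i, Xs i) = Set.univ) (i j : Fin l) (hij : j ≠ i) (U : Fin l → ℝ≥0∞)
    (hi : U i = 0) (hj : U j = 1) (hU : ∀ m, m ≠ i → m ≠ j → ∀ z ∈ Xs m,
      GG κ (Xs i ∪ Xs j)ᶜ (Xs j) z ≤ U m) (y : X) :
    GG κ (Xs i ∪ Xs j)ᶜ (Xs j) y ≤ ∑ m, κ y (Xs m) * U m := by
  rw [GG_sum κ Xs hXmeas hXdisj hXcover, sum_split i j hij _ (by simp [hi]), hj, mul_one]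
  gcongr with m hm
  simp only [Finset.mem_sdiff, Finset.mem_univ, true_and, Finset.mem_insert,
    Finset.mem_singleton, not_or] at hm
  rw [mul_comm, ← setLIntegral_const]
  exact setLIntegral_mono' (hXmeas m) (hU m hm.1 hm.2)

theorem le_GG {l : ℕ} (κ : Kernel X X) [IsMarkovKernel κ] (Xs : Fin l → Set X)
    (hXmeas : ∀ i, MeasurableSet (Xs i))
    (hXdisj : Pairwise fun i j => Disjoint (Xs i) (Xs j))
    (hXcover : (⋃ i, Xs i) = Set.univ) (i j : Fin l) (hij : j ≠ i) (U : Fin l → ℝ≥0∞)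
    (hi : U i = 0) (hj : U j = 1) (hU : ∀ m, m ≠ i → m ≠ j → ∀ z ∈ Xs m,
      U m ≤ GG κ (Xs i ∪ Xs j)ᶜ (Xs j) z) (y : X) :
    ∑ m, κ y (Xs m) * U m ≤ GG κ (Xs i ∪ Xs j)ᶜ (Xs j) y := by
  rw [GG_sum κ Xs hXmeas hXdisj hXcover, sum_split i j hij _ (by simp [hi]), hj, mul_one]
  gcongr with m hm
  simp only [Finset.mem_sdiff, Finset.mem_univ, true_and, Finset.mem_insert,
    Finset.mem_singleton, not_or] at hm
  rw [mul_comm, ← setLIntegral_const]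
  exact setLIntegral_mono' (hXmeas m) (hU m hm.1 hm.2)

theorem hit_lt_iff_s8 (I J : Set X) (ω : ℕ → X) :
    hitS J ω < hitSpos I ω ↔ ∃ n, ω n ∈ J ∧ ∀ m, 1 ≤ m → ω m ∈ I → n < m := by
  unfold hitS hitSpos
  simp only [iInf_lt_iff, Set.mem_ofPred_eq, exists_prop]
  refine exists_congr fun n => and_congr_right fun _ => ?_
  constructor
  · intro h m hm hmI
    have := h.trans_le (iInf₂_le m ⟨hm, hmI⟩)
    exact_mod_cast this
  · intro h
    refine lt_of_lt_of_le (b := ((n + 1 : ℕ) : ℝ≥0∞)) (by exact_mod_cast Nat.lt_succ_self n) ?_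
    refine le_iInf₂ fun m hm => ?_
    exact_mod_cast h m hm.1 hm.2

theorem event_eq (κ : Kernel X X) (Q : X → Measure (ℕ → X))
    (hQ : IsMarkovChainLawKernel κ Q) {I J : Set X} (hI : MeasurableSet I) (hJ : MeasurableSet J)
    (hd : Disjoint I J) (x : X) (hx : x ∈ I) :
    Q x {ω | hitS J ω < hitSpos I ω} = GG κ (I ∪ J)ᶜ J x := by
  have := hQ.1 x
  set A : ℕ → ℕ → Set X := fun n k => if k = 0 then I else if k ≤ n then (I ∪ J)ᶜ else J with hA
  have hAm : ∀ n k, MeasurableSet (A n k) := by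
    intro n k
    simp only [hA]
    split_ifs
    · exact hI
    · exact (hI.union hJ).compl
    · exact hJ
  have h0 : ∀ᵐ ω ∂Q x, ω 0 ∈ I := by
    have := hQ.2 x 0 (fun _ => I) (fun _ => hI)
    simp [cylProb, hx] at this
    have hm : MeasurableSet {ω : ℕ → X | ω 0 ∈ I} := measurable_pi_apply 0 hI
    exact (prob_compl_eq_zero_iff hm).mpr this
  have hE : ∀ n, Q x {ω | ∀ k ≤ n + 1, ω k ∈ A n k} = vv κ (I ∪ J)ᶜ J n x := by
    intro n
    rw [hQ.2 x (n + 1) (A n) (hAm n)]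
    have : (List.range (n + 1)).map (fun k => A n (k + 1))
        = List.replicate n (I ∪ J)ᶜ ++ [J] := by
      rw [List.range_succ, List.map_append]
      congr 1
      · rw [List.eq_replicate_iff]
        simp only [List.length_map, List.length_range, List.mem_map, List.mem_range, true_and]
        rintro b ⟨k, hk, rfl⟩
        simp only [hA, Nat.add_eq_zero_iff, one_ne_zero, and_false, if_false]
        rw [if_pos (by omega)]
      · simp [hA]
    rw [this]
    simp [hA, hx, vv]
  have hU : Q x {ω | hitS J ω < hitSpos I ω} = Q x (⋃ n, {ω | ∀ k ≤ n + 1, ω k ∈ A n k}) := by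
    refine measure_congr ?_
    filter_upwards [h0] with ω hω
    refine propext ?_
    change hitS J ω < hitSpos I ω ↔ ω ∈ ⋃ n, {ω | ∀ k ≤ n + 1, ω k ∈ A n k}
    rw [hit_lt_iff_s8]
    simp only [Set.mem_iUnion, Set.mem_ofPred_eq]
    constructor
    · intro h
      have hn := Nat.find_spec h
      have hmin := fun m hm => Nat.find_min h (m := m) hm
      set n := Nat.find h
      have hn0 : n ≠ 0 := fun e => Set.disjoint_left.mp hd hω (e ▸ hn.1)
      refine ⟨n - 1, fun k hk => ?_⟩
      simp only [hA]
      split_ifs with h1 h2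
      · rw [h1]; exact hω
      · rintro (h3 | h3)
        · have := hn.2 k (by omega) h3; omega
        · exact hmin k (by omega) ⟨h3, fun m hm hmI => by have := hn.2 m hm hmI; omega⟩
      · have : k = n := by omega
        rw [this]; exact hn.1
    · rintro ⟨n, hn⟩
      refine ⟨n + 1, by simpa [hA] using hn (n + 1) le_rfl, fun m hm hmI => ?_⟩
      by_contra hlt
      have h1 := hn m (by omega)
      simp only [hA] at h1
      rw [if_neg (by omega)] at h1
      split_ifs at h1 with h2
      · exact h1 (Or.inl hmI)
      · exact Set.disjoint_left.mp hd hmI h1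
  rw [hU, measure_iUnion]
  · simp only [hE, GG]
  · have key : ∀ n m, n < m → Disjoint {ω : ℕ → X | ∀ k ≤ n + 1, ω k ∈ A n k}
        {ω : ℕ → X | ∀ k ≤ m + 1, ω k ∈ A m k} := by
      intro n m hnm
      rw [Set.disjoint_left]
      intro ω h1 h2
      have h1 := h1 (n + 1) le_rfl
      have h2 := h2 (n + 1) (by omega)
      simp only [hA, Nat.add_eq_zero_iff, one_ne_zero, and_false, if_false] at h1 h2
      rw [if_neg (by omega)] at h1
      rw [if_pos (by omega)] at h2
      exact h2 (Or.inr h1)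
    intro n m hnm
    rcases lt_or_gt_of_ne hnm with h | h
    · exact key n m h
    · exact (key m n h).symm
  · intro n
    have : {ω : ℕ → X | ∀ k ≤ n + 1, ω k ∈ A n k}
        = ⋂ k, ⋂ (_ : k ≤ n + 1), (fun ω : ℕ → X => ω k) ⁻¹' A n k := by
      ext; simp
    rw [this]
    exact MeasurableSet.iInter fun k => MeasurableSet.iInter fun _ =>
      measurable_pi_apply k (hAm n k)

/-- The kernel of a transition matrix. -/
noncomputable def kp {l : ℕ} (p : Fin l → Fin l → ℝ≥0∞) : Kernel (Fin l) (Fin l) :=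
  Kernel.ofFunOfCountable fun x => ∑ y, p x y • Measure.dirac y

theorem kp_apply {l : ℕ} (p : Fin l → Fin l → ℝ≥0∞) (x : Fin l) :
    kp p x = ∑ y, p x y • Measure.dirac y := rfl

theorem kp_singleton {l : ℕ} (p : Fin l → Fin l → ℝ≥0∞) (x y : Fin l) :
    kp p x {y} = p x y := by
  rw [kp_apply]
  simp [Measure.finsetSum_apply, Set.indicator_apply]

theorem kp_lintegral {l : ℕ} (p : Fin l → Fin l → ℝ≥0∞) (x : Fin l) (A : Set (Fin l))
    (f : Fin l → ℝ≥0∞) :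
    ∫⁻ z in A, f z ∂kp p x = ∑ z with z ∈ A, p x z * f z := by
  rw [← lintegral_indicator (MeasurableSet.of_discrete), lintegral_fintype]
  simp only [kp_singleton, Finset.sum_filter, Set.indicator_apply]
  exact Finset.sum_congr rfl fun z _ => by split_ifs <;> simp [mul_comm]

theorem kp_markov {l : ℕ} (p : Fin l → Fin l → ℝ≥0∞) (hrow : ∀ i, ∑ j, p i j = 1) :
    IsMarkovKernel (kp p) := by
  refine ⟨fun x => ⟨?_⟩⟩
  rw [kp_apply]
  simp [Measure.finsetSum_apply, hrow]

theorem path_law {l : ℕ} (p : Fin l → Fin l → ℝ≥0∞)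
    (P : Fin l → Measure (ℕ → Fin l)) (hP : IsMarkovChainLaw p P) (i : Fin l) (n : ℕ) :
    ∀ (A : ℕ → Set (Fin l)) (m : ℕ) (s : ℕ → Fin l),
      P i {ω | (∀ k ≤ m, ω k = s k) ∧ ∀ k < n, ω (m + 1 + k) ∈ A k} =
        P i {ω | ∀ k ≤ m, ω k = s k} * cylProb (kp p) (s m) ((List.range n).map A) := by
  induction n with
  | zero => intro A m s; simp [cylProb]
  | succ n ih =>
    intro A m s
    rw [List.range_succ_eq_map, List.map_cons, List.map_map, cylProb, kp_lintegral, Finset.mul_sum]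
    have hset : {ω : ℕ → Fin l | (∀ k ≤ m, ω k = s k) ∧ ∀ k < n + 1, ω (m + 1 + k) ∈ A k}
        = ⋃ y ∈ (Finset.univ.filter fun z => z ∈ A 0),
          {ω : ℕ → Fin l | (∀ k ≤ m + 1, ω k = Function.update s (m + 1) y k) ∧
            ∀ k < n, ω (m + 1 + 1 + k) ∈ A (k + 1)} := by
      ext ω
      simp only [Set.mem_ofPred_eq, Finset.mem_filter, Finset.mem_univ, true_and, Set.mem_iUnion,
        exists_prop]
      constructor
      · rintro ⟨h1, h2⟩
        refine ⟨ω (m + 1), h2 0 (by omega), fun k hk => ?_, fun k hk => ?_⟩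
        · by_cases h : k = m + 1
          · subst h; simp
          · rw [Function.update_of_ne h]; exact h1 k (by omega)
        · have := h2 (k + 1) (by omega)
          rwa [show m + 1 + 1 + k = m + 1 + (k + 1) by omega]
      · rintro ⟨y, hy, h1, h2⟩
        refine ⟨fun k hk => ?_, fun k hk => ?_⟩
        · have := h1 k (by omega)
          rwa [Function.update_of_ne (by omega)] at this
        · rcases k with _ | k
          · have := h1 (m + 1) le_rfl
            rw [Function.update_self] at this
            rw [add_zero, this]; exact hy
          · have := h2 k (by omega)
            rwa [show m + 1 + 1 + k = m + 1 + (k + 1) by omega] at this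
    rw [hset, measure_biUnion_finset]
    · refine Finset.sum_congr rfl fun y _ => ?_
      rw [ih (fun k => A (k + 1)) (m + 1), hP.2, hP.2, Function.update_self,
        Finset.prod_range_succ, Function.update_self, Function.update_of_ne (by omega),
        Function.update_of_ne (by omega)]
      have : ∏ k ∈ Finset.range m, p (Function.update s (m + 1) y k)
          (Function.update s (m + 1) y (k + 1)) = ∏ k ∈ Finset.range m, p (s k) (s (k + 1)) := by
        refine Finset.prod_congr rfl fun k hk => ?_
        have := Finset.mem_range.mp hk
        rw [Function.update_of_ne (by omega), Function.update_of_ne (by omega)]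
      rw [this]
      simp only [mul_assoc]
      rfl
    · intro y _ z _ hyz
      refine Set.disjoint_left.mpr fun ω h1 h2 => hyz ?_
      have e1 := h1.1 (m + 1) le_rfl
      have e2 := h2.1 (m + 1) le_rfl
      rw [Function.update_self] at e1 e2
      rw [← e1, ← e2]
    · intro y _
      measurability

theorem kp_law {l : ℕ} (p : Fin l → Fin l → ℝ≥0∞)
    (P : Fin l → Measure (ℕ → Fin l)) (hP : IsMarkovChainLaw p P) :
    IsMarkovChainLawKernel (kp p) P := by
  refine ⟨hP.1, fun i n A _ => ?_⟩
  have := hP.1 i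
  have h1 : P i {ω | ∀ k ≤ 0, ω k = i} = 1 := by
    rw [hP.2 i 0 (fun _ => i)]; simp
  have h0 : ∀ᵐ ω ∂P i, ω 0 = i := by
    have h2 := h1
    simp only [Nat.le_zero, forall_eq] at h2
    have hm : MeasurableSet {ω : ℕ → Fin l | ω 0 = i} :=
      measurableSet_eq_fun (measurable_pi_apply 0) measurable_const
    exact (prob_compl_eq_zero_iff hm).mpr h2
  by_cases hi : i ∈ A 0
  · have h3 := path_law p P hP i n (fun k => A (k + 1)) 0 (fun _ => i)
    rw [h1, one_mul] at h3
    rw [Set.indicator_of_mem hi, one_mul, ← h3]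
    refine measure_congr ?_
    filter_upwards [h0] with ω hω
    refine propext ?_
    change (∀ k ≤ n, ω k ∈ A k) ↔ (∀ k ≤ 0, ω k = i) ∧ ∀ k < n, ω (0 + 1 + k) ∈ A (k + 1)
    constructor
    · intro h
      refine ⟨fun k hk => by rw [Nat.le_zero.mp hk]; exact hω, fun k hk => ?_⟩
      rw [show 0 + 1 + k = k + 1 by omega]; exact h _ (by omega)
    · rintro ⟨_, h⟩ k hk
      rcases k with _ | k
      · rw [hω]; exact hi
      · have := h k (by omega)
        rwa [show 0 + 1 + k = k + 1 by omega] at this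
  · rw [Set.indicator_of_notMem hi, zero_mul]
    refine measure_mono_null (t := {ω | ¬ ω 0 = i}) ?_ h0
    intro ω h e
    exact hi (e ▸ h 0 (Nat.zero_le _))

theorem irr_exit {l : ℕ} (p : Fin l → Fin l → ℝ≥0∞) (hirr : Irreducible p)
    (D : Set (Fin l)) {x y : Fin l} (hx : x ∈ D) (hy : y ∉ D) :
    ∃ x ∈ D, ∃ m, m ∉ D ∧ 0 < p x m := by
  by_contra hcon
  push Not at hcon
  have : ∀ n, ∀ y, y ∉ D → matPow p n x y = 0 := by
    intro n
    induction n with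
    | zero =>
      intro y hy
      simp only [matPow]
      rw [if_neg]
      rintro rfl
      exact hy hx
    | succ n ih =>
      intro y hy
      simp only [matPow]
      refine Finset.sum_eq_zero fun k _ => ?_
      by_cases hk : k ∈ D
      · rw [le_zero_iff.mp (hcon k hk y hy), mul_zero]
      · rw [ih k hk, zero_mul]
  obtain ⟨n, hn⟩ := hirr x y
  exact hn.ne' (this n y hy)

/-- extremal rates for the function `f`. -/
noncomputable def bang {l : ℕ} (A : ℝ) (q : Fin l → Fin l → ℝ) (f : Fin l → ℝ)
    (k m : Fin l) : ℝ :=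
  if m = k then q k m else if f k ≤ f m then A * q k m else A⁻¹ * q k m

theorem bang_nonneg {l : ℕ} {A : ℝ} (hA : 1 ≤ A) {q : Fin l → Fin l → ℝ} (hq : ∀ k m, 0 ≤ q k m)
    (f : Fin l → ℝ) (k m : Fin l) : 0 ≤ bang A q f k m := by
  have := hq k m
  unfold bang
  split_ifs <;> positivity

theorem bang_le {l : ℕ} {A : ℝ} (hA : 1 ≤ A) {q : Fin l → Fin l → ℝ} (hq : ∀ k m, 0 ≤ q k m)
    (f : Fin l → ℝ) (k m : Fin l) : bang A q f k m ≤ A * q k m := by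
  have h := hq k m
  have h1 : A⁻¹ ≤ 1 := inv_le_one_of_one_le₀ hA
  unfold bang
  split_ifs
  · nlinarith
  · exact le_rfl
  · nlinarith

theorem le_bang {l : ℕ} {A : ℝ} (hA : 1 ≤ A) {q : Fin l → Fin l → ℝ} (hq : ∀ k m, 0 ≤ q k m)
    (f : Fin l → ℝ) (k m : Fin l) : q k m ≤ A * bang A q f k m := by
  have h := hq k m
  unfold bang
  split_ifs
  · nlinarith
  · have : 1 ≤ A * A := by nlinarith
    nlinarith
  · rw [← mul_assoc, mul_inv_cancel₀ (by positivity), one_mul]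

theorem bang_max {l : ℕ} {A : ℝ} {q : Fin l → Fin l → ℝ}
    (f : Fin l → ℝ) (k : Fin l) (v : Fin l → ℝ) (h1 : ∀ m, m ≠ k → v m ≤ A * q k m)
    (h2 : ∀ m, m ≠ k → A⁻¹ * q k m ≤ v m) :
    ∑ m, v m * (f m - f k) ≤ ∑ m, bang A q f k m * (f m - f k) := by
  refine Finset.sum_le_sum fun m _ => ?_
  unfold bang
  split_ifs with h3 h4
  · rw [h3]; simp
  · exact mul_le_mul_of_nonneg_right (h1 m h3) (by linarith)
  · exact mul_le_mul_of_nonpos_right (h2 m h3) (by linarith)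

theorem main_comparison {l : ℕ} (hl : 2 ≤ l)
    (p : Fin l → Fin l → ℝ≥0∞) (hrow : ∀ i, ∑ j, p i j = 1)
    (hirr : Irreducible p)
    (Xs : Fin l → Set X) (hXmeas : ∀ i, MeasurableSet (Xs i))
    (hXdisj : Pairwise fun i j => Disjoint (Xs i) (Xs j))
    (hXcover : (⋃ i, Xs i) = Set.univ)
    (κ : Kernel X X) (hκ : IsMarkovKernel κ)
    (a : ℝ≥0∞) (ha1 : 1 ≤ a) (haT : a ≠ ⊤)
    (hcomp : ∀ (i j : Fin l), j ≠ i → ∀ x ∈ Xs i,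
      a⁻¹ * p i j ≤ κ x (Xs j) ∧ κ x (Xs j) ≤ a * p i j)
    (i : Fin l) (j : Fin l) (hij : j ≠ i)
    (x : X) (hx : x ∈ Xs i) :
    GG (kp p) ({i} ∪ {j})ᶜ {j} i ≤ a ^ (4 ^ (l - 2) + 1) * GG κ (Xs i ∪ Xs j)ᶜ (Xs j) x ∧
    GG κ (Xs i ∪ Xs j)ᶜ (Xs j) x ≤ a ^ (4 ^ (l - 2) + 1) * GG (kp p) ({i} ∪ {j})ᶜ {j} i := by
  have hkp := kp_markov p hrow
  have ha0 : a ≠ 0 := (zero_lt_one.trans_le ha1).ne'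
  have hne : ∀ k, (Xs k).Nonempty := by
    by_contra hcon
    push Not at hcon
    obtain ⟨k, hk⟩ := hcon
    obtain ⟨y, hy, m, hm, hp⟩ := irr_exit p hirr {k | (Xs k).Nonempty} (x := i) (y := k) ⟨x, hx⟩
      (by simp [hk])
    obtain ⟨z, hz⟩ := hy
    have hm : Xs m = ∅ := Set.not_nonempty_iff_eq_empty.mp hm
    have hmy : m ≠ y := by
      rintro rfl
      rw [hm] at hz
      exact hz
    have h := (hcomp y m hmy z hz).1
    rw [hm, measure_empty, nonpos_iff_eq_zero, mul_eq_zero, ENNReal.inv_eq_zero] at h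
    exact h.elim haT hp.ne'
  have hpT : ∀ k m, p k m ≠ ⊤ := fun k m => by
    have : p k m ≤ 1 := (hrow k) ▸ Finset.single_le_sum (fun _ _ => zero_le) (Finset.mem_univ m)
    exact (this.trans_lt ENNReal.one_lt_top).ne
  set g := GG (kp p) ({i} ∪ {j})ᶜ {j} with hg
  set G := GG κ (Xs i ∪ Xs j)ᶜ (Xs j) with hG
  have hG1 : ∀ y, G y ≤ 1 := GG_le_one κ ((hXmeas i).union (hXmeas j)).compl (hXmeas j)
    (Set.disjoint_left.mpr fun z hz hz' => hz' (Or.inr hz))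
  have hg1 : ∀ y, g y ≤ 1 := GG_le_one (kp p) MeasurableSet.of_discrete MeasurableSet.of_discrete
    (Set.disjoint_left.mpr fun z hz hz' => hz' (Or.inr hz))
  have bd : ∀ f : Fin l → ℝ≥0∞, ∀ m, f m ≤ 1 →
      (if m = j then 1 else if m = i then 0 else f m) ≤ 1 := by
    intro f m h
    split_ifs
    · exact le_rfl
    · exact zero_le_one
    · exact h
  obtain ⟨h, hh⟩ : ∃ h : Fin l → ℝ≥0∞, h = fun m => if m = j then 1 else if m = i then 0 else g m :=
    ⟨_, rfl⟩
  obtain ⟨U, hU⟩ : ∃ U : Fin l → ℝ≥0∞,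
      U = fun m => if m = j then 1 else if m = i then 0 else ⨆ z ∈ Xs m, G z := ⟨_, rfl⟩
  obtain ⟨L, hL⟩ : ∃ L : Fin l → ℝ≥0∞,
      L = fun m => if m = j then 1 else if m = i then 0 else ⨅ z ∈ Xs m, G z := ⟨_, rfl⟩
  have hh1 : ∀ m, h m ≤ 1 := fun m => by rw [hh]; exact bd _ _ (hg1 m)
  have hU1 : ∀ m, U m ≤ 1 := fun m => by
    rw [hU]; exact bd (fun m => ⨆ z ∈ Xs m, G z) m (iSup₂_le fun z _ => hG1 z)
  have hL1 : ∀ m, L m ≤ 1 := fun m => by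
    rw [hL]
    obtain ⟨z, hz⟩ := hne m
    exact bd (fun m => ⨅ z ∈ Xs m, G z) m ((iInf₂_le z hz).trans (hG1 z))
  have fin : ∀ {t : ℝ≥0∞}, t ≤ 1 → t ≠ ⊤ := fun ht => (ht.trans_lt ENNReal.one_lt_top).ne
  have hhj : h j = 1 := by simp [hh]
  have hUj : U j = 1 := by simp [hU]
  have hLj : L j = 1 := by simp [hL]
  have hhi : h i = 0 := by simp [hh, hij.symm]
  have hUi : U i = 0 := by simp [hU, hij.symm]
  have hLi : L i = 0 := by simp [hL, hij.symm]
  -- harmonicity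
  have hgeq : ∀ y, g y = ∑ m, p y m * h m := by
    intro y
    have hm : ∀ m : Fin l, MeasurableSet ({m} : Set (Fin l)) := fun m => MeasurableSet.of_discrete
    have hd : Pairwise fun i j : Fin l => Disjoint ({i} : Set (Fin l)) {j} := fun a b hab => by
      simpa using hab
    have hc : (⋃ i : Fin l, ({i} : Set (Fin l))) = Set.univ := 
      Set.eq_univ_of_forall fun z => Set.mem_iUnion.mpr ⟨z, rfl⟩
    have e : ∑ m, p y m * h m = ∑ m, kp p y {m} * h m := 
      Finset.sum_congr rfl fun m _ => by rw [kp_singleton]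
    rw [e]
    refine le_antisymm
      (GG_le (kp p) (fun m => {m}) hm hd hc i j hij h hhi hhj ?_ y)
      (le_GG (kp p) (fun m => {m}) hm hd hc i j hij h hhi hhj ?_ y)
    · intro m hmi hmj z hz
      rw [Set.mem_singleton_iff.mp hz, hh]
      simp [hmi, hmj, hg]
    · intro m hmi hmj z hz
      rw [Set.mem_singleton_iff.mp hz, hh]
      simp [hmi, hmj, hg]
  have hGU : ∀ y, G y ≤ ∑ m, κ y (Xs m) * U m :=
    GG_le κ Xs hXmeas hXdisj hXcover i j hij U hUi hUj fun m hmi hmj z hz => by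
      simp only [hU, hmi, hmj, if_false]
      exact le_iSup₂ (f := fun z (_ : z ∈ Xs m) => G z) z hz
  have hGL : ∀ y, ∑ m, κ y (Xs m) * L m ≤ G y :=
    le_GG κ Xs hXmeas hXdisj hXcover i j hij L hLi hLj fun m hmi hmj z hz => by
      simp only [hL, hmi, hmj, if_false]
      exact iInf₂_le (f := fun z (_ : z ∈ Xs m) => G z) z hz
  have hκ1 : ∀ y, ∑ m, κ y (Xs m) = 1 := by
    intro y
    rw [← tsum_fintype (L := .unconditional _), ← measure_iUnion hXdisj hXmeas, hXcover,
      measure_univ]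
  -- real versions
  set A := a.toReal with hAdef
  have hA : 1 ≤ A := by
    have := ENNReal.toReal_mono haT ha1
    simpa using this
  set q : Fin l → Fin l → ℝ := fun k m => (p k m).toReal with hq
  have hq0 : ∀ k m, 0 ≤ q k m := fun _ _ => ENNReal.toReal_nonneg
  set hr : Fin l → ℝ := fun m => (h m).toReal with hhr
  set Ur : Fin l → ℝ := fun m => (U m).toReal with hUr
  set Lr : Fin l → ℝ := fun m => (L m).toReal with hLr
  have toR : ∀ (c f : Fin l → ℝ≥0∞), (∀ m, c m ≠ ⊤) → (∀ m, f m ≤ 1) →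
      (∑ m, c m * f m).toReal = ∑ m, (c m).toReal * (f m).toReal := by
    intro c f hc hf
    rw [ENNReal.toReal_sum fun m _ => ENNReal.mul_ne_top (hc m) (fin (hf m))]
    simp only [ENNReal.toReal_mul]
  have sumNT : ∀ (c f : Fin l → ℝ≥0∞), (∀ m, c m ≠ ⊤) → (∀ m, f m ≤ 1) →
      (∑ m, c m * f m) ≠ ⊤ := fun c f hc hf =>
    ENNReal.sum_ne_top.mpr fun m _ => ENNReal.mul_ne_top (hc m) (fin (hf m))
  have hκT : ∀ y m, κ y (Xs m) ≠ ⊤ := fun y m => measure_ne_top _ _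
  have hκr : ∀ y, ∑ m, (κ y (Xs m)).toReal = 1 := by
    intro y
    rw [← ENNReal.toReal_sum fun m _ => hκT y m, hκ1, ENNReal.toReal_one]
  have shift : ∀ (c f : Fin l → ℝ) (t : ℝ), ∑ m, c m = 1 →
      ∑ m, c m * (f m - t) = ∑ m, c m * f m - t := by
    intro c f t hc
    simp only [mul_sub, Finset.sum_sub_distrib, ← Finset.sum_mul, hc, one_mul]
  have hup : ∀ k m, m ≠ k → ∀ y ∈ Xs k, (κ y (Xs m)).toReal ≤ A * q k m := by
    intro k m hmk y hy
    have := ENNReal.toReal_mono (ENNReal.mul_ne_top haT (hpT k m)) (hcomp k m hmk y hy).2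
    rwa [ENNReal.toReal_mul] at this
  have hlo : ∀ k m, m ≠ k → ∀ y ∈ Xs k, A⁻¹ * q k m ≤ (κ y (Xs m)).toReal := by
    intro k m hmk y hy
    have := ENNReal.toReal_mono (hκT y m) (hcomp k m hmk y hy).1
    rwa [ENNReal.toReal_mul, ENNReal.toReal_inv] at this
  have hharm : ∀ k ∈ Finset.univ \ ({i, j} : Finset (Fin l)), ∑ m, q k m * (hr m - hr k) = 0 := by
    intro k hk
    simp only [Finset.mem_sdiff, Finset.mem_univ, true_and, Finset.mem_insert,
      Finset.mem_singleton, not_or] at hk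
    have hqs : ∑ m, q k m = 1 := by
      rw [hq, ← ENNReal.toReal_sum fun m _ => hpT k m, hrow, ENNReal.toReal_one]
    rw [shift _ _ _ hqs, ← toR _ _ (hpT k) hh1, ← hgeq k]
    simp [hhr, hh, hk.1, hk.2]
  have hUsub : ∀ k ∈ Finset.univ \ ({i, j} : Finset (Fin l)),
      0 ≤ ∑ m, bang A q Ur k m * (Ur m - Ur k) := by
    intro k hk
    simp only [Finset.mem_sdiff, Finset.mem_univ, true_and, Finset.mem_insert,
      Finset.mem_singleton, not_or] at hk
    have hy : ∀ y ∈ Xs k, (G y).toReal ≤ Ur k + ∑ m, bang A q Ur k m * (Ur m - Ur k) := by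
      intro y hy
      have h1 := ENNReal.toReal_mono (sumNT _ _ (hκT y) hU1) (hGU y)
      rw [toR _ _ (hκT y) hU1] at h1
      have h2 := bang_max (A := A) (q := q) Ur k (fun m => (κ y (Xs m)).toReal)
        (fun m hm => hup k m hm y hy) (fun m hm => hlo k m hm y hy)
      rw [shift _ _ _ (hκr y)] at h2
      linarith
    have : Ur k ≤ Ur k + ∑ m, bang A q Ur k m * (Ur m - Ur k) := by
      obtain ⟨z, hz⟩ := hne k
      refine ENNReal.toReal_le_of_le_ofReal (ENNReal.toReal_nonneg.trans (hy z hz)) ?_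
      have e : U k = ⨆ z ∈ Xs k, G z := by simp [hU, hk.1, hk.2]
      rw [e]
      refine iSup₂_le fun y hyk => ?_
      rw [ENNReal.le_ofReal_iff_toReal_le (fin (hG1 y))
        (ENNReal.toReal_nonneg.trans (hy z hz))]
      exact hy y hyk
    linarith
  have hLsup : ∀ k ∈ Finset.univ \ ({i, j} : Finset (Fin l)),
      ∑ m, bang A q (fun m => -Lr m) k m * (Lr m - Lr k) ≤ 0 := by
    intro k hk
    simp only [Finset.mem_sdiff, Finset.mem_univ, true_and, Finset.mem_insert,
      Finset.mem_singleton, not_or] at hk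
    have hy : ∀ y ∈ Xs k, Lr k + ∑ m, bang A q (fun m => -Lr m) k m * (Lr m - Lr k)
        ≤ (G y).toReal := by
      intro y hy
      have h1 := ENNReal.toReal_mono (fin (hG1 y)) (hGL y)
      rw [toR _ _ (hκT y) hL1] at h1
      have h2 := bang_max (A := A) (q := q) (fun m => -Lr m) k (fun m => (κ y (Xs m)).toReal)
        (fun m hm => hup k m hm y hy) (fun m hm => hlo k m hm y hy)
      rw [shift _ _ _ (hκr y)] at h2
      have e1 : ∑ m, (κ y (Xs m)).toReal * -Lr m = -∑ m, (κ y (Xs m)).toReal * Lr m := by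
        simp
      have e2 : ∑ m, bang A q (fun m => -Lr m) k m * (-Lr m - -Lr k)
          = -∑ m, bang A q (fun m => -Lr m) k m * (Lr m - Lr k) := by
        rw [← Finset.sum_neg_distrib]
        exact Finset.sum_congr rfl fun m _ => by ring
      rw [e1, e2] at h2
      linarith
    have : Lr k + ∑ m, bang A q (fun m => -Lr m) k m * (Lr m - Lr k) ≤ Lr k := by
      rw [← ENNReal.ofReal_le_iff_le_toReal (fin (hL1 k))]
      have e : L k = ⨅ z ∈ Xs k, G z := by simp [hL, hk.1, hk.2]
      rw [e]
      refine le_iInf₂ fun y hyk => ?_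
      rw [ENNReal.ofReal_le_iff_le_toReal (fin (hG1 y))]
      exact hy y hyk
    linarith
  -- the elimination lemma
  have hcard : (Finset.univ \ ({i, j} : Finset (Fin l))).card = l - 2 := by
    rw [Finset.card_sdiff_of_subset (Finset.subset_univ _), Finset.card_pair hij.symm]
    simp
  have huni : Finset.univ \ ({i, j} : Finset (Fin l)) ∪ {i, j} = Finset.univ :=
    Finset.sdiff_union_of_subset (Finset.subset_univ _)
  have hndq : ∀ D ⊆ Finset.univ \ ({i, j} : Finset (Fin l)), D.Nonempty →
      ∃ x ∈ D, ∃ m ∈ (Finset.univ : Finset (Fin l)), m ∉ D ∧ 0 < q x m := by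
    intro D hD ⟨y, hy⟩
    have hiD : i ∉ D := fun h => by simpa using hD h
    obtain ⟨z, hz, m, hm, hp⟩ := irr_exit p hirr (D : Set (Fin l)) (x := y) (y := i)
      (by simpa using hy) (by simpa using hiD)
    exact ⟨z, by simpa using hz, m, Finset.mem_univ _, by simpa using hm,
      ENNReal.toReal_pos hp.ne' (hpT z m)⟩
  have hndU : ∀ D ⊆ Finset.univ \ ({i, j} : Finset (Fin l)), D.Nonempty →
      ∃ x ∈ D, ∃ m ∈ (Finset.univ : Finset (Fin l)), m ∉ D ∧ 0 < bang A q Ur x m := by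
    intro D hD hn
    obtain ⟨z, hz, m, hm, hmD, hp⟩ := hndq D hD hn
    refine ⟨z, hz, m, hm, hmD, ?_⟩
    have h1 := le_bang hA hq0 Ur z m
    exact pos_of_mul_pos_right (hp.trans_le h1) (by linarith)
  set c := 3 ^ (l - 2) - 1 with hc
  have key1 := elim {i, j} (l - 2) (Finset.univ \ {i, j}) hcard Finset.sdiff_disjoint A hA
    (bang A q Ur) q (bang_nonneg hA hq0 Ur) hq0 (bang_le hA hq0 Ur) (le_bang hA hq0 Ur)
    (by rw [huni]; exact hndU) Ur hr (fun _ => ENNReal.toReal_nonneg)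
    (by intro b hb; rcases Finset.mem_insert.mp hb with rfl | hb
        · simp [hUr, hhr, hUi, hhi]
        · rw [Finset.mem_singleton.mp hb]; simp [hUr, hhr, hUj, hhj])
    (by rw [huni]; exact hUsub) (by rw [huni]; exact fun k hk => (hharm k hk).le)
  have key2 := elim {i, j} (l - 2) (Finset.univ \ {i, j}) hcard Finset.sdiff_disjoint A hA
    q (bang A q fun m => -Lr m) hq0 (bang_nonneg hA hq0 _) (le_bang hA hq0 _) (bang_le hA hq0 _)
    (by rw [huni]; exact hndq) hr Lr (fun _ => ENNReal.toReal_nonneg)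
    (by intro b hb; rcases Finset.mem_insert.mp hb with rfl | hb
        · simp [hLr, hhr, hLi, hhi]
        · rw [Finset.mem_singleton.mp hb]; simp [hLr, hhr, hLj, hhj])
    (by rw [huni]; exact fun k hk => (hharm k hk).ge) (by rw [huni]; exact hLsup)
  have back : ∀ f f' : Fin l → ℝ≥0∞, (∀ m, f m ≤ 1) → (∀ m, f' m ≤ 1) → f i = 0 →
      f j = 1 → f' j = 1 →
      (∀ m ∈ Finset.univ \ ({i, j} : Finset (Fin l)), (f m).toReal ≤ A ^ c * (f' m).toReal) →
      ∀ m, f m ≤ a ^ c * f' m := by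
    intro f f' hf hf' hi hj hj' hm m
    by_cases h1 : m = i
    · rw [h1, hi]; exact zero_le
    by_cases h2 : m = j
    · rw [h2, hj, hj', mul_one]; exact one_le_pow₀ ha1
    rw [← ENNReal.toReal_le_toReal (fin (hf m))
      (ENNReal.mul_ne_top (ENNReal.pow_ne_top haT) (fin (hf' m))), ENNReal.toReal_mul,
      ENNReal.toReal_pow]
    exact hm m (by simp [h1, h2])
  have hUh := back U h hU1 hh1 hUi hUj hhj key1
  have hhL := back h L hh1 hL1 hhi hhj hLj key2
  have hpow : a ^ (c + 1) ≤ a ^ (4 ^ (l - 2) + 1) := by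
    refine pow_le_pow_right₀ ha1 ?_
    have : 3 ^ (l - 2) ≤ 4 ^ (l - 2) := Nat.pow_le_pow_left (by norm_num) _
    exact Nat.add_le_add_right ((Nat.sub_le _ _).trans this) 1
  constructor
  · calc g i = ∑ m, p i m * h m := hgeq i
      _ ≤ ∑ m, a ^ (c + 1) * (κ x (Xs m) * L m) := by
        refine Finset.sum_le_sum fun m _ => ?_
        by_cases hm : m = i
        · rw [hm, hhi, mul_zero]; exact zero_le
        have h1 : p i m ≤ a * κ x (Xs m) := by
          have := mul_le_mul_right (hcomp i m hm x hx).1 a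
          rwa [← mul_assoc, ENNReal.mul_inv_cancel ha0 haT, one_mul] at this
        calc p i m * h m ≤ (a * κ x (Xs m)) * (a ^ c * L m) := mul_le_mul' h1 (hhL m)
          _ = _ := by ring
      _ ≤ a ^ (c + 1) * G x := by rw [← Finset.mul_sum]; gcongr; exact hGL x
      _ ≤ _ := by gcongr
  · calc G x ≤ ∑ m, κ x (Xs m) * U m := hGU x
      _ ≤ ∑ m, a ^ (c + 1) * (p i m * h m) := by
        refine Finset.sum_le_sum fun m _ => ?_
        by_cases hm : m = i
        · rw [hm, hUi, mul_zero]; exact zero_le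
        calc κ x (Xs m) * U m ≤ (a * p i m) * (a ^ c * h m) :=
              mul_le_mul' (hcomp i m hm x hx).2 (hUh m)
          _ = _ := by ring
      _ = a ^ (c + 1) * g i := by rw [← Finset.mul_sum, hgeq i]
      _ ≤ _ := by gcongr

/-- For every `i`, every `j ≠ i`, and every `x ∈ 𝒳_i`:
`a^{−4^{l−2}−1} · P_i(T_j < T_i⁺) ≤ P_x(T̃_j < T̃_i⁺) ≤ a^{4^{l−2}+1} · P_i(T_j < T_i⁺)`. -/
theorem hit_before_return_prob_comparison {l : ℕ} (hl : 2 ≤ l)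
    (p : Fin l → Fin l → ℝ≥0∞) (hrow : ∀ i, ∑ j, p i j = 1)
    (hirr : Irreducible p)
    (P : Fin l → Measure (ℕ → Fin l)) (hP : IsMarkovChainLaw p P)
    (Xs : Fin l → Set X) (hXmeas : ∀ i, MeasurableSet (Xs i))
    (hXdisj : Pairwise fun i j => Disjoint (Xs i) (Xs j))
    (hXcover : (⋃ i, Xs i) = Set.univ)
    (κ : Kernel X X) (hκ : IsMarkovKernel κ)
    (Q : X → Measure (ℕ → X)) (hQ : IsMarkovChainLawKernel κ Q)
    (a : ℝ≥0∞) (ha1 : 1 ≤ a) (haT : a ≠ ⊤)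
    (hcomp : ∀ (i j : Fin l), j ≠ i → ∀ x ∈ Xs i,
      a⁻¹ * p i j ≤ κ x (Xs j) ∧ κ x (Xs j) ≤ a * p i j)
    (i : Fin l) (j : Fin l) (hij : j ≠ i)
    (x : X) (hx : x ∈ Xs i) :
    (a ^ (4 ^ (l - 2) + 1))⁻¹ * P i {ω | hitT j ω < hitTpos i ω}
        ≤ Q x {ω | hitS (Xs j) ω < hitSpos (Xs i) ω} ∧
      Q x {ω | hitS (Xs j) ω < hitSpos (Xs i) ω}
        ≤ a ^ (4 ^ (l - 2) + 1) * P i {ω | hitT j ω < hitTpos i ω} := by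
  have h1 := event_eq κ Q hQ (hXmeas i) (hXmeas j) (hXdisj hij.symm) x hx
  have h2 : P i {ω | hitT j ω < hitTpos i ω} = GG (kp p) ({i} ∪ {j})ᶜ {j} i :=
    event_eq (kp p) P (kp_law p P hP) (I := {i}) (J := {j}) MeasurableSet.of_discrete
      MeasurableSet.of_discrete (by simpa using hij.symm) i rfl
  have h3 := main_comparison hl p hrow hirr Xs hXmeas hXdisj hXcover κ hκ a ha1 haT hcomp i j hij
    x hx
  rw [h1, h2]
  refine ⟨?_, h3.2⟩
  rw [mul_comm, ← div_eq_mul_inv]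
  exact ENNReal.div_le_of_le_mul' h3.1

end FW
end
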